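/- Let ψ : [0,∞) → [0,∞) be an increasing function satisfying ψ(0) = 0, lim_{u→0⁺} ψ(u) = 0, and limsup_{u→∞} (log ψ(u))/u < ∞. Then for every f ∈ L log L(𝕋²), for almost every (x,y) ∈ 𝕋², lim_{m→∞} (1/(m+1)) Σ_{n=0}^{m} ψ(|S_{nn}(x,y,f) − f(x,y)|) = 0. -/

import Mathlib

open MeasureTheory Filter Set

noncomputable section

/-- `[-π, π)`, a fundamental domain for the circle `𝕋 = ℝ/2πℤ`. -/
def T1 : Set ℝ := Set.Ico (-Real.pi) Real.pi

/-- `[-π, π)²`, a fundamental domain for the torus `𝕋²`. -/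
def T2 : Set (ℝ × ℝ) := T1 ×ˢ T1

/-- `log⁺ u = log u` for `u > 1`, and `0` otherwise. -/
def logPlus (u : ℝ) : ℝ := if 1 < u then Real.log u else 0

/-- `f` is `2π`-periodic in each variable. -/
def Biperiodic (f : ℝ × ℝ → ℝ) : Prop :=
  ∀ x y : ℝ, f (x + 2 * Real.pi, y) = f (x, y) ∧ f (x, y + 2 * Real.pi) = f (x, y)

/-- Fourier coefficients `f̂(m,n)` of a function on `𝕋²`. -/
def fourierCoef2 (f : ℝ × ℝ → ℝ) (m n : ℤ) : ℂ :=
  (1 / (4 * (Real.pi : ℂ) ^ 2)) *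
    ∫ p in T2, (f p : ℂ) * Complex.exp (-Complex.I * ((m : ℂ) * (p.1 : ℂ) + (n : ℂ) * (p.2 : ℂ)))

/-- Quadratic partial sums `S_{nn}(x, y, f)` of the double Fourier series.
(For real `f` the symmetric sum is real, so we take the real part.) -/
def Snn (f : ℝ × ℝ → ℝ) (n : ℕ) (x y : ℝ) : ℝ :=
  (∑ m ∈ Finset.Icc (-(n : ℤ)) (n : ℤ), ∑ k ∈ Finset.Icc (-(n : ℤ)) (n : ℤ),
    fourierCoef2 f m k * Complex.exp (Complex.I * ((m : ℂ) * (x : ℂ) + (k : ℂ) * (y : ℂ)))).re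

/-- The `BMO[0,1]` norm:
`‖g‖_BMO = sup_{I ⊂ [0,1]} (1/|I|) ∫_I |g - g_I| + |∫_0^1 g|`. -/
def bmoNorm (g : ℝ → ℝ) : ℝ :=
  (⨆ I : {p : ℝ × ℝ // 0 ≤ p.1 ∧ p.1 < p.2 ∧ p.2 ≤ 1},
      (I.1.2 - I.1.1)⁻¹ *
        ∫ t in Set.Icc I.1.1 I.1.2,
          |g t - (I.1.2 - I.1.1)⁻¹ * ∫ s in Set.Icc I.1.1 I.1.2, g s|) +
    |∫ t in Set.Icc (0 : ℝ) 1, g t|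

/-- The step function `Σ_{k=0}^n ξ_k 𝟙_{δ_k^n}` with `δ_k^n = [k/(n+1), (k+1)/(n+1)]`. -/
def stepFun (ξ : ℕ → ℝ) (n : ℕ) (t : ℝ) : ℝ :=
  ∑ k ∈ Finset.range (n + 1),
    Set.indicator (Set.Icc ((k : ℝ) / ((n : ℝ) + 1)) (((k : ℝ) + 1) / ((n : ℝ) + 1)))
      (fun _ => ξ k) t

/-- `bmo[ξ_n] = sup_{n ≥ 0} ‖Σ_{k=0}^n ξ_k 𝟙_{δ_k^n}‖_BMO`. -/
def bmoSeq (ξ : ℕ → ℝ) : ℝ := ⨆ n : ℕ, bmoNorm (stepFun ξ n)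

/-- `L` is the principal value `p.v. ∫_𝕋 g`, i.e. the limit as `ε → 0⁺` of the
integrals over `{ε < |t| < π}`. -/
def pvT1 (g : ℝ → ℝ) (L : ℝ) : Prop :=
  Filter.Tendsto (fun ε : ℝ => ∫ t in {t : ℝ | ε < |t| ∧ |t| < Real.pi}, g t)
    (nhdsWithin 0 (Set.Ioi 0)) (nhds L)

/-- `L` is the two-dimensional principal value `p.v. ∬_{𝕋²} g`, the limit as `ε → 0⁺`
of the integrals over `{ε < |t| < π, ε < |s| < π}`. -/
def pvT2 (g : ℝ × ℝ → ℝ) (L : ℝ) : Prop :=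
  Filter.Tendsto
    (fun ε : ℝ =>
      ∫ q in {q : ℝ × ℝ | (ε < |q.1| ∧ |q.1| < Real.pi) ∧ ε < |q.2| ∧ |q.2| < Real.pi}, g q)
    (nhdsWithin 0 (Set.Ioi 0)) (nhds L)

/-- Luxemburg norm with respect to a Young function `M`. -/
def luxNorm {α : Type*} [MeasurableSpace α] (μ : Measure α) (M : ℝ → ℝ) (g : α → ℝ) : ℝ :=
  sInf {lam : ℝ | 0 < lam ∧ ∫⁻ x, ENNReal.ofReal (M (|g x| / lam)) ∂μ ≤ 1}

/-- The Young function `Φ(t) = t log⁺ t`. -/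
def PhiY (t : ℝ) : ℝ := t * logPlus t

/-- The Young function `Ψ(t) = eᵗ - 1`. -/
def PsiY (t : ℝ) : ℝ := Real.exp t - 1

/-- normalized Lebesgue measure on the circle -/
def mu : Measure ℝ := ENNReal.ofReal (2 * Real.pi)⁻¹ • volume.restrict T1

lemma two_pi_pos' : (0 : ℝ) < 2 * Real.pi := by positivity

instance mu_prob : IsProbabilityMeasure mu := by
  constructor
  simp only [mu, T1, Measure.smul_apply, smul_eq_mul, Measure.restrict_apply MeasurableSet.univ,
    Set.univ_inter, Real.volume_Ico]
  rw [← ENNReal.ofReal_mul (by positivity)]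
  have : (2 * Real.pi)⁻¹ * (Real.pi - -Real.pi) = 1 := by
    field_simp; ring
  rw [this, ENNReal.ofReal_one]

lemma integral_mu {E : Type*} [NormedAddCommGroup E] [NormedSpace ℝ E] (f : ℝ → E) :
    ∫ t, f t ∂mu = (2 * Real.pi)⁻¹ • ∫ t in (-Real.pi)..Real.pi, f t := by
  rw [mu, integral_smul_measure, ENNReal.toReal_ofReal (by positivity), T1,
    intervalIntegral.integral_of_le (by linarith [Real.pi_pos]), integral_Ico_eq_integral_Ioc]

lemma integrable_mu_iff {E : Type*} [NormedAddCommGroup E] (f : ℝ → E) :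
    Integrable f mu ↔ IntegrableOn f T1 := by
  rw [mu, IntegrableOn, integrable_smul_measure]
  · simp [Real.pi_pos]
  · simp

lemma integrable_mu {E : Type*} [NormedAddCommGroup E] {f : ℝ → E} (hf : Continuous f) :
    Integrable f mu := by
  rw [integrable_mu_iff]
  exact (hf.continuousOn.integrableOn_compact (isCompact_Icc (a := -Real.pi) (b := Real.pi))).mono_set
    Ico_subset_Icc_self

lemma integral_mu_add {E : Type*} [NormedAddCommGroup E] [NormedSpace ℝ E] {f : ℝ → E}
    (hf : Function.Periodic f (2 * Real.pi)) (x : ℝ) :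
    ∫ t, f (x + t) ∂mu = ∫ t, f t ∂mu := by
  rw [integral_mu, integral_mu, intervalIntegral.integral_comp_add_left]
  congr 1
  have := hf.intervalIntegral_add_eq (x + -Real.pi) (-Real.pi)
  convert this using 2 <;> ring

lemma integral_mu_neg {E : Type*} [NormedAddCommGroup E] [NormedSpace ℝ E] (f : ℝ → E) :
    ∫ t, f (-t) ∂mu = ∫ t, f t ∂mu := by
  rw [integral_mu, integral_mu, intervalIntegral.integral_comp_neg]
  simp

lemma integral_mu_sub {E : Type*} [NormedAddCommGroup E] [NormedSpace ℝ E] {f : ℝ → E}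
    (hf : Function.Periodic f (2 * Real.pi)) (x : ℝ) :
    ∫ t, f (x - t) ∂mu = ∫ t, f t ∂mu := by
  rw [← integral_mu_add hf x, ← integral_mu_neg]
  simp [sub_eq_add_neg]

/-- `e^{it}` -/
def ee (t : ℝ) : ℂ := Complex.exp (t * Complex.I)

lemma ee_eq_circleMap (t : ℝ) : ee t = circleMap 0 1 t := by simp [ee, circleMap]
@[fun_prop] lemma continuous_ee : Continuous ee := by unfold ee; fun_prop
@[simp] lemma norm_ee (t : ℝ) : ‖ee t‖ = 1 := by simp [ee, Complex.norm_exp_ofReal_mul_I]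
lemma ee_ne (t : ℝ) : ee t ≠ 0 := by simp [ee]
lemma ee_add (s t : ℝ) : ee (s + t) = ee s * ee t := by
  simp [ee, add_mul, Complex.exp_add]
lemma ee_neg (t : ℝ) : ee (-t) = (ee t)⁻¹ := by
  simp [ee, Complex.exp_neg]
@[simp] lemma ee_zero : ee 0 = 1 := by simp [ee]
lemma ee_sub (s t : ℝ) : ee (s - t) = ee s * (ee t)⁻¹ := by
  rw [sub_eq_add_neg, ee_add, ee_neg]
lemma ee_periodic : Function.Periodic ee (2 * Real.pi) := by
  intro t
  have := Complex.exp_periodic (t * Complex.I)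
  simp only [ee]; rw [← this]; push_cast; ring_nf
lemma ee_conj (t : ℝ) : (starRingEnd ℂ) (ee t) = (ee t)⁻¹ := by
  rw [← ee_neg]; simp [ee, ← Complex.exp_conj]

lemma circleAverage_eq {E : Type*} [NormedAddCommGroup E] [NormedSpace ℝ E] (f : ℂ → E) :
    Real.circleAverage f 0 1 = ∫ t, f (ee t) ∂mu := by
  rw [integral_mu, Real.circleAverage_def]
  simp_rw [← ee_eq_circleMap]
  congr 1
  have hp : Function.Periodic (fun t => f (ee t)) (2 * Real.pi) := fun t => by
    simp only [ee_periodic t]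
  have := hp.intervalIntegral_add_eq (-Real.pi) 0
  rw [zero_add] at this
  rw [← this]
  congr 1; ring

/-- mean value property -/
lemma mean_value {f : ℂ → ℂ} (hf : DiffContOnCl ℂ f (Metric.ball 0 1)) :
    ∫ t, f (ee t) ∂mu = f 0 := by
  rw [← circleAverage_eq]
  apply DiffContOnCl.circleAverage
  simpa using hf

/-- Poisson kernel -/
def Pk (r t : ℝ) : ℝ := (1 - r ^ 2) / ((1 - r) ^ 2 + r * (2 - 2 * Real.cos t))

lemma normSq_one_sub (r t : ℝ) : ‖1 - r * ee t‖ ^ 2 = (1 - r) ^ 2 + r * (2 - 2 * Real.cos t) := by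
  rw [← Complex.normSq_eq_norm_sq, Complex.normSq_apply]
  simp [ee, Complex.exp_ofReal_mul_I_re, Complex.exp_ofReal_mul_I_im]
  linear_combination r ^ 2 * Real.sin_sq_add_cos_sq t

lemma Pk_den_pos {r : ℝ} (h0 : 0 ≤ r) (h1 : r < 1) (t : ℝ) :
    0 < (1 - r) ^ 2 + r * (2 - 2 * Real.cos t) := by
  have : 0 ≤ 2 - 2 * Real.cos t := by linarith [Real.cos_le_one t]
  have h2 : 0 < (1 - r) ^ 2 := by nlinarith
  positivity

lemma one_sub_ne {r : ℝ} (h0 : 0 ≤ r) (h1 : r < 1) (t : ℝ) : (1 : ℂ) - r * ee t ≠ 0 := by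
  intro h
  have := Pk_den_pos h0 h1 t
  rw [← normSq_one_sub, h] at this
  simp at this

lemma Pk_nonneg {r : ℝ} (h0 : 0 ≤ r) (h1 : r < 1) (t : ℝ) : 0 ≤ Pk r t := by
  apply div_nonneg _ (Pk_den_pos h0 h1 t).le
  nlinarith

lemma Pk_pos {r : ℝ} (h0 : 0 ≤ r) (h1 : r < 1) (t : ℝ) : 0 < Pk r t := by
  apply div_pos _ (Pk_den_pos h0 h1 t)
  nlinarith

lemma continuous_Pk {r : ℝ} (h0 : 0 ≤ r) (h1 : r < 1) : Continuous (Pk r) := by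
  unfold Pk
  exact Continuous.div (by fun_prop) (by fun_prop) (fun t => (Pk_den_pos h0 h1 t).ne')

lemma Pk_neg (r t : ℝ) : Pk r (-t) = Pk r t := by simp [Pk]
lemma Pk_symm (r s t : ℝ) : Pk r (s - t) = Pk r (t - s) := by rw [← Pk_neg]; ring_nf
lemma Pk_periodic (r : ℝ) : Function.Periodic (Pk r) (2 * Real.pi) := by
  intro t; simp [Pk]

lemma poissonKernel_eq (r x t : ℝ) :
    poissonKernel 0 (r * ee x) (ee t) = Pk r (x - t) := by
  have h1 : ‖ee t - r * ee x‖ = ‖1 - r * ee (x - t)‖ := by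
    have : ee t - r * ee x = ee t * (1 - r * ee (x - t)) := by
      rw [ee_sub]; field_simp [ee_ne]
    rw [this, norm_mul, norm_ee, one_mul]
  simp only [poissonKernel, sub_zero, norm_ee, norm_mul, Complex.norm_real, Real.norm_eq_abs,
    mul_one, sq_abs, one_pow, h1, normSq_one_sub, Pk]

lemma mem_ball_r {r : ℝ} (h0 : 0 ≤ r) (h1 : r < 1) (x : ℝ) : (r * ee x : ℂ) ∈ Metric.ball (0:ℂ) 1 := by
  simp [abs_of_nonneg h0, h1]

/-- Poisson formula -/
lemma poisson_formula {f : ℂ → ℂ} (hf : DiffContOnCl ℂ f (Metric.ball 0 1)) {r : ℝ}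
    (h0 : 0 ≤ r) (h1 : r < 1) (x : ℝ) :
    ∫ t, (Pk r (x - t) : ℂ) * f (ee t) ∂mu = f (r * ee x) := by
  rw [← hf.circleAverage_poissonKernel_smul (mem_ball_r h0 h1 x), circleAverage_eq]
  simp [poissonKernel_eq]

lemma integral_Pk_sub {r : ℝ} (h0 : 0 ≤ r) (h1 : r < 1) (x : ℝ) :
    ∫ t, Pk r (x - t) ∂mu = 1 := by
  have := poisson_formula (f := fun _ => 1) diffContOnCl_const h0 h1 x
  simp only [mul_one] at this
  rw [integral_complex_ofReal] at this
  exact_mod_cast this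

lemma integral_Pk_sub' {r : ℝ} (h0 : 0 ≤ r) (h1 : r < 1) (x : ℝ) :
    ∫ t, Pk r (t - x) ∂mu = 1 := by
  simp_rw [Pk_symm r _ x]
  exact integral_Pk_sub h0 h1 x

lemma diffContOnCl_pow (n : ℕ) : DiffContOnCl ℂ (fun z : ℂ => z ^ n) (Metric.ball 0 1) :=
  (differentiable_pow n).diffContOnCl

lemma poisson_pow {r : ℝ} (h0 : 0 ≤ r) (h1 : r < 1) (x : ℝ) (n : ℕ) :
    ∫ t, (Pk r (x - t) : ℂ) * ee t ^ n ∂mu = r ^ n * ee x ^ n := by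
  rw [poisson_formula (diffContOnCl_pow n) h0 h1 x, mul_pow]

lemma poisson_zpow {r : ℝ} (h0 : 0 ≤ r) (h1 : r < 1) (x : ℝ) (b : ℤ) :
    ∫ t, (Pk r (x - t) : ℂ) * ee t ^ b ∂mu = r ^ b.natAbs * ee x ^ b := by
  obtain ⟨n, rfl | rfl⟩ := b.eq_nat_or_neg
  · simpa using poisson_pow h0 h1 x n
  · have := congrArg (starRingEnd ℂ) (poisson_pow h0 h1 x n)
    rw [← integral_conj] at this
    simpa [ee_conj] using this

lemma integral_ee_zpow (b : ℤ) : ∫ t, ee t ^ b ∂mu = if b = 0 then 1 else 0 := by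
  have := poisson_zpow (r := 0) le_rfl zero_lt_one 0 b
  simp [Pk] at this
  rw [this]
  by_cases h : b = 0
  · simp [h]
  · simp [h]

/-- Fourier coefficients of the Cauchy kernel -/
lemma cauchy_coef_pos {r : ℝ} (h0 : 0 ≤ r) (h1 : r < 1) (l : ℕ) :
    ∫ t, ee t ^ l * (1 - r * ee t)⁻¹ ∂mu = if l = 0 then 1 else 0 := by
  have hd : DiffContOnCl ℂ (fun z : ℂ => z ^ l * (1 - r * z)⁻¹) (Metric.ball 0 1) := by
    apply DifferentiableOn.diffContOnCl
    rw [closure_ball _ one_ne_zero]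
    intro z hz
    apply DifferentiableAt.differentiableWithinAt
    have : (1 : ℂ) - r * z ≠ 0 := by
      intro h
      have h2 : (r : ℂ) * z = 1 := by linear_combination -h
      have h3 : ‖(r : ℂ) * z‖ = 1 := by rw [h2]; simp
      rw [norm_mul, Complex.norm_real, Real.norm_of_nonneg h0] at h3
      have : ‖z‖ ≤ 1 := by simpa using hz
      nlinarith [norm_nonneg z]
    fun_prop (disch := assumption)
  have := mean_value hd
  rw [this]
  by_cases h : l = 0 <;> simp [h]

lemma continuous_cauchy {r : ℝ} (h0 : 0 ≤ r) (h1 : r < 1) :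
    Continuous (fun t => (1 - r * ee t)⁻¹ : ℝ → ℂ) :=
  Continuous.inv₀ (by fun_prop) (one_sub_ne h0 h1)

@[fun_prop] lemma continuous_ee_zpow (b : ℤ) : Continuous (fun t => ee t ^ b) :=
  continuous_ee.zpow₀ b (fun t => Or.inl (ee_ne t))

lemma cauchy_coef_neg {r : ℝ} (h0 : 0 ≤ r) (h1 : r < 1) (j : ℕ) :
    ∫ t, ee t ^ (-(j:ℤ)) * (1 - r * ee t)⁻¹ ∂mu = r ^ j := by
  induction j with
  | zero => simpa using cauchy_coef_pos h0 h1 0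
  | succ j ih =>
    have : ∀ t, ee t ^ (-((j+1 : ℕ):ℤ)) * (1 - r * ee t)⁻¹
        = ee t ^ (-((j+1 : ℕ):ℤ)) + r * (ee t ^ (-(j:ℤ)) * (1 - r * ee t)⁻¹) := by
      intro t
      have h2 := one_sub_ne h0 h1 t
      have h3 : ee t ^ (-(j:ℤ)) = ee t ^ (-((j+1 : ℕ):ℤ)) * ee t := by
        rw [← zpow_add_one₀ (ee_ne t)]; push_cast; ring_nf
      rw [h3]; field_simp; ring
    simp_rw [this]
    rw [integral_add, integral_const_mul, ih, integral_ee_zpow]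
    · rw [if_neg (by push_cast; omega)]; ring
    · exact integrable_mu (by fun_prop)
    · exact integrable_mu (continuous_const.mul ((continuous_ee_zpow _).mul (continuous_cauchy h0 h1)))

lemma cauchy_coef {r : ℝ} (h0 : 0 ≤ r) (h1 : r < 1) (b : ℤ) :
    ∫ t, ee t ^ b * (1 - r * ee t)⁻¹ ∂mu = if b ≤ 0 then (r : ℂ) ^ b.natAbs else 0 := by
  obtain ⟨n, rfl | rfl⟩ := b.eq_nat_or_neg
  · have := cauchy_coef_pos h0 h1 n
    simp only [zpow_natCast, this]
    by_cases h : n = 0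
    · simp [h]
    · rw [if_neg h, if_neg (by omega)]
  · rw [cauchy_coef_neg h0 h1 n, if_pos (by omega)]; simp

/-! ### Dyadic trees -/

def ek (k : ℕ) : ℝ := (1 / 2 : ℝ) ^ k

lemma ek_pos (k : ℕ) : 0 < ek k := by unfold ek; positivity
lemma ek_zero : ek 0 = 1 := by simp [ek]
lemma ek_succ (k : ℕ) : ek (k + 1) = ek k / 2 := by unfold ek; ring
lemma ek_le_one (k : ℕ) : ek k ≤ 1 := pow_le_one₀ (by norm_num) (by norm_num)
lemma ek_le_half {k : ℕ} (hk : 1 ≤ k) : ek k ≤ 1 / 2 := by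
  obtain ⟨k, rfl⟩ := Nat.exists_eq_add_of_le' hk
  rw [ek_succ]; linarith [ek_le_one k]
lemma ek_mul_two_pow (k : ℕ) : ek k * 2 ^ k = 1 := by
  unfold ek; rw [← mul_pow]; norm_num

lemma sum_range_mul_split (F : ℕ → ℝ) (n c : ℕ) :
    ∑ i ∈ Finset.range (n * c), F i = ∑ l ∈ Finset.range n, ∑ t ∈ Finset.range c, F (l * c + t) := by
  induction n with
  | zero => simp
  | succ n ih => rw [Nat.succ_mul, Finset.sum_range_add, ih, Finset.sum_range_succ]

def TreeAdd (m : ℕ → ℕ → ℝ) : Prop := ∀ k i, m k i = m (k + 1) (2 * i) + m (k + 1) (2 * i + 1)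

lemma tree_sum {m : ℕ → ℕ → ℝ} (hm : TreeAdd m) (j l d : ℕ) :
    m j l = ∑ t ∈ Finset.range (2 ^ d), m (j + d) (l * 2 ^ d + t) := by
  induction d with
  | zero => simp
  | succ d ih =>
    rw [ih, pow_succ, sum_range_mul_split]
    refine Finset.sum_congr rfl fun t _ => ?_
    rw [hm, Finset.sum_range_succ, Finset.sum_range_succ, Finset.sum_range_zero, zero_add]
    congr 2 <;> ring

lemma tree_sum_sq {m : ℕ → ℕ → ℝ} (hm : TreeAdd m) (h0 : ∀ k i, 0 ≤ m k i) (j l d : ℕ) :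
    ∑ t ∈ Finset.range (2 ^ d), (m (j + d) (l * 2 ^ d + t)) ^ 2 ≤ (m j l) ^ 2 := by
  rw [tree_sum hm j l d]
  exact Finset.sum_sq_le_sq_sum_of_nonneg fun i _ => h0 _ _

def SelD (m : ℕ → ℕ → ℝ) (lam : ℝ) (j l : ℕ) : Prop :=
  lam * ek j < m j l ∧ ∀ j' < j, m j' (l / 2 ^ (j - j')) ≤ lam * ek j'

lemma sel_exists {m : ℕ → ℕ → ℝ} {lam : ℝ} {k i : ℕ} (h : lam * ek k < m k i) :
    ∃ j ≤ k, SelD m lam j (i / 2 ^ (k - j)) := by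
  classical
  have hex : ∃ j, j ≤ k ∧ lam * ek j < m j (i / 2 ^ (k - j)) := ⟨k, le_rfl, by simpa using h⟩
  refine ⟨Nat.find hex, (Nat.find_spec hex).1, (Nat.find_spec hex).2, fun j' hj' => ?_⟩
  have h1 := Nat.find_min hex hj'
  have h2 := (Nat.find_spec hex).1
  rw [Nat.div_div_eq_div_mul, ← pow_add]
  have : k - Nat.find hex + (Nat.find hex - j') = k - j' := by omega
  rw [this]
  by_contra h3
  exact h1 ⟨by omega, not_le.mp h3⟩

lemma sel_bound {m : ℕ → ℕ → ℝ} (hm : TreeAdd m) (h0 : ∀ k i, 0 ≤ m k i) {lam : ℝ}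
    (h00 : m 0 0 ≤ lam) {j l : ℕ} (hl : l < 2 ^ j) (h : SelD m lam j l) :
    1 ≤ j ∧ m j l ≤ 2 * lam * ek j := by
  rcases j with _ | j
  · simp at hl; subst hl
    have := h.1
    rw [ek_zero] at this; linarith
  · refine ⟨by omega, ?_⟩
    have h1 := h.2 j (by omega)
    have h2 : j + 1 - j = 1 := by omega
    rw [h2, pow_one, hm] at h1
    rw [ek_succ]
    have : m (j+1) l ≤ m (j + 1) (2 * (l / 2)) + m (j + 1) (2 * (l / 2) + 1) := by
      rcases Nat.even_or_odd' l with ⟨c, rfl | rfl⟩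
      · have : 2 * c / 2 = c := by omega
        rw [this]; linarith [h0 (j+1) (2*c+1)]
      · have : (2 * c + 1) / 2 = c := by omega
        rw [this]; linarith [h0 (j+1) (2*c)]
    linarith

lemma sel_unique {m : ℕ → ℕ → ℝ} {lam : ℝ} {K i j j' : ℕ} (hj : j ≤ K) (hj' : j' ≤ K)
    (h : SelD m lam j (i / 2 ^ (K - j))) (h' : SelD m lam j' (i / 2 ^ (K - j'))) : j = j' := by
  by_contra hne
  wlog hlt : j < j' generalizing j j'
  · exact this hj' hj h' h (Ne.symm hne) (by omega)
  have h1 := h'.2 j hlt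
  rw [Nat.div_div_eq_div_mul, ← pow_add] at h1
  have : K - j' + (j' - j) = K - j := by omega
  rw [this] at h1
  linarith [h.1]

open Classical in
lemma sel_sum {m : ℕ → ℕ → ℝ} (hm : TreeAdd m) (h0 : ∀ k i, 0 ≤ m k i) {lam : ℝ}
    (hlam : 0 < lam) (K : ℕ) :
    ∑ j ∈ Finset.range (K + 1), ∑ l ∈ Finset.range (2 ^ j),
      (if SelD m lam j l then ek j else 0) ≤ m 0 0 / lam := by
  rw [le_div_iff₀ hlam, Finset.sum_mul]
  calc ∑ j ∈ Finset.range (K + 1), (∑ l ∈ Finset.range (2 ^ j),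
      (if SelD m lam j l then ek j else 0)) * lam
      ≤ ∑ j ∈ Finset.range (K + 1), ∑ i ∈ Finset.range (2 ^ K),
        (if SelD m lam j (i / 2 ^ (K - j)) then m K i else 0) := by
        refine Finset.sum_le_sum fun j hj => ?_
        have hjK : j ≤ K := by simp at hj; omega
        have e : 2 ^ K = 2 ^ j * 2 ^ (K - j) := by rw [← pow_add]; congr 1; omega
        rw [Finset.sum_mul, e, sum_range_mul_split]
        refine Finset.sum_le_sum fun l _ => ?_
        have h3 : ∀ t ∈ Finset.range (2 ^ (K - j)), (l * 2 ^ (K - j) + t) / 2 ^ (K - j) = l := by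
          intro t ht
          rw [Finset.mem_range] at ht
          rw [Nat.add_div_of_dvd_right (Dvd.intro_left l rfl), Nat.mul_div_cancel _ (by positivity),
            Nat.div_eq_of_lt ht, add_zero]
        rw [Finset.sum_congr rfl (fun t ht => by rw [h3 t ht])]
        by_cases hs : SelD m lam j l
        · simp only [hs, if_true]
          have := tree_sum hm j l (K - j)
          rw [show j + (K - j) = K by omega] at this
          rw [← this]; linarith [hs.1]
        · simp [hs]
    _ = ∑ i ∈ Finset.range (2 ^ K), ∑ j ∈ Finset.range (K + 1),
        (if SelD m lam j (i / 2 ^ (K - j)) then m K i else 0) := Finset.sum_comm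
    _ ≤ ∑ i ∈ Finset.range (2 ^ K), m K i := by
        refine Finset.sum_le_sum fun i _ => ?_
        by_cases hex : ∃ j ≤ K, SelD m lam j (i / 2 ^ (K - j))
        · obtain ⟨j, hj, hs⟩ := hex
          rw [Finset.sum_eq_single j]
          · simp [hs]
          · intro b hb hne
            rw [if_neg]
            intro hs'
            exact hne (sel_unique (by simp at hb; omega) hj hs' hs)
          · intro hj'; simp at hj'; omega
        · rw [Finset.sum_eq_zero]
          · exact h0 _ _
          · intro j hj
            rw [if_neg]
            intro hs
            exact hex ⟨j, by simp at hj; omega, hs⟩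
    _ = m 0 0 := by
        have := tree_sum hm 0 0 K
        simp at this; exact this.symm

/-! ### dyadic intervals -/

def iv (k i : ℕ) : Set ℝ := Set.Ico (-Real.pi + 2 * Real.pi * (i * ek k))
  (-Real.pi + 2 * Real.pi * ((i + 1) * ek k))

def cen (k i : ℕ) : ℝ := -Real.pi + 2 * Real.pi * ((i + 1 / 2) * ek k)

lemma iv_split (k i : ℕ) : iv k i = iv (k + 1) (2 * i) ∪ iv (k + 1) (2 * i + 1) := by
  unfold iv
  rw [ek_succ]; push_cast
  have := ek_pos k
  have h : (2 * (i:ℝ) + 1) * (ek k / 2) = 2 * i * (ek k / 2) + ek k / 2 := by ring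
  rw [Set.Ico_union_Ico_eq_Ico]
  · congr 2 <;> ring
  · gcongr; linarith
  · gcongr; linarith

lemma iv_disj (k i : ℕ) : Disjoint (iv (k + 1) (2 * i)) (iv (k + 1) (2 * i + 1)) := by
  unfold iv
  push_cast
  rw [Set.Ico_disjoint_Ico]
  exact (min_le_left _ _).trans (le_max_right _ _)

lemma measurableSet_iv (k i : ℕ) : MeasurableSet (iv k i) := measurableSet_Ico

def mI (G : ℝ → ℝ) (k i : ℕ) : ℝ := ∫ t in iv k i, G t ∂mu

lemma mI_tree {G : ℝ → ℝ} (hG : Integrable G mu) : TreeAdd (mI G) := by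
  intro k i
  unfold mI
  rw [iv_split, setIntegral_union (iv_disj k i) (measurableSet_iv _ _) hG.integrableOn hG.integrableOn]

lemma iv_zero : iv 0 0 = T1 := by
  unfold iv T1; rw [ek_zero]; congr 1 <;> simp; ring

lemma mu_restrict_T1 : mu.restrict T1 = mu := by
  unfold mu
  rw [Measure.restrict_smul, Measure.restrict_restrict_of_subset (Set.Subset.refl _)]

lemma mI_zero (G : ℝ → ℝ) : mI G 0 0 = ∫ t, G t ∂mu := by
  unfold mI; rw [iv_zero, mu_restrict_T1]

lemma mI_sum {G : ℝ → ℝ} (hG : Integrable G mu) (k : ℕ) :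
    ∑ i ∈ Finset.range (2 ^ k), mI G k i = ∫ t, G t ∂mu := by
  have := tree_sum (mI_tree hG) 0 0 k
  rw [mI_zero] at this
  simpa using this.symm

lemma mI_nonneg {G : ℝ → ℝ} (hG : ∀ t, 0 ≤ G t) (k i : ℕ) : 0 ≤ mI G k i :=
  setIntegral_nonneg (measurableSet_iv _ _) fun t _ => hG t

lemma mI_mono {G H : ℝ → ℝ} (hG : Integrable G mu) (hH : Integrable H mu) {k i : ℕ}
    (h : ∀ t ∈ iv k i, G t ≤ H t) : mI G k i ≤ mI H k i :=
  setIntegral_mono_on hG.integrableOn hH.integrableOn (measurableSet_iv _ _) h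

lemma mI_one {k i : ℕ} (hi : i < 2 ^ k) : mI (fun _ => 1) k i = ek k := by
  have hsub : iv k i ⊆ T1 := by
    have := ek_pos k
    have h2 : ((i:ℝ) + 1) * ek k ≤ 1 := by
      have h3 : (i:ℝ) + 1 ≤ 2 ^ k := by exact_mod_cast hi
      have h4 := ek_mul_two_pow k
      nlinarith
    have := Real.pi_pos
    unfold iv T1
    apply Set.Ico_subset_Ico
    · have : 0 ≤ 2 * Real.pi * (i * ek k) := by positivity
      linarith
    · nlinarith
  unfold mI mu
  rw [Measure.restrict_smul, Measure.restrict_restrict_of_subset hsub]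
  rw [integral_smul_measure, integral_const, smul_eq_mul, smul_eq_mul, mul_one, measureReal_restrict_apply_univ]
  rw [ENNReal.toReal_ofReal (by positivity), iv, Real.volume_real_Ico_of_le]
  · have := Real.pi_pos
    field_simp; ring
  · have := Real.pi_pos
    have := ek_pos k
    gcongr; linarith

lemma mem_iv_cen {k i : ℕ} {t : ℝ} (h : t ∈ iv k i) : |t - cen k i| ≤ Real.pi * ek k := by
  unfold iv at h; unfold cen
  rw [Set.mem_Ico] at h
  rw [abs_le]
  constructor <;> nlinarith [h.1, h.2]

lemma cen_cen {j l d t : ℕ} (ht : t < 2 ^ d) :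
    |cen (j + d) (l * 2 ^ d + t) - cen j l| ≤ Real.pi * ek j := by
  have h1 : ek j = ek (j + d) * 2 ^ d := by
    unfold ek; rw [pow_add, mul_assoc, ← mul_pow]; norm_num
  have h2 : (t:ℝ) + 1 ≤ 2 ^ d := by exact_mod_cast ht
  have h3 := ek_pos (j + d)
  have h4 := Real.pi_pos
  unfold cen
  rw [h1]
  push_cast
  have e : -Real.pi + 2 * Real.pi * ((l * 2 ^ d + t + 1 / 2) * ek (j + d)) -
      (-Real.pi + 2 * Real.pi * ((l + 1 / 2) * (ek (j + d) * 2 ^ d))) =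
      (Real.pi * ek (j + d)) * (2 * t + 1 - 2 ^ d) := by ring
  rw [e, abs_mul, abs_of_pos (by positivity), mul_assoc]
  rw [show Real.pi * (ek (j+d) * 2 ^ d) = (Real.pi * ek (j+d)) * 2 ^ d by ring, ← mul_assoc]
  refine mul_le_mul_of_nonneg_left ?_ (by positivity)
  rw [abs_le]
  constructor
  · have : (0:ℝ) ≤ t := by positivity
    linarith
  · linarith

/-! ### Lemma D -/

def rk (k : ℕ) : ℝ := 1 - ek k
lemma rk_nonneg (k : ℕ) : 0 ≤ rk k := by unfold rk; linarith [ek_le_one k]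
lemma rk_lt (k : ℕ) : rk k < 1 := by unfold rk; linarith [ek_pos k]

def DD (t : ℝ) : ℝ := 2 - 2 * Real.cos t
lemma DD_nonneg (t : ℝ) : 0 ≤ DD t := by unfold DD; linarith [Real.cos_le_one t]
lemma DD_eq (t : ℝ) : DD t = 4 * Real.sin (t / 2) ^ 2 := by
  have h := Real.cos_sq_add_sin_sq (t / 2)
  have h2 := Real.cos_two_mul (t / 2)
  rw [mul_div_cancel₀ _ (two_ne_zero)] at h2
  unfold DD; rw [h2]; linarith
lemma DD_add (s t : ℝ) : DD (s + t) ≤ 2 * DD s + 2 * DD t := by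
  rw [DD_eq, DD_eq, DD_eq, add_div, Real.sin_add]
  have h1 := Real.cos_sq_add_sin_sq (s / 2)
  have h2 := Real.cos_sq_add_sin_sq (t / 2)
  set a := Real.sin (s/2); set b := Real.sin (t/2)
  set a' := Real.cos (s/2); set b' := Real.cos (t/2)
  have e1 : a' ^ 2 = 1 - a ^ 2 := by linarith
  have e2 : b' ^ 2 = 1 - b ^ 2 := by linarith
  have : (a * b' + a' * b) ^ 2 ≤ 2 * (a ^ 2 * b' ^ 2) + 2 * (a' ^ 2 * b ^ 2) := by
    nlinarith [sq_nonneg (a * b' - a' * b)]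
  rw [e1, e2] at this
  nlinarith [mul_nonneg (sq_nonneg a) (sq_nonneg b)]
lemma DD_le_sq (t : ℝ) : DD t ≤ t ^ 2 := by
  unfold DD; linarith [Real.one_sub_sq_div_two_le_cos (x := t)]
lemma DD_neg (t : ℝ) : DD (-t) = DD t := by simp [DD]

lemma DD_tri (x y z : ℝ) : DD (x - z) ≤ 2 * DD (x - y) + 2 * DD (y - z) := by
  have := DD_add (x - y) (y - z)
  rwa [sub_add_sub_cancel] at this

lemma DD_small {t : ℝ} {k : ℕ} (h : |t| ≤ Real.pi * ek k) : DD t ≤ 10 * ek k ^ 2 := by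
  refine (DD_le_sq t).trans ?_
  rw [← sq_abs]
  have h1 : |t| ^ 2 ≤ (Real.pi * ek k) ^ 2 := by gcongr
  have h2 : Real.pi ^ 2 ≤ 10 := by
    have := Real.pi_lt_d2; have := Real.pi_pos; nlinarith
  nlinarith [sq_nonneg (ek k)]

lemma Pk_rk (k : ℕ) (t : ℝ) :
    Pk (rk k) t = ek k * (2 - ek k) / (ek k ^ 2 + (1 - ek k) * DD t) := by
  unfold Pk rk DD; congr 1 <;> ring

lemma den_pos (k : ℕ) (t : ℝ) : 0 < ek k ^ 2 + (1 - ek k) * DD t := by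
  have := DD_nonneg t; have := ek_pos k; have := ek_le_one k
  have : 0 ≤ (1 - ek k) * DD t := mul_nonneg (by linarith) (by linarith)
  positivity

lemma num_pos (k : ℕ) : 0 < ek k * (2 - ek k) :=
  mul_pos (ek_pos k) (by linarith [ek_le_one k])

lemma harnack {k : ℕ} {s c : ℝ} (y : ℝ) (h : |s - c| ≤ Real.pi * ek k) :
    Pk (rk k) (y - s) ≤ 21 * Pk (rk k) (y - c) := by
  rw [Pk_rk, Pk_rk, ← mul_div_assoc, div_le_div_iff₀ (den_pos _ _) (den_pos _ _)]
  have h1 := DD_tri y s c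
  have h2 := DD_small h
  have h4 := ek_pos k; have h5 := ek_le_one k
  have h6 := DD_nonneg (y - s)
  have h7 : ek k ^ 2 + (1 - ek k) * DD (y - c) ≤ 21 * (ek k ^ 2 + (1 - ek k) * DD (y - s)) := by
    have a1 : (1 - ek k) * DD (y - c) ≤ (1 - ek k) * (2 * DD (y - s) + 20 * ek k ^ 2) :=
      mul_le_mul_of_nonneg_left (by linarith) (by linarith)
    have a2 : 0 ≤ (1 - ek k) * DD (y - s) := mul_nonneg (by linarith) h6
    have a3 : 0 ≤ ek k * ek k ^ 2 := by positivity
    nlinarith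
  have := mul_le_mul_of_nonneg_left h7 (num_pos k).le
  linarith

lemma harnack' {k : ℕ} {s c : ℝ} (y : ℝ) (h : |s - c| ≤ Real.pi * ek k) :
    Pk (rk k) (y - c) ≤ 21 * Pk (rk k) (y - s) :=
  harnack y (by rwa [abs_sub_comm])

lemma Pk_upper {k : ℕ} (hk : 1 ≤ k) {t d : ℝ} (hd : 0 < d) (h : d ≤ 4 * DD t) :
    Pk (rk k) t ≤ 16 * ek k / d := by
  rw [Pk_rk, div_le_div_iff₀ (den_pos _ _) hd]
  have h4 := ek_pos k; have h5 := ek_le_half hk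
  have h6 := DD_nonneg t
  have a1 : ek k * (2 - ek k) * d ≤ 2 * ek k * d := by
    apply mul_le_mul_of_nonneg_right _ hd.le
    nlinarith
  have a2 : d / 8 ≤ ek k ^ 2 + (1 - ek k) * DD t := by nlinarith [sq_nonneg (ek k)]
  have a3 := mul_le_mul_of_nonneg_left a2 (by positivity : 0 ≤ 16 * ek k)
  linarith

lemma Pk_lower (k : ℕ) (t : ℝ) : ek k ^ 2 / (ek k ^ 2 + DD t) ≤ ek k * Pk (rk k) t := by
  rw [Pk_rk, ← mul_div_assoc]
  have h4 := ek_pos k; have h5 := ek_le_one k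
  have h6 := DD_nonneg t
  apply div_le_div₀
  · exact mul_nonneg h4.le (num_pos k).le
  · nlinarith [sq_nonneg (ek k)]
  · exact den_pos _ _
  · nlinarith

lemma continuous_integral_mu {E : Type*} [NormedAddCommGroup E] [NormedSpace ℝ E]
    {f : ℝ → ℝ → E} (hf : Continuous (Function.uncurry f)) :
    Continuous (fun x => ∫ t, f x t ∂mu) := by
  simp_rw [integral_mu]
  apply Continuous.const_smul
  exact intervalIntegral.continuous_parametric_intervalIntegral_of_continuous' hf _ _

@[fun_prop] lemma continuous_Pk_rk (k : ℕ) : Continuous (Pk (rk k)) :=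
  continuous_Pk (rk_nonneg k) (rk_lt k)
lemma Pk_rk_nonneg (k : ℕ) (t : ℝ) : 0 ≤ Pk (rk k) t := Pk_nonneg (rk_nonneg k) (rk_lt k) t

/-- Poisson integral -/
def PG (k : ℕ) (G : ℝ → ℝ) (y : ℝ) : ℝ := ∫ s, Pk (rk k) (y - s) * G s ∂mu

def BB (k : ℕ) (G : ℝ → ℝ) (x : ℝ) : ℝ := ∫ y, Pk (rk k) (x - y) * (PG k G y) ^ 2 ∂mu

lemma continuous_PG (k : ℕ) {G : ℝ → ℝ} (hG : Continuous G) : Continuous (PG k G) := by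
  apply continuous_integral_mu
  simp only [Function.uncurry_def]
  fun_prop

lemma continuous_BB (k : ℕ) {G : ℝ → ℝ} (hG : Continuous G) : Continuous (BB k G) := by
  apply continuous_integral_mu
  have := continuous_PG k hG
  simp only [Function.uncurry_def]
  fun_prop

lemma PG_nonneg (k : ℕ) {G : ℝ → ℝ} (hG : ∀ t, 0 ≤ G t) (y : ℝ) : 0 ≤ PG k G y :=
  integral_nonneg fun s => mul_nonneg (Pk_rk_nonneg _ _) (hG s)

lemma PG_le_sum (k : ℕ) {G : ℝ → ℝ} (hG : Continuous G) (h0 : ∀ t, 0 ≤ G t) (y : ℝ) :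
    PG k G y ≤ 21 * ∑ i ∈ Finset.range (2 ^ k), Pk (rk k) (y - cen k i) * mI G k i := by
  have hc : Continuous (fun s => Pk (rk k) (y - s) * G s) := by fun_prop
  rw [PG, ← mI_sum (integrable_mu hc) k, Finset.mul_sum]
  refine Finset.sum_le_sum fun i _ => ?_
  have : mI (fun s => Pk (rk k) (y - s) * G s) k i
      ≤ mI (fun s => (21 * Pk (rk k) (y - cen k i)) * G s) k i := by
    apply mI_mono (integrable_mu hc) (integrable_mu (by fun_prop))
    intro t ht
    exact mul_le_mul_of_nonneg_right (harnack y (mem_iv_cen ht)) (h0 t)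
  refine this.trans (le_of_eq ?_)
  unfold mI; rw [integral_const_mul]; ring

lemma sum_Pk_le (k : ℕ) (y : ℝ) :
    ∑ i ∈ Finset.range (2 ^ k), ek k * Pk (rk k) (y - cen k i) ≤ 21 := by
  have hc : Continuous (fun s => 21 * Pk (rk k) (y - s)) := by fun_prop
  have h1 : ∫ s, 21 * Pk (rk k) (y - s) ∂mu = 21 := by
    rw [integral_const_mul, integral_Pk_sub (rk_nonneg k) (rk_lt k)]; norm_num
  rw [← h1, ← mI_sum (integrable_mu hc) k]
  refine Finset.sum_le_sum fun i hi => ?_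
  have : mI (fun _ => Pk (rk k) (y - cen k i) * 1) k i ≤ mI (fun s => 21 * Pk (rk k) (y - s)) k i := by
    apply mI_mono (integrable_mu (by fun_prop)) (integrable_mu hc)
    intro t ht
    rw [mul_one]
    exact harnack' y (mem_iv_cen ht)
  refine le_trans (le_of_eq ?_) this
  have h2 := mI_one (Finset.mem_range.mp hi)
  unfold mI at h2 ⊢
  rw [integral_const_mul, h2]; ring

def kap (k : ℕ) (x : ℝ) (i : ℕ) : ℝ :=
  ek k * ∫ y, Pk (rk k) (x - y) * Pk (rk k) (y - cen k i) ∂mu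

lemma kap_nonneg (k : ℕ) (x : ℝ) (i : ℕ) : 0 ≤ kap k x i :=
  mul_nonneg (ek_pos k).le (integral_nonneg fun y => mul_nonneg (Pk_rk_nonneg _ _) (Pk_rk_nonneg _ _))

lemma sum_kap (k : ℕ) (x : ℝ) : ∑ i ∈ Finset.range (2 ^ k), kap k x i ≤ 21 := by
  unfold kap
  rw [← Finset.mul_sum, ← integral_finsetSum _ (fun i _ => integrable_mu (by fun_prop)),
    ← integral_const_mul]
  have h1 : ∫ y, Pk (rk k) (x - y) * 21 ∂mu = 21 := by
    rw [integral_mul_const, integral_Pk_sub (rk_nonneg k) (rk_lt k)]; norm_num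
  rw [← h1]
  apply integral_mono (integrable_mu (by fun_prop)) (integrable_mu (by fun_prop))
  intro y
  simp only
  rw [← Finset.mul_sum, ← mul_assoc, mul_comm (ek k), mul_assoc, Finset.mul_sum]
  exact mul_le_mul_of_nonneg_left (sum_Pk_le k y) (Pk_rk_nonneg _ _)

lemma kap_le {k : ℕ} (hk : 1 ≤ k) (x : ℝ) (i : ℕ) (hD : 0 < DD (x - cen k i)) :
    kap k x i ≤ 32 * ek k ^ 2 / DD (x - cen k i) := by
  set d := DD (x - cen k i) with hd
  have h1 : ∫ y, Pk (rk k) (x - y) * Pk (rk k) (y - cen k i) ∂mu ≤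
      ∫ y, (16 * ek k / d) * (Pk (rk k) (x - y) + Pk (rk k) (y - cen k i)) ∂mu := by
    apply integral_mono (integrable_mu (by fun_prop)) (integrable_mu (by fun_prop))
    intro y
    have p1 := Pk_rk_nonneg k (x - y)
    have p2 := Pk_rk_nonneg k (y - cen k i)
    have h2 := DD_tri x y (cen k i)
    have h4 := ek_pos k
    have h5 : 0 ≤ 16 * ek k / d := by positivity
    simp only
    rcases le_total (DD (x - y)) (DD (y - cen k i)) with h3 | h3
    · have := Pk_upper hk hD (t := y - cen k i) (by linarith)
      nlinarith [mul_le_mul_of_nonneg_left this p1]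
    · have := Pk_upper hk hD (t := x - y) (by linarith)
      nlinarith [mul_le_mul_of_nonneg_right this p2]
  rw [integral_const_mul, integral_add (integrable_mu (by fun_prop)) (integrable_mu (by fun_prop)),
    integral_Pk_sub (rk_nonneg k) (rk_lt k), integral_Pk_sub' (rk_nonneg k) (rk_lt k)] at h1
  unfold kap
  have := mul_le_mul_of_nonneg_left h1 (ek_pos k).le
  refine this.trans (le_of_eq ?_)
  ring

lemma BB_le_kap (k : ℕ) {G : ℝ → ℝ} (hG : Continuous G) (h0 : ∀ t, 0 ≤ G t) (x : ℝ) :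
    BB k G x ≤ 9261 * ∑ i ∈ Finset.range (2 ^ k), kap k x i * (mI G k i / ek k) ^ 2 := by
  have hp : ∀ y, (PG k G y) ^ 2 ≤ 9261 * ∑ i ∈ Finset.range (2 ^ k),
      ek k * Pk (rk k) (y - cen k i) * (mI G k i / ek k) ^ 2 := by
    intro y
    have h1 := PG_le_sum k hG h0 y
    have h2 := PG_nonneg k h0 y
    have h3 : (∑ i ∈ Finset.range (2 ^ k), Pk (rk k) (y - cen k i) * mI G k i) ^ 2 ≤
        (∑ i ∈ Finset.range (2 ^ k), ek k * Pk (rk k) (y - cen k i)) *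
        ∑ i ∈ Finset.range (2 ^ k), ek k * Pk (rk k) (y - cen k i) * (mI G k i / ek k) ^ 2 := by
      apply Finset.sum_sq_le_sum_mul_sum_of_sq_eq_mul
      · intro i _; exact mul_nonneg (ek_pos k).le (Pk_rk_nonneg _ _)
      · intro i _
        have := Pk_rk_nonneg k (y - cen k i); have := ek_pos k; positivity
      · intro i _
        have := ek_pos k
        field_simp
    have h4 : 0 ≤ ∑ i ∈ Finset.range (2 ^ k), ek k * Pk (rk k) (y - cen k i) * (mI G k i / ek k) ^ 2 := by
      apply Finset.sum_nonneg
      intro i _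
      have := Pk_rk_nonneg k (y - cen k i); have := ek_pos k; positivity
    have h5 := mul_le_mul_of_nonneg_right (sum_Pk_le k y) h4
    have h6 : (PG k G y) ^ 2 ≤ (21 * ∑ i ∈ Finset.range (2 ^ k), Pk (rk k) (y - cen k i) * mI G k i) ^ 2 := by
      gcongr
    rw [mul_pow] at h6
    linarith
  have hcp := continuous_PG k hG
  have h1 : BB k G x ≤ ∫ y, Pk (rk k) (x - y) * (9261 * ∑ i ∈ Finset.range (2 ^ k),
      ek k * Pk (rk k) (y - cen k i) * (mI G k i / ek k) ^ 2) ∂mu := by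
    unfold BB
    apply integral_mono (integrable_mu (by fun_prop)) (integrable_mu (by fun_prop))
    intro y
    exact mul_le_mul_of_nonneg_left (hp y) (Pk_rk_nonneg _ _)
  refine h1.trans (le_of_eq ?_)
  simp_rw [Finset.mul_sum]
  rw [integral_finsetSum _ (fun i _ => integrable_mu (by fun_prop))]
  refine Finset.sum_congr rfl fun i _ => ?_
  unfold kap
  rw [← integral_const_mul, ← integral_mul_const, ← integral_const_mul]
  congr 1; ext y; ring

open Classical in
def Xi (m : ℕ → ℕ → ℝ) (lam : ℝ) (K : ℕ) (x : ℝ) : ℝ :=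
  ∑ j ∈ Finset.range (K + 1), ∑ l ∈ Finset.range (2 ^ j),
      (if SelD m lam j l then ek j * Pk (rk j) (x - cen j l) else 0)

lemma continuous_Xi (m : ℕ → ℕ → ℝ) (lam : ℝ) (K : ℕ) : Continuous (Xi m lam K) := by
  unfold Xi
  refine continuous_finsetSum _ fun j _ => continuous_finsetSum _ fun l _ => ?_
  split_ifs <;> fun_prop

lemma Xi_nonneg (m : ℕ → ℕ → ℝ) (lam : ℝ) (K : ℕ) (x : ℝ) : 0 ≤ Xi m lam K x := by
  unfold Xi
  refine Finset.sum_nonneg fun j _ => Finset.sum_nonneg fun l _ => ?_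
  split_ifs
  · exact mul_nonneg (ek_pos _).le (Pk_rk_nonneg _ _)
  · exact le_rfl

lemma integral_Xi (m : ℕ → ℕ → ℝ) (hm : TreeAdd m) (h0 : ∀ k i, 0 ≤ m k i) {lam : ℝ}
    (hlam : 0 < lam) (K : ℕ) : ∫ x, Xi m lam K x ∂mu ≤ m 0 0 / lam := by
  classical
  refine le_trans (le_of_eq ?_) (sel_sum hm h0 hlam K)
  unfold Xi
  have hc : ∀ j l : ℕ, Continuous (fun x => if SelD m lam j l then ek j * Pk (rk j) (x - cen j l) else 0) := by
    intro j l; split_ifs <;> fun_prop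
  rw [integral_finsetSum _ (fun j _ => integrable_mu (continuous_finsetSum _ fun l _ => hc j l))]
  refine Finset.sum_congr rfl fun j _ => ?_
  rw [integral_finsetSum _ (fun l _ => integrable_mu (hc j l))]
  refine Finset.sum_congr rfl fun l _ => ?_
  split_ifs
  · rw [integral_const_mul, integral_Pk_sub' (rk_nonneg j) (rk_lt j), mul_one]
  · simp

lemma Xi_term_le {m : ℕ → ℕ → ℝ} {lam : ℝ} {K j l : ℕ} (x : ℝ) (hj : j ≤ K) (hl : l < 2 ^ j)
    (h : SelD m lam j l) : ek j * Pk (rk j) (x - cen j l) ≤ Xi m lam K x := by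
  classical
  have hn : ∀ j l : ℕ, 0 ≤ (if SelD m lam j l then ek j * Pk (rk j) (x - cen j l) else 0) := by
    intro j l
    split_ifs
    · exact mul_nonneg (ek_pos _).le (Pk_rk_nonneg _ _)
    · exact le_rfl
  have h1 := Finset.single_le_sum (f := fun l => (if SelD m lam j l then ek j * Pk (rk j) (x - cen j l) else 0))
    (fun l _ => hn j l) (Finset.mem_range.mpr hl)
  have h2 := Finset.single_le_sum (f := fun j => ∑ l ∈ Finset.range (2 ^ j),
    (if SelD m lam j l then ek j * Pk (rk j) (x - cen j l) else 0))
    (fun j _ => Finset.sum_nonneg fun l _ => hn j l) (Finset.mem_range.mpr (Nat.lt_succ_of_le hj))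
  simp only [h, if_true] at h1
  exact h1.trans h2

lemma bad_term {m : ℕ → ℕ → ℝ} (hm : TreeAdd m) (h0 : ∀ k i, 0 ≤ m k i) {lam : ℝ} (hlam : 0 < lam)
    (h00 : m 0 0 ≤ lam) {K j l d : ℕ} {x : ℝ} (hk : 1 ≤ j + d) (hj : j ≤ K) (hl : l < 2 ^ j)
    (h : SelD m lam j l) (hx : Xi m lam K x ≤ 1 / 200) :
    ∑ t ∈ Finset.range (2 ^ d), kap (j + d) x (l * 2 ^ d + t) *
      (m (j + d) (l * 2 ^ d + t) / ek (j + d)) ^ 2 ≤ 640 * lam ^ 2 * (ek j * Pk (rk j) (x - cen j l)) := by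
  have hp := Pk_lower j (x - cen j l)
  have hq := (Xi_term_le x hj hl h).trans hx
  have he := ek_pos j
  have hD0 := DD_nonneg (x - cen j l)
  set D := DD (x - cen j l) with hDdef
  have hD : 199 * ek j ^ 2 ≤ D := by
    have := hp.trans hq
    rw [div_le_div_iff₀ (by positivity) (by norm_num)] at this
    linarith
  have hDpos : 0 < D := lt_of_lt_of_le (by positivity) hD
  have hsel := sel_bound hm h0 h00 hl h
  have h1 : ∀ t ∈ Finset.range (2 ^ d), kap (j + d) x (l * 2 ^ d + t) *
      (m (j + d) (l * 2 ^ d + t) / ek (j + d)) ^ 2 ≤ 128 / D * (m (j + d) (l * 2 ^ d + t)) ^ 2 := by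
    intro t ht
    have c1 := DD_small (cen_cen (j := j) (l := l) (Finset.mem_range.mp ht))
    have c2 := DD_tri x (cen (j + d) (l * 2 ^ d + t)) (cen j l)
    have c3 : D / 4 ≤ DD (x - cen (j + d) (l * 2 ^ d + t)) := by linarith
    have c4 := kap_le hk x (l * 2 ^ d + t) (by linarith)
    have e2 := ek_pos (j + d)
    have c5 : kap (j + d) x (l * 2 ^ d + t) ≤ 32 * ek (j + d) ^ 2 / (D / 4) := by
      refine c4.trans ?_
      gcongr
    calc _ ≤ 32 * ek (j + d) ^ 2 / (D / 4) * (m (j + d) (l * 2 ^ d + t) / ek (j + d)) ^ 2 := by gcongr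
      _ = _ := by field_simp; ring
  refine (Finset.sum_le_sum h1).trans ?_
  rw [← Finset.mul_sum]
  have h2 := tree_sum_sq hm h0 j l d
  have h3 : (m j l) ^ 2 ≤ (2 * lam * ek j) ^ 2 := by
    have := h0 j l
    gcongr; exact hsel.2
  calc 128 / D * _ ≤ 128 / D * (2 * lam * ek j) ^ 2 := by
        gcongr; exact h2.trans h3
    _ = 512 * lam ^ 2 * (ek j ^ 2 / D) := by ring
    _ ≤ 512 * lam ^ 2 * (200 / 199 * (ek j ^ 2 / (ek j ^ 2 + D))) := by
        gcongr
        rw [← mul_div_assoc, div_le_div_iff₀ hDpos (by positivity)]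
        nlinarith [sq_nonneg (ek j)]
    _ ≤ 512 * lam ^ 2 * (200 / 199 * (ek j * Pk (rk j) (x - cen j l))) := by gcongr
    _ ≤ _ := by
        have : 0 ≤ lam ^ 2 * (ek j * Pk (rk j) (x - cen j l)) := by
          have := Pk_rk_nonneg j (x - cen j l); positivity
        nlinarith

lemma BB_le_of_Xi {G : ℝ → ℝ} (hG : Continuous G) (h0 : ∀ t, 0 ≤ G t) {lam : ℝ} (hlam : 0 < lam)
    (h00 : ∫ t, G t ∂mu ≤ lam) {K k : ℕ} {x : ℝ} (hk : 1 ≤ k) (hkK : k ≤ K)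
    (hx : Xi (mI G) lam K x ≤ 1 / 200) : BB k G x ≤ 250000 * lam ^ 2 := by
  classical
  have hm := mI_tree (integrable_mu hG)
  have hm0 := mI_nonneg h0
  rw [← mI_zero] at h00
  have hb := BB_le_kap k hG h0 x
  set m := mI G with hmdef
  set term : ℕ → ℝ := fun i => kap k x i * (m k i / ek k) ^ 2 with hterm
  have hterm0 : ∀ i, 0 ≤ term i := fun i => mul_nonneg (kap_nonneg _ _ _) (sq_nonneg _)
  have hptw : ∀ i ∈ Finset.range (2 ^ k), term i ≤ kap k x i * lam ^ 2 +
      ∑ j ∈ Finset.range (k + 1), (if SelD m lam j (i / 2 ^ (k - j)) then term i else 0) := by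
    intro i _
    have hn : ∀ j ∈ Finset.range (k + 1), 0 ≤ (if SelD m lam j (i / 2 ^ (k - j)) then term i else 0) := by
      intro j _; split_ifs
      · exact hterm0 i
      · exact le_rfl
    rcases le_or_gt (m k i) (lam * ek k) with h | h
    · have : term i ≤ kap k x i * lam ^ 2 := by
        refine mul_le_mul_of_nonneg_left ?_ (kap_nonneg _ _ _)
        have e := ek_pos k
        have := hm0 k i
        have : m k i / ek k ≤ lam := by rw [div_le_iff₀ e]; exact h
        gcongr
      linarith [Finset.sum_nonneg hn]
    · obtain ⟨j, hj, hs⟩ := sel_exists h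
      have := Finset.single_le_sum hn (Finset.mem_range.mpr (Nat.lt_succ_of_le hj))
      rw [if_pos hs] at this
      have h2 : 0 ≤ kap k x i * lam ^ 2 := mul_nonneg (kap_nonneg _ _ _) (sq_nonneg _)
      linarith
  have hsum := Finset.sum_le_sum hptw
  rw [Finset.sum_add_distrib, ← Finset.sum_mul, Finset.sum_comm] at hsum
  have h2 : ∑ j ∈ Finset.range (k + 1), ∑ i ∈ Finset.range (2 ^ k),
      (if SelD m lam j (i / 2 ^ (k - j)) then term i else 0) ≤ 640 * lam ^ 2 * Xi m lam k x := by
    unfold Xi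
    rw [Finset.mul_sum]
    refine Finset.sum_le_sum fun j hj => ?_
    have hjk : j ≤ k := by simp at hj; omega
    have e : 2 ^ k = 2 ^ j * 2 ^ (k - j) := by rw [← pow_add]; congr 1; omega
    rw [e, sum_range_mul_split, Finset.mul_sum]
    refine Finset.sum_le_sum fun l hl => ?_
    have h3 : ∀ t ∈ Finset.range (2 ^ (k - j)), (l * 2 ^ (k - j) + t) / 2 ^ (k - j) = l := by
      intro t ht
      rw [Finset.mem_range] at ht
      rw [Nat.add_div_of_dvd_right (Dvd.intro_left l rfl), Nat.mul_div_cancel _ (by positivity),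
        Nat.div_eq_of_lt ht, add_zero]
    rw [Finset.sum_congr rfl (fun t ht => by rw [h3 t ht])]
    by_cases hs : SelD m lam j l
    · simp only [hs, if_true]
      have := bad_term hm hm0 hlam h00 (K := K) (d := k - j) (by omega) (hjk.trans hkK)
        (Finset.mem_range.mp hl) hs hx
      rw [show j + (k - j) = k by omega] at this
      exact this
    · simp [hs]
  have h3 : Xi m lam k x ≤ Xi m lam K x := by
    unfold Xi
    apply Finset.sum_le_sum_of_subset_of_nonneg
    · intro a; simp; omega
    · intro j _ _
      refine Finset.sum_nonneg fun l _ => ?_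
      split_ifs
      · exact mul_nonneg (ek_pos _).le (Pk_rk_nonneg _ _)
      · exact le_rfl
  have h4 := mul_le_mul_of_nonneg_right (sum_kap k x) (sq_nonneg lam)
  have h5 := mul_le_mul_of_nonneg_left (h3.trans hx) (by positivity : 0 ≤ 640 * lam ^ 2)
  have h6 : ∑ i ∈ Finset.range (2 ^ k), term i ≤ 25 * lam ^ 2 := by nlinarith [sq_nonneg lam]
  nlinarith [sq_nonneg lam]

lemma chebyshev_mu {h : ℝ → ℝ} (hc : Continuous h) (h0 : ∀ t, 0 ≤ h t) {a : ℝ} (ha : 0 < a) :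
    mu {x | a < h x} ≤ ENNReal.ofReal ((∫ x, h x ∂mu) / a) := by
  have h1 := mul_meas_ge_le_integral_of_nonneg (μ := mu) (Filter.Eventually.of_forall h0) (integrable_mu hc) a
  calc mu {x | a < h x} ≤ mu {x | a ≤ h x} := measure_mono fun x (hx : a < h x) => hx.le
    _ = ENNReal.ofReal (mu.real {x | a ≤ h x}) := by simp
    _ ≤ _ := by
      apply ENNReal.ofReal_le_ofReal
      rw [le_div_iff₀ ha]; linarith

/-- Lemma D: the weak type estimate -/
lemma lemmaD {G : ℝ → ℝ} (hG : Continuous G) (h0 : ∀ t, 0 ≤ G t) {lam : ℝ} (hlam : 0 < lam) (K : ℕ) :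
    mu {x | ∃ k, 1 ≤ k ∧ k ≤ K ∧ 250000 * lam ^ 2 < BB k G x} ≤
      ENNReal.ofReal (200 * (∫ t, G t ∂mu) / lam) := by
  rcases le_or_gt (∫ t, G t ∂mu) lam with h | h
  · calc _ ≤ mu {x | 1 / 200 < Xi (mI G) lam K x} := by
          apply measure_mono
          rintro x ⟨k, hk, hkK, hx⟩
          simp only [mem_setOf_eq]
          by_contra h2
          exact absurd (BB_le_of_Xi hG h0 hlam h hk hkK (not_lt.mp h2)) (not_le.mpr hx)
      _ ≤ _ := by
          refine (chebyshev_mu (continuous_Xi _ _ _) (Xi_nonneg _ _ _) (by norm_num)).trans ?_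
          apply ENNReal.ofReal_le_ofReal
          have := integral_Xi (mI G) (mI_tree (integrable_mu hG)) (mI_nonneg h0) hlam K
          rw [mI_zero] at this
          rw [mul_div_assoc]; linarith
  · refine prob_le_one.trans ?_
    rw [← ENNReal.ofReal_one]
    apply ENNReal.ofReal_le_ofReal
    rw [le_div_iff₀ hlam]; linarith

/-! ### Bessel and the oscillation estimate -/

/-- trigonometric polynomial -/
def tp (s : Finset ℤ) (c : ℤ → ℂ) (t : ℝ) : ℂ := ∑ a ∈ s, c a * ee t ^ a

/-- upper remainder -/
def Rp (s : Finset ℤ) (c : ℤ → ℂ) (n : ℤ) (t : ℝ) : ℂ :=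
  ∑ a ∈ s, if n < a then c a * ee t ^ a else 0

/-- analytic part at radius rho -/
def Ph (s : Finset ℤ) (c : ℤ → ℂ) (rho : ℝ) (t : ℝ) : ℂ :=
  ∑ a ∈ s, if 0 < a then c a * rho ^ a.natAbs * ee t ^ a else 0

@[fun_prop] lemma continuous_tp (s : Finset ℤ) (c : ℤ → ℂ) : Continuous (tp s c) := by
  unfold tp; fun_prop

lemma ee_zpow_periodic (a : ℤ) : Function.Periodic (fun t => ee t ^ a) (2 * Real.pi) := by
  intro t; simp only [ee_periodic t]

lemma tp_periodic (s : Finset ℤ) (c : ℤ → ℂ) : Function.Periodic (tp s c) (2 * Real.pi) := by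
  intro t; simp only [tp, ee_periodic t]

lemma ee_zpow_orth (i j : ℤ) : ∫ t, ee t ^ (-i) * ee t ^ j ∂mu = if i = j then 1 else 0 := by
  have : ∀ t, ee t ^ (-i) * ee t ^ j = ee t ^ (-i + j) := fun t => (zpow_add₀ (ee_ne t) _ _).symm
  simp_rw [this]
  rw [integral_ee_zpow]
  congr 1
  exact propext ⟨fun h => by omega, fun h => by omega⟩

lemma conj_ee_zpow (t : ℝ) (j : ℤ) : (starRingEnd ℂ) (ee t ^ j) = ee t ^ (-j) := by
  rw [map_zpow₀, ee_conj, inv_zpow, zpow_neg]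

lemma bessel {f : ℝ → ℂ} (hf : Continuous f) (m : ℕ) :
    ∑ j ∈ Finset.range m, ‖∫ t, ee t ^ (-(j:ℤ)) * f t ∂mu‖ ^ 2 ≤ ∫ t, ‖f t‖ ^ 2 ∂mu := by
  set b : ℕ → ℂ := fun j => ∫ t, ee t ^ (-(j:ℤ)) * f t ∂mu with hb
  set p : ℝ → ℂ := fun t => ∑ j ∈ Finset.range m, b j * ee t ^ (j:ℤ) with hp
  have hpc : Continuous p := by rw [hp]; fun_prop
  have hconj : ∀ t, (starRingEnd ℂ) (p t) = ∑ j ∈ Finset.range m, (starRingEnd ℂ) (b j) * ee t ^ (-(j:ℤ)) := by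
    intro t
    rw [hp, map_sum]
    refine Finset.sum_congr rfl fun j _ => ?_
    rw [map_mul, conj_ee_zpow]
  have key : ∀ h : ℝ → ℂ, Continuous h → (∀ j ∈ Finset.range m, ∫ t, ee t ^ (-(j:ℤ)) * h t ∂mu = b j) →
      ∫ t, (starRingEnd ℂ) (p t) * h t ∂mu = ((∑ j ∈ Finset.range m, ‖b j‖ ^ 2 : ℝ) : ℂ) := by
    intro h hh hbj
    simp_rw [hconj, Finset.sum_mul]
    rw [integral_finsetSum _ (fun j _ => integrable_mu (by fun_prop))]
    push_cast
    refine Finset.sum_congr rfl fun j hj => ?_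
    simp_rw [mul_assoc]
    rw [integral_const_mul, hbj j hj, ← Complex.conj_mul']
  have k1 := key f hf (fun j _ => rfl)
  have k2 := key p hpc (by
    intro j hj
    simp_rw [hp, Finset.mul_sum]
    rw [integral_finsetSum _ (fun j _ => integrable_mu (by fun_prop))]
    have : ∀ i : ℕ, ∫ t, ee t ^ (-(j:ℤ)) * (b i * ee t ^ (i:ℤ)) ∂mu = if i = j then b i else 0 := by
      intro i
      have e : ∀ t, ee t ^ (-(j:ℤ)) * (b i * ee t ^ (i:ℤ)) = b i * (ee t ^ (-(j:ℤ)) * ee t ^ (i:ℤ)) := by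
        intro t; ring
      simp_rw [e]
      rw [integral_const_mul, ee_zpow_orth]
      by_cases h : i = j
      · simp [h]
      · rw [if_neg (by omega), if_neg h, mul_zero]
    simp_rw [this]
    rw [Finset.sum_ite_eq' ]
    simp [hj])
  have hpt : ∀ t, 2 * ((starRingEnd ℂ) (p t) * f t).re - ((starRingEnd ℂ) (p t) * p t).re ≤ ‖f t‖ ^ 2 := by
    intro t
    have h1 : ((starRingEnd ℂ) (p t) * p t).re = ‖p t‖ ^ 2 := by
      rw [Complex.conj_mul']; norm_cast
    have h2 : ((starRingEnd ℂ) (p t) * f t).re ≤ ‖p t‖ * ‖f t‖ := by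
      refine (Complex.re_le_norm _).trans ?_
      rw [norm_mul, Complex.norm_conj]
    nlinarith [sq_nonneg (‖p t‖ - ‖f t‖)]
  have hcc : Continuous (fun t => (starRingEnd ℂ) (p t)) := Complex.continuous_conj.comp hpc
  have hi := integral_mono (μ := mu) (integrable_mu (by fun_prop)) (integrable_mu (by fun_prop)) hpt
  rw [integral_sub (integrable_mu (by fun_prop)) (integrable_mu (by fun_prop)), integral_const_mul] at hi
  have r1 : ∫ t, ((starRingEnd ℂ) (p t) * f t).re ∂mu = ∑ j ∈ Finset.range m, ‖b j‖ ^ 2 := by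
    have := integral_re (μ := mu) (𝕜 := ℂ) (f := fun t => (starRingEnd ℂ) (p t) * f t) (integrable_mu (by fun_prop))
    rw [k1] at this
    exact this.trans (by simp only [RCLike.re_eq_complex_re, Complex.ofReal_re])
  have r2 : ∫ t, ((starRingEnd ℂ) (p t) * p t).re ∂mu = ∑ j ∈ Finset.range m, ‖b j‖ ^ 2 := by
    have := integral_re (μ := mu) (𝕜 := ℂ) (f := fun t => (starRingEnd ℂ) (p t) * p t) (integrable_mu (by fun_prop))
    rw [k2] at this
    exact this.trans (by simp only [RCLike.re_eq_complex_re, Complex.ofReal_re])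
  rw [r1, r2] at hi
  linarith

lemma rk_pow_lower {k : ℕ} (hk : 1 ≤ k) : 1 / 4 ≤ rk k ^ (2 ^ k) := by
  induction k, hk using Nat.le_induction with
  | base => norm_num [rk, ek]
  | succ k hk ih =>
    have h1 : rk k ≤ rk (k + 1) ^ 2 := by
      unfold rk; rw [ek_succ]; nlinarith [sq_nonneg (ek k)]
    rw [pow_succ, mul_comm, pow_mul]
    refine ih.trans ?_
    exact pow_le_pow_left₀ (rk_nonneg k) h1 _

lemma rk_pow_lower' {k j : ℕ} (hk : 1 ≤ k) (hj : j < 2 ^ k) : 1 / 16 ≤ (rk k ^ j) ^ 2 := by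
  have h1 := rk_pow_lower hk
  have h2 : rk k ^ (2 ^ k) ≤ rk k ^ j := pow_le_pow_of_le_one (rk_nonneg k) (rk_lt k).le hj.le
  have h3 : 1 / 4 ≤ rk k ^ j := h1.trans h2
  nlinarith

lemma PG_shift (k : ℕ) {G : ℝ → ℝ} (hp : Function.Periodic G (2 * Real.pi)) (x t : ℝ) :
    ∫ s, Pk (rk k) (t - s) * G (x + s) ∂mu = PG k G (x + t) := by
  have hper : Function.Periodic (fun u => Pk (rk k) (x + t - u) * G u) (2 * Real.pi) := by
    intro u
    simp only [hp u]
    rw [← sub_sub, (Pk_periodic (rk k)).sub_eq]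
  rw [PG, ← integral_mu_add hper x]
  congr 1; ext s; ring_nf

lemma PG_periodic (k : ℕ) (G : ℝ → ℝ) : Function.Periodic (PG k G) (2 * Real.pi) := by
  intro y
  unfold PG
  congr 1; ext s
  rw [show y + 2 * Real.pi - s = (y - s) + 2 * Real.pi by ring, Pk_periodic]

lemma BB_shift (k : ℕ) (G : ℝ → ℝ) (x : ℝ) :
    ∫ t, Pk (rk k) t * (PG k G (x + t)) ^ 2 ∂mu = BB k G x := by
  have hper : Function.Periodic (fun u => Pk (rk k) (x - u) * (PG k G u) ^ 2) (2 * Real.pi) := by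
    intro u
    simp only [PG_periodic k G u]
    rw [← sub_sub, (Pk_periodic (rk k)).sub_eq]
  rw [BB, ← integral_mu_add hper x]
  congr 1; ext s
  rw [sub_add_cancel_left, Pk_neg]

lemma osc_aux (s : Finset ℤ) (c : ℤ → ℂ) (n0 : ℤ) (k : ℕ) (x t : ℝ) :
    ‖∑ a ∈ s, c a * ee x ^ a * (rk k : ℂ) ^ (a - n0).natAbs * ee t ^ (a - n0)‖ ≤
      PG k (fun u => ‖tp s c u‖) (x + t) := by
  have h1 : ∑ a ∈ s, c a * ee x ^ a * (rk k : ℂ) ^ (a - n0).natAbs * ee t ^ (a - n0) =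
      ∫ u, (Pk (rk k) (t - u) : ℂ) * ∑ a ∈ s, c a * ee x ^ a * ee u ^ (a - n0) ∂mu := by
    simp_rw [Finset.mul_sum]
    have hc : Continuous (fun u => ((Pk (rk k) (t - u) : ℝ) : ℂ)) := by fun_prop
    rw [integral_finsetSum _ (fun a _ => integrable_mu (by fun_prop))]
    refine Finset.sum_congr rfl fun a _ => ?_
    have := poisson_zpow (rk_nonneg k) (rk_lt k) t (a - n0)
    rw [mul_assoc, ← this, ← integral_const_mul]
    congr 1; ext u; ring
  rw [h1, ← PG_shift k (G := fun u => ‖tp s c u‖) (fun u => by simp only [tp_periodic s c u])]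
  refine (norm_integral_le_integral_norm _).trans (le_of_eq ?_)
  congr 1; ext u
  rw [norm_mul, Complex.norm_real, Real.norm_of_nonneg (Pk_rk_nonneg _ _)]
  congr 1
  have : ∑ a ∈ s, c a * ee x ^ a * ee u ^ (a - n0) = tp s c (x + u) * ee u ^ (-n0) := by
    rw [tp, Finset.sum_mul]
    refine Finset.sum_congr rfl fun a _ => ?_
    rw [ee_add, mul_zpow, sub_eq_add_neg, zpow_add₀ (ee_ne u)]; ring
  rw [this, norm_mul, norm_zpow, norm_ee, one_zpow, mul_one]

/-- lower correction -/
def cl (s : Finset ℤ) (c : ℤ → ℂ) (k : ℕ) (n0 : ℤ) (x : ℝ) : ℂ :=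
  ∑ a ∈ s, if a ≤ n0 then c a * ee x ^ a * (rk k : ℂ) ^ (2 * (a - n0).natAbs) else 0

lemma osc (s : Finset ℤ) (c : ℤ → ℂ) (n0 : ℤ) {k : ℕ} (hk : 1 ≤ k) (x : ℝ) :
    ∑ j ∈ Finset.range (2 ^ k), ‖Rp s c (n0 + j) x - (Rp s c n0 x + cl s c k n0 x)‖ ^ 2 ≤
      16 * 2 ^ k * BB k (fun u => ‖tp s c u‖) x := by
  set r := rk k with hr
  have hr0 : 0 ≤ r := rk_nonneg k
  have hr1 : r < 1 := rk_lt k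
  set q : ℝ → ℂ := fun t => ∑ a ∈ s, c a * ee x ^ a * (r : ℂ) ^ (a - n0).natAbs * ee t ^ (a - n0) with hq
  have hqc : Continuous q := by rw [hq]; fun_prop
  have hcc := continuous_cauchy hr0 hr1
  set f : ℝ → ℂ := fun t => q t * (1 - r * ee t)⁻¹ with hf
  have hfc : Continuous f := hqc.mul hcc
  have hcoef : ∀ j : ℕ, ∫ t, ee t ^ (-(j:ℤ)) * f t ∂mu =
      (r:ℂ) ^ j * (-(Rp s c (n0 + j) x - (Rp s c n0 x + cl s c k n0 x))) := by
    intro j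
    have e1 : ∀ t, ee t ^ (-(j:ℤ)) * f t = ∑ a ∈ s, c a * ee x ^ a * (r : ℂ) ^ (a - n0).natAbs *
        (ee t ^ (a - n0 - j) * (1 - r * ee t)⁻¹) := by
      intro t
      rw [hf, hq]
      simp only
      rw [Finset.sum_mul, Finset.mul_sum]
      refine Finset.sum_congr rfl fun a _ => ?_
      rw [sub_eq_add_neg (a - n0), zpow_add₀ (ee_ne t)]; ring
    simp_rw [e1]
    have hcc2 : Continuous (fun t => (1 - (r:ℂ) * ee t)⁻¹ : ℝ → ℂ) := hcc
    rw [integral_finsetSum _ (fun a _ => integrable_mu (by fun_prop))]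
    simp_rw [integral_const_mul, cauchy_coef hr0 hr1]
    unfold Rp cl
    rw [← Finset.sum_add_distrib, ← Finset.sum_sub_distrib, ← Finset.sum_neg_distrib, Finset.mul_sum]
    refine Finset.sum_congr rfl fun a _ => ?_
    rcases lt_trichotomy a n0 with h | h | h
    · rw [if_pos (by omega), if_neg (by omega), if_neg (by omega), if_pos (by omega)]
      have : (a - n0 - j).natAbs = (a - n0).natAbs + j := by omega
      rw [this]; ring
    · subst h
      rw [if_pos (by omega), if_neg (by omega), if_neg (by omega), if_pos (by omega)]
      have : (a - a - j).natAbs = j := by omega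
      rw [this]; simp; ring
    · by_cases h2 : a ≤ n0 + j
      · rw [if_pos (by omega), if_neg (by omega), if_pos (by omega), if_neg (by omega)]
        have : j = (a - n0).natAbs + (a - n0 - j).natAbs := by omega
        have e : (r:ℂ) ^ j = (r:ℂ) ^ (a - n0).natAbs * (r:ℂ) ^ (a - n0 - j).natAbs := by
          rw [← pow_add, ← this]
        rw [e]; ring
      · rw [if_neg (by omega), if_pos (by omega), if_pos (by omega), if_neg (by omega)]
        ring
  have hb := bessel hfc (2 ^ k)
  simp_rw [hcoef] at hb
  have hBf : ∫ t, ‖f t‖ ^ 2 ∂mu ≤ 2 ^ k * BB k (fun u => ‖tp s c u‖) x := by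
    rw [← BB_shift, ← integral_const_mul]
    have hcP := continuous_PG k (G := fun u => ‖tp s c u‖) (by fun_prop)
    apply integral_mono (integrable_mu (by fun_prop)) (integrable_mu (by fun_prop))
    intro t
    simp only [hf]
    rw [norm_mul, mul_pow, norm_inv, inv_pow, normSq_one_sub]
    have h1 : ‖q t‖ ^ 2 ≤ (PG k (fun u => ‖tp s c u‖) (x + t)) ^ 2 := by
      have := osc_aux s c n0 k x t
      gcongr
    have h2 : ((1 - r) ^ 2 + r * (2 - 2 * Real.cos t))⁻¹ ≤ 2 ^ k * Pk r t := by
      unfold Pk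
      have hd := Pk_den_pos hr0 hr1 t
      rw [← mul_div_assoc, inv_eq_one_div]
      gcongr
      have h3 := ek_mul_two_pow k
      have h4 := ek_pos k; have h5 := ek_le_one k
      rw [hr]; unfold rk
      nlinarith [mul_nonneg (by positivity : (0:ℝ) ≤ ek k * 2 ^ k) (by linarith : 0 ≤ 1 - ek k)]
    have h3 : 0 ≤ ((1 - r) ^ 2 + r * (2 - 2 * Real.cos t))⁻¹ := (inv_pos.mpr (Pk_den_pos hr0 hr1 t)).le
    calc _ ≤ (PG k (fun u => ‖tp s c u‖) (x + t)) ^ 2 * (2 ^ k * Pk r t) := by gcongr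
      _ = _ := by ring
  have hlow : ∑ j ∈ Finset.range (2 ^ k), 1 / 16 * ‖Rp s c (n0 + j) x - (Rp s c n0 x + cl s c k n0 x)‖ ^ 2 ≤
      ∑ j ∈ Finset.range (2 ^ k), ‖(r:ℂ) ^ j * (-(Rp s c (n0 + j) x - (Rp s c n0 x + cl s c k n0 x)))‖ ^ 2 := by
    refine Finset.sum_le_sum fun j hj => ?_
    rw [norm_mul, norm_neg, mul_pow, norm_pow, Complex.norm_real, Real.norm_of_nonneg hr0]
    exact mul_le_mul_of_nonneg_right (rk_pow_lower' hk (Finset.mem_range.mp hj)) (sq_nonneg _)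
  rw [← Finset.mul_sum] at hlow
  linarith

lemma jensen_PG (k : ℕ) {G : ℝ → ℝ} (hG : Continuous G) (x : ℝ) :
    (PG k (PG k G) x) ^ 2 ≤ BB k G x := by
  have hc := continuous_PG k hG
  set A := PG k (PG k G) x with hA
  have h1 : ∫ y, (Pk (rk k) (x - y)) * (2 * A * PG k G y - A ^ 2) ∂mu ≤ BB k G x := by
    apply integral_mono (integrable_mu (by fun_prop)) (integrable_mu (by fun_prop))
    intro y
    refine mul_le_mul_of_nonneg_left ?_ (Pk_rk_nonneg _ _)
    nlinarith [sq_nonneg (A - PG k G y)]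
  have h2 : ∫ y, (Pk (rk k) (x - y)) * (2 * A * PG k G y - A ^ 2) ∂mu = 2 * A * A - A ^ 2 := by
    have e : ∀ y, (Pk (rk k) (x - y)) * (2 * A * PG k G y - A ^ 2) =
        2 * A * (Pk (rk k) (x - y) * PG k G y) - A ^ 2 * Pk (rk k) (x - y) := fun y => by ring
    simp_rw [e]
    rw [integral_sub (integrable_mu (by fun_prop)) (integrable_mu (by fun_prop)), integral_const_mul,
      integral_const_mul, integral_Pk_sub (rk_nonneg k) (rk_lt k)]
    rw [hA]; unfold PG; ring
  nlinarith

lemma BB_nonneg (k : ℕ) (G : ℝ → ℝ) (x : ℝ) : 0 ≤ BB k G x :=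
  integral_nonneg fun y => mul_nonneg (Pk_rk_nonneg _ _) (sq_nonneg _)

/-- Poisson at radius r^2 -/
lemma tp_poisson_sq (s : Finset ℤ) (c : ℤ → ℂ) (k : ℕ) (x : ℝ) :
    ‖∑ a ∈ s, c a * ee x ^ a * (rk k : ℂ) ^ (2 * a.natAbs)‖ ^ 2 ≤ BB k (fun u => ‖tp s c u‖) x := by
  have hcG : Continuous (fun u => ‖tp s c u‖) := by fun_prop
  have hcP := continuous_PG k hcG
  have h1 : ∑ a ∈ s, c a * ee x ^ a * (rk k : ℂ) ^ (2 * a.natAbs) =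
      ∫ y, (Pk (rk k) (x - y) : ℂ) * ∑ a ∈ s, c a * ee y ^ a * (rk k : ℂ) ^ (a.natAbs) ∂mu := by
    simp_rw [Finset.mul_sum]
    have hc : Continuous (fun u => ((Pk (rk k) (x - u) : ℝ) : ℂ)) := by fun_prop
    rw [integral_finsetSum _ (fun a _ => integrable_mu (by fun_prop))]
    refine Finset.sum_congr rfl fun a _ => ?_
    have := poisson_zpow (rk_nonneg k) (rk_lt k) x a
    have e : ∀ y, (Pk (rk k) (x - y) : ℂ) * (c a * ee y ^ a * (rk k : ℂ) ^ (a.natAbs)) =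
      (c a * (rk k : ℂ) ^ (a.natAbs)) * ((Pk (rk k) (x - y) : ℂ) * ee y ^ a) := fun y => by ring
    simp_rw [e]
    rw [integral_const_mul, this]; ring
  have h2 : ‖∑ a ∈ s, c a * ee x ^ a * (rk k : ℂ) ^ (2 * a.natAbs)‖ ≤ PG k (PG k (fun u => ‖tp s c u‖)) x := by
    rw [h1]
    refine (norm_integral_le_integral_norm _).trans ?_
    rw [PG.eq_1 k (PG k _)]
    refine integral_mono ?_ ?_ ?_
    · have hc : Continuous (fun u => ((Pk (rk k) (x - u) : ℝ) : ℂ)) := by fun_prop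
      exact integrable_mu (by fun_prop)
    · exact integrable_mu (by fun_prop)
    · intro y
      simp only
      rw [norm_mul, Complex.norm_real, Real.norm_of_nonneg (Pk_rk_nonneg _ _)]
      refine mul_le_mul_of_nonneg_left ?_ (Pk_rk_nonneg _ _)
      have := osc_aux s c 0 k 0 y
      simp only [ee_zero, one_zpow, mul_one, sub_zero, zero_add] at this
      refine le_trans (le_of_eq ?_) this
      congr 1
      refine Finset.sum_congr rfl fun a _ => ?_
      ring
  calc _ ≤ (PG k (PG k (fun u => ‖tp s c u‖)) x) ^ 2 := by gcongr
    _ ≤ _ := jensen_PG k hcG x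

lemma center_zero (s : Finset ℤ) (c : ℤ → ℂ) (k : ℕ) (x : ℝ) :
    ‖Rp s c 0 x + cl s c k 0 x‖ ≤ ‖Ph s c 1 x‖ + ‖Ph s c (rk k ^ 2) x‖ +
      √(BB k (fun u => ‖tp s c u‖) x) := by
  have h1 : Rp s c 0 x + cl s c k 0 x = Ph s c 1 x - Ph s c (rk k ^ 2) x +
      ∑ a ∈ s, c a * ee x ^ a * (rk k : ℂ) ^ (2 * a.natAbs) := by
    unfold Rp cl Ph
    rw [← Finset.sum_add_distrib, ← Finset.sum_sub_distrib, ← Finset.sum_add_distrib]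
    refine Finset.sum_congr rfl fun a _ => ?_
    by_cases h : 0 < a
    · rw [if_pos h, if_pos h, if_pos h, if_neg (by omega)]
      push_cast
      rw [pow_mul]; ring
    · rw [if_neg h, if_neg h, if_neg h, if_pos (by omega)]
      simp
  have h2 := Real.le_sqrt_of_sq_le (tp_poisson_sq s c k x)
  rw [h1]
  refine (norm_add_le _ _).trans ?_
  have := norm_sub_le (Ph s c 1 x) (Ph s c (rk k ^ 2) x)
  linarith

/-! ### Herglotz transform -/

def Fh (w : ℝ → ℝ) (z : ℂ) : ℂ := ∫ t, (w t : ℂ) * (2 * (1 - z * ee (-t))⁻¹ - 1) ∂mu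

lemma one_sub_lower {z : ℂ} {q : ℝ} (hz : ‖z‖ ≤ q) (t : ℝ) : 1 - q ≤ ‖1 - z * ee (-t)‖ := by
  have h1 : ‖(1:ℂ)‖ - ‖z * ee (-t)‖ ≤ ‖1 - z * ee (-t)‖ := norm_sub_norm_le _ _
  rw [norm_mul, norm_ee, norm_one, mul_one] at h1
  linarith

lemma one_sub_ne' {z : ℂ} (hz : ‖z‖ < 1) (t : ℝ) : 1 - z * ee (-t) ≠ 0 := by
  have := one_sub_lower (le_refl ‖z‖) t
  intro h
  rw [h, norm_zero] at this
  linarith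

lemma continuous_ker {z : ℂ} (hz : ‖z‖ < 1) : Continuous (fun t => (1 - z * ee (-t))⁻¹) :=
  Continuous.inv₀ (by fun_prop) (one_sub_ne' hz)

lemma integrable_mul_cont {w : ℝ → ℝ} (hw : Integrable w mu) {h : ℝ → ℂ} (hh : Continuous h)
    {B : ℝ} (hB : ∀ t, ‖h t‖ ≤ B) : Integrable (fun t => (w t : ℂ) * h t) mu :=
  hw.ofReal.mul_bdd hh.aestronglyMeasurable (Filter.Eventually.of_forall hB)

lemma ker_bound {z : ℂ} {q : ℝ} (hq : q < 1) (hz : ‖z‖ ≤ q) (t : ℝ) :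
    ‖(1 - z * ee (-t))⁻¹‖ ≤ (1 - q)⁻¹ := by
  rw [norm_inv]
  exact inv_anti₀ (by linarith) (one_sub_lower hz t)

lemma integrable_Fh {w : ℝ → ℝ} (hw : Integrable w mu) {z : ℂ} (hz : ‖z‖ < 1) :
    Integrable (fun t => (w t : ℂ) * (2 * (1 - z * ee (-t))⁻¹ - 1)) mu := by
  have hc := continuous_ker hz
  apply integrable_mul_cont hw (by fun_prop) (B := 2 * (1 - ‖z‖)⁻¹ + 1)
  intro t
  refine (norm_sub_le _ _).trans ?_
  rw [norm_mul, norm_one, Complex.norm_ofNat]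
  have := ker_bound hz le_rfl t
  linarith

lemma hasDerivAt_Fh {w : ℝ → ℝ} (hw : Integrable w mu) {z : ℂ} (hz : ‖z‖ < 1) :
    DifferentiableAt ℂ (Fh w) z := by
  set q : ℝ := (1 + ‖z‖) / 2 with hq
  have hq1 : q < 1 := by rw [hq]; linarith
  have hzq : ‖z‖ < q := by rw [hq]; linarith
  have hs : Metric.ball (0:ℂ) q ∈ nhds z := Metric.isOpen_ball.mem_nhds (by simpa using hzq)
  have hmem : ∀ y ∈ Metric.ball (0:ℂ) q, ‖y‖ ≤ q := fun y hy => by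
    simp only [mem_ball_zero_iff] at hy; exact hy.le
  have hcz := continuous_ker hz
  have := hasDerivAt_integral_of_dominated_loc_of_deriv_le (𝕜 := ℂ) (μ := mu)
    (F := fun z t => (w t : ℂ) * (2 * (1 - z * ee (-t))⁻¹ - 1))
    (F' := fun z t => (w t : ℂ) * (2 * (ee (-t) * ((1 - z * ee (-t))⁻¹ * (1 - z * ee (-t))⁻¹))))
    (bound := fun t => ‖w t‖ * (2 * ((1 - q)⁻¹ * (1 - q)⁻¹))) hs ?_ (integrable_Fh hw hz) ?_ ?_ ?_ ?_
  · exact this.2.differentiableAt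
  · filter_upwards [hs] with y hy
    exact (integrable_Fh hw ((hmem y hy).trans_lt hq1)).aestronglyMeasurable
  · refine hw.ofReal.aestronglyMeasurable.mul ?_
    have : Continuous fun t => 2 * (ee (-t) * ((1 - z * ee (-t))⁻¹ * (1 - z * ee (-t))⁻¹)) := by fun_prop
    exact this.aestronglyMeasurable
  · refine Filter.Eventually.of_forall fun t y hy => ?_
    have hb := ker_bound hq1 (hmem y hy) t
    rw [norm_mul, norm_mul, norm_mul, norm_mul, norm_ee, Complex.norm_ofNat, one_mul, Complex.norm_real]
    gcongr
  · exact hw.norm.mul_const _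
  · refine Filter.Eventually.of_forall fun t y hy => ?_
    have hne := one_sub_ne' ((hmem y hy).trans_lt hq1) t
    have h1 : HasDerivAt (fun z : ℂ => 1 - z * ee (-t)) (-(1 * ee (-t))) y :=
      ((hasDerivAt_id y).mul_const (ee (-t))).const_sub 1
    have h2 := (((h1.inv hne).const_mul 2).sub_const 1).const_mul (w t : ℂ)
    have e : (w t : ℂ) * (2 * (ee (-t) * ((1 - y * ee (-t))⁻¹ * (1 - y * ee (-t))⁻¹))) =
        (w t : ℂ) * (2 * (- -(1 * ee (-t)) / (1 - y * ee (-t)) ^ 2)) := by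
      rw [div_eq_mul_inv, ← inv_pow]
      ring
    rw [e]
    exact h2

lemma Fh_zero (w : ℝ → ℝ) : Fh w 0 = ((∫ t, w t ∂mu : ℝ) : ℂ) := by
  unfold Fh
  simp only [zero_mul, sub_zero, inv_one, mul_one]
  norm_num
  exact integral_complex_ofReal

/-- the kernel at `rho e^{ix}` -/
lemma ker_re {rho : ℝ} (h0 : 0 ≤ rho) (h1 : rho < 1) (u : ℝ) :
    (2 * (1 - rho * ee u)⁻¹ - 1).re = Pk rho u := by
  have hd := Pk_den_pos h0 h1 u
  unfold Pk
  rw [Complex.sub_re, Complex.mul_re, Complex.inv_re, Complex.inv_im, Complex.normSq_eq_norm_sq, normSq_one_sub]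
  have hre : (ee u).re = Real.cos u := by simp [ee, Complex.exp_ofReal_mul_I_re]
  simp [hre]
  rw [mul_div_assoc', div_sub_one hd.ne', div_left_inj' hd.ne']
  ring

lemma ee_mul_neg (x t : ℝ) : ee x * ee (-t) = ee (x - t) := by
  rw [sub_eq_add_neg, ee_add]

lemma Fh_polar (w : ℝ → ℝ) (rho x : ℝ) :
    Fh w (rho * ee x) = ∫ t, (w t : ℂ) * (2 * (1 - rho * ee (x - t))⁻¹ - 1) ∂mu := by
  unfold Fh
  simp_rw [mul_assoc (rho:ℂ), ee_mul_neg]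

lemma norm_rho {rho : ℝ} (h0 : 0 ≤ rho) (x : ℝ) : ‖(rho * ee x : ℂ)‖ = rho := by
  rw [norm_mul, norm_ee, mul_one, Complex.norm_real, Real.norm_of_nonneg h0]

lemma integrable_polar {w : ℝ → ℝ} (hw : Integrable w mu) {rho : ℝ} (h0 : 0 ≤ rho) (h1 : rho < 1) (x : ℝ) :
    Integrable (fun t => (w t : ℂ) * (2 * (1 - rho * ee (x - t))⁻¹ - 1)) mu := by
  have := integrable_Fh hw (z := rho * ee x) (by rw [norm_rho h0]; exact h1)
  simp_rw [mul_assoc (rho:ℂ), ee_mul_neg] at this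
  exact this

lemma Fh_re {w : ℝ → ℝ} (hw : Integrable w mu) {rho : ℝ} (h0 : 0 ≤ rho) (h1 : rho < 1) (x : ℝ) :
    (Fh w (rho * ee x)).re = ∫ t, w t * Pk rho (x - t) ∂mu := by
  have := integral_re (𝕜 := ℂ) (integrable_polar hw h0 h1 x)
  rw [Fh_polar]
  refine Eq.trans this.symm ?_
  congr 1; ext t
  simp only [RCLike.re_eq_complex_re]
  rw [Complex.re_ofReal_mul, ker_re h0 h1]

lemma exists_polar (z : ℂ) : ∃ rho x : ℝ, 0 ≤ rho ∧ ‖z‖ = rho ∧ z = rho * ee x :=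
  ⟨‖z‖, z.arg, norm_nonneg z, rfl, (Complex.norm_mul_exp_arg_mul_I z).symm⟩

lemma Fh_re_nonneg {w : ℝ → ℝ} (hw : Integrable w mu) (hw0 : ∀ t, 0 ≤ w t) {z : ℂ} (hz : ‖z‖ < 1) :
    0 ≤ (Fh w z).re := by
  obtain ⟨rho, x, h0, hn, rfl⟩ := exists_polar z
  rw [hn] at hz
  rw [Fh_re hw h0 hz]
  exact integral_nonneg fun t => mul_nonneg (hw0 t) (Pk_nonneg h0 hz _)

lemma diffContOnCl_scaled {F : ℂ → ℂ} (hF : ∀ z, ‖z‖ < 1 → DifferentiableAt ℂ F z) {R : ℝ}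
    (h0 : 0 ≤ R) (h1 : R < 1) : DiffContOnCl ℂ (fun z => F (R * z)) (Metric.ball 0 1) := by
  apply DifferentiableOn.diffContOnCl
  rw [closure_ball _ one_ne_zero]
  intro z hz
  apply DifferentiableAt.differentiableWithinAt
  have hz' : ‖z‖ ≤ 1 := by simpa using hz
  have h2 : ‖(R:ℂ) * z‖ < 1 := by
    rw [norm_mul, Complex.norm_real, Real.norm_of_nonneg h0]; nlinarith [norm_nonneg z]
  exact DifferentiableAt.comp z (hF _ h2) (by fun_prop)

/-- double Poisson -/
lemma PG_PG {W : ℂ → ℂ} (hW : DiffContOnCl ℂ W (Metric.ball 0 1)) (k : ℕ) (x : ℝ) :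
    PG k (PG k (fun t => (W (ee t)).re)) x = (W (((rk k) ^ 2 : ℝ) * ee x)).re := by
  have hcont : Continuous (fun t => W (ee t)) := by
    have := hW.continuousOn
    rw [closure_ball _ one_ne_zero] at this
    exact this.comp_continuous continuous_ee (by intro t; simp)
  have key : ∀ V : ℂ → ℂ, DiffContOnCl ℂ V (Metric.ball 0 1) → Continuous (fun t => V (ee t)) → ∀ y,
      PG k (fun t => (V (ee t)).re) y = (V (rk k * ee y)).re := by
    intro V hV hc y
    rw [← poisson_formula hV (rk_nonneg k) (rk_lt k) y]
    have hcP : Continuous (fun u => ((Pk (rk k) (y - u) : ℝ) : ℂ)) := by fun_prop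
    have := integral_re (𝕜 := ℂ) (μ := mu) (f := fun t => (Pk (rk k) (y - t) : ℂ) * V (ee t))
      (integrable_mu (hcP.mul hc))
    refine Eq.trans ?_ this
    unfold PG
    congr 1; ext t
    simp only [RCLike.re_eq_complex_re]
    rw [Complex.re_ofReal_mul]
  have h1 : PG k (fun t => (W (ee t)).re) = fun y => (W (rk k * ee y)).re := funext (key W hW hcont)
  rw [h1]
  have hW2 : DiffContOnCl ℂ (fun z => W (rk k * z)) (Metric.ball 0 1) := by
    refine hW.comp (g := fun z => (rk k : ℂ) * z) ?_ ?_
    · exact Differentiable.diffContOnCl (by fun_prop)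
    · intro z hz
      simp only [mem_ball_zero_iff] at hz ⊢
      rw [norm_mul, Complex.norm_real, Real.norm_of_nonneg (rk_nonneg k)]
      nlinarith [rk_nonneg k, rk_lt k, norm_nonneg z]
  have hc2 : Continuous (fun t => W (rk k * ee t)) := by
    have := hW2.continuousOn
    rw [closure_ball _ one_ne_zero] at this
    exact this.comp_continuous continuous_ee (by intro t; simp)
  rw [key _ hW2 hc2 x]
  congr 2
  push_cast; ring

lemma ratio_re {F : ℂ} {lam : ℝ} (hlam : 0 < lam) (hF : 0 ≤ F.re) :
    0 ≤ (F / (lam + F)).re ∧ (lam ≤ ‖F‖ → 1 / 4 ≤ (F / (lam + F)).re) := by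
  have hsq : ‖F‖ ^ 2 = F.re * F.re + F.im * F.im := by
    rw [← Complex.normSq_eq_norm_sq, Complex.normSq_apply]
  have hden : Complex.normSq (lam + F) = (lam + F.re) * (lam + F.re) + F.im * F.im := by
    rw [Complex.normSq_apply]; simp
  have hdp : 0 < (lam + F.re) * (lam + F.re) + F.im * F.im := by nlinarith [mul_self_nonneg F.im]
  have e : (F / (lam + F)).re = (F.re * F.re + F.im * F.im + lam * F.re) /
      ((lam + F.re) * (lam + F.re) + F.im * F.im) := by
    rw [Complex.div_re, hden]; simp; field_simp; ring
  rw [e]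
  constructor
  · apply div_nonneg _ hdp.le
    nlinarith [mul_self_nonneg F.im, mul_self_nonneg F.re, mul_nonneg hlam.le hF]
  · intro h
    rw [div_le_div_iff₀ (by norm_num) hdp]
    have : lam ^ 2 ≤ ‖F‖ ^ 2 := by gcongr
    rw [hsq] at this
    nlinarith [mul_nonneg hlam.le hF, mul_self_nonneg F.im, mul_self_nonneg F.re]

/-- Kolmogorov -/
lemma kolmogorov {w : ℝ → ℝ} (hw : Integrable w mu) (hw0 : ∀ t, 0 ≤ w t) {lam : ℝ} (hlam : 0 < lam)
    {R : ℝ} (h0 : 0 ≤ R) (h1 : R < 1) (K : ℕ) :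
    mu {x | lam ≤ ‖Fh w (R * ee x)‖ ∨ ∃ k, 1 ≤ k ∧ k ≤ K ∧ lam ≤ ‖Fh w (R * (((rk k) ^ 2 : ℝ) * ee x))‖} ≤
      ENNReal.ofReal (600005 * (∫ t, w t ∂mu) / lam) := by
  set W : ℂ → ℂ := fun z => Fh w (R * z) / (lam + Fh w (R * z)) with hW
  have hre : ∀ z, ‖z‖ ≤ 1 → 0 ≤ (Fh w (R * z)).re := by
    intro z hz
    apply Fh_re_nonneg hw hw0
    rw [norm_mul, Complex.norm_real, Real.norm_of_nonneg h0]; nlinarith [norm_nonneg z]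
  have hWd : DiffContOnCl ℂ W (Metric.ball 0 1) := by
    apply DifferentiableOn.diffContOnCl
    rw [closure_ball _ one_ne_zero]
    intro z hz
    have hz' : ‖z‖ ≤ 1 := by simpa using hz
    apply DifferentiableAt.differentiableWithinAt
    have h2 : ‖(R:ℂ) * z‖ < 1 := by
      rw [norm_mul, Complex.norm_real, Real.norm_of_nonneg h0]; nlinarith [norm_nonneg z]
    have hd : DifferentiableAt ℂ (fun z => Fh w (R * z)) z :=
      DifferentiableAt.comp (g := Fh w) (f := fun z => (R:ℂ) * z) z (hasDerivAt_Fh hw h2) (by fun_prop)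
    refine hd.div (hd.const_add _) ?_
    intro h
    have := congrArg Complex.re h
    simp at this
    linarith [hre z hz']
  have hcont : Continuous (fun t => W (ee t)) := by
    have := hWd.continuousOn
    rw [closure_ball _ one_ne_zero] at this
    exact this.comp_continuous continuous_ee (by intro t; simp)
  set G : ℝ → ℝ := fun t => (W (ee t)).re with hG
  have hGc : Continuous G := Complex.continuous_re.comp hcont
  have hG0 : ∀ t, 0 ≤ G t := fun t => (ratio_re hlam (hre _ (by simp))).1
  set A := ∫ t, w t ∂mu with hA
  have hA0 : 0 ≤ A := integral_nonneg hw0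
  have hint : ∫ t, G t ∂mu ≤ A / lam := by
    have h2 := integral_re (𝕜 := ℂ) (μ := mu) (f := fun t => W (ee t)) (integrable_mu hcont)
    rw [mean_value hWd] at h2
    have h3 : W 0 = ((A / (lam + A) : ℝ) : ℂ) := by
      simp only [hW, mul_zero, Fh_zero]; push_cast; rfl
    rw [h3] at h2
    have h4 : ∫ t, G t ∂mu = A / (lam + A) := by
      refine Eq.trans h2 ?_
      simp only [RCLike.re_eq_complex_re, Complex.ofReal_re]
    rw [h4]
    gcongr; linarith
  have hsub : {x | lam ≤ ‖Fh w (R * ee x)‖ ∨ ∃ k, 1 ≤ k ∧ k ≤ K ∧ lam ≤ ‖Fh w (R * (((rk k) ^ 2 : ℝ) * ee x))‖}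
      ⊆ {x | 1 / 5 < G x} ∪ {x | ∃ k, 1 ≤ k ∧ k ≤ K ∧ 250000 * (1 / 3000 : ℝ) ^ 2 < BB k G x} := by
    rintro x (hx | ⟨k, hk, hkK, hx⟩)
    · left
      have := (ratio_re hlam (hre (ee x) (by simp))).2 hx
      simp only [mem_setOf_eq, hG, hW]
      linarith
    · right
      refine ⟨k, hk, hkK, ?_⟩
      have hn : ‖(((rk k) ^ 2 : ℝ) * ee x : ℂ)‖ ≤ 1 := by
        rw [norm_rho (sq_nonneg _)]
        have := rk_nonneg k; have := rk_lt k; nlinarith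
      have h2 := (ratio_re hlam (hre _ hn)).2 hx
      have h3 := PG_PG hWd k x
      have h4 := jensen_PG k hGc x
      have h5 : 1 / 4 ≤ PG k (PG k G) x := by rw [h3]; exact h2
      nlinarith
  refine (measure_mono hsub).trans ((measure_union_le _ _).trans ?_)
  have m1 := chebyshev_mu hGc hG0 (a := 1 / 5) (by norm_num)
  have m2 := lemmaD hGc hG0 (lam := 1 / 3000) (by norm_num) K
  refine (add_le_add m1 m2).trans ?_
  have hIG : 0 ≤ ∫ t, G t ∂mu := integral_nonneg hG0
  rw [← ENNReal.ofReal_add (by positivity) (by positivity)]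
  apply ENNReal.ofReal_le_ofReal
  have e1 : 600005 * A / lam = 600005 * (A / lam) := mul_div_assoc _ _ _
  rw [e1]
  linarith

/-! ### weak type bound for the analytic projections -/

lemma continuous_kerp {rho : ℝ} (h0 : 0 ≤ rho) (h1 : rho < 1) (x : ℝ) :
    Continuous (fun t => 2 * (1 - rho * ee (x - t))⁻¹ - 1) := by
  have h := (continuous_cauchy h0 h1).comp (continuous_const.sub continuous_id : Continuous fun t : ℝ => x - t)
  exact (continuous_const.mul h).sub continuous_const

lemma cker_pos {rho : ℝ} (h0 : 0 ≤ rho) (h1 : rho < 1) (x : ℝ) (a : ℤ) :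
    ∫ t, ee t ^ a * (2 * (1 - rho * ee (x - t))⁻¹ - 1) ∂mu =
      (if 0 < a then 2 * (rho ^ a.natAbs * ee x ^ a) else 0) + if a = 0 then 1 else 0 := by
  have hper : Function.Periodic (fun u => ee u ^ (-a) * (1 - rho * ee u)⁻¹) (2 * Real.pi) := by
    intro u
    simp only [ee_periodic u]
  have hA : ∫ t, ee t ^ a * (1 - rho * ee (x - t))⁻¹ ∂mu =
      ee x ^ a * (if 0 ≤ a then (rho:ℂ) ^ a.natAbs else 0) := by
    have e1 : ∀ t, ee t ^ a * (1 - rho * ee (x - t))⁻¹ =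
        ee x ^ a * (ee (x - t) ^ (-a) * (1 - rho * ee (x - t))⁻¹) := by
      intro t
      rw [← mul_assoc, ee_sub, mul_zpow, zpow_neg, inv_zpow, zpow_neg, inv_inv, ← mul_assoc (ee x ^ a) _ (ee t ^ a),
        mul_inv_cancel₀ (zpow_ne_zero a (ee_ne x)), one_mul]
    simp_rw [e1]
    rw [integral_const_mul, integral_mu_sub hper x, cauchy_coef h0 h1]
    simp [Int.natAbs_neg]
  have hc := continuous_kerp h0 h1 x
  have hcc : Continuous (fun t => (1 - rho * ee (x - t))⁻¹) :=
    (continuous_cauchy h0 h1).comp (continuous_const.sub continuous_id : Continuous fun t : ℝ => x - t)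
  have hz := continuous_ee_zpow a
  have e2 : ∀ t, ee t ^ a * (2 * (1 - rho * ee (x - t))⁻¹ - 1) =
      2 * (ee t ^ a * (1 - rho * ee (x - t))⁻¹) - ee t ^ a := by intro t; ring
  simp_rw [e2]
  have i1 : Integrable (fun t => 2 * (ee t ^ a * (1 - rho * ee (x - t))⁻¹)) mu :=
    integrable_mu (continuous_const.mul (hz.mul hcc))
  rw [integral_sub i1 (integrable_mu hz),
    integral_const_mul, hA, integral_ee_zpow]
  rcases lt_trichotomy a 0 with h | h | h
  · simp [not_le.mpr h, not_lt.mpr h.le, h.ne]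
  · subst h; norm_num
  · simp [h.le, h, h.ne']; ring

lemma tp_ker {rho : ℝ} (h0 : 0 ≤ rho) (h1 : rho < 1) (s : Finset ℤ) (c : ℤ → ℂ) (x : ℝ) :
    ∫ t, tp s c t * (2 * (1 - rho * ee (x - t))⁻¹ - 1) ∂mu =
      2 * Ph s c rho x + ∫ t, tp s c t ∂mu := by
  have hc := continuous_kerp h0 h1 x
  have hI : ∫ t, tp s c t ∂mu = ∑ a ∈ s, c a * (if a = 0 then 1 else 0) := by
    unfold tp
    have i1 : ∀ a ∈ s, Integrable (fun t => c a * ee t ^ a) mu :=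
      fun a _ => integrable_mu (continuous_const.mul (continuous_ee_zpow a))
    rw [integral_finsetSum _ i1]
    refine Finset.sum_congr rfl fun a _ => ?_
    rw [integral_const_mul, integral_ee_zpow]
  rw [hI]
  unfold tp Ph
  simp_rw [Finset.sum_mul, mul_assoc]
  have i1 : ∀ a ∈ s, Integrable (fun t => c a * (ee t ^ a * (2 * (1 - rho * ee (x - t))⁻¹ - 1))) mu :=
    fun a _ => integrable_mu (continuous_const.mul ((continuous_ee_zpow a).mul hc))
  rw [integral_finsetSum _ i1, Finset.mul_sum, ← Finset.sum_add_distrib]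
  refine Finset.sum_congr rfl fun a _ => ?_
  rw [integral_const_mul, cker_pos h0 h1]
  split_ifs <;> ring

def wq (g : ℝ → ℂ) (q : Fin 4) (t : ℝ) : ℝ :=
  match q with
  | 0 => max (g t).re 0
  | 1 => max (-(g t).re) 0
  | 2 => max (g t).im 0
  | 3 => max (-(g t).im) 0

lemma wq_cont {g : ℝ → ℂ} (hg : Continuous g) (q : Fin 4) : Continuous (wq g q) := by
  have h1 := Complex.continuous_re.comp hg
  have h2 := Complex.continuous_im.comp hg
  fin_cases q
  · exact h1.max continuous_const
  · exact h1.neg.max continuous_const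
  · exact h2.max continuous_const
  · exact h2.neg.max continuous_const

lemma wq_nonneg (g : ℝ → ℂ) (q : Fin 4) (t : ℝ) : 0 ≤ wq g q t := by
  fin_cases q <;> exact le_max_right _ _

lemma wq_le (g : ℝ → ℂ) (q : Fin 4) (t : ℝ) : wq g q t ≤ ‖g t‖ := by
  have h1 := abs_le.mp (Complex.abs_re_le_norm (g t))
  have h2 := abs_le.mp (Complex.abs_im_le_norm (g t))
  have h3 := norm_nonneg (g t)
  fin_cases q <;> refine max_le ?_ h3 <;> linarith

lemma wq_decomp (g : ℝ → ℂ) (t : ℝ) :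
    g t = (wq g 0 t : ℂ) - wq g 1 t + Complex.I * (wq g 2 t - wq g 3 t) := by
  have key : ∀ r : ℝ, max r 0 - max (-r) 0 = r := fun r => by
    rcases le_total 0 r with h | h
    · rw [max_eq_left h, max_eq_right (by linarith)]; ring
    · rw [max_eq_right h, max_eq_left (by linarith)]; ring
  have h1 := key (g t).re
  have h2 := key (g t).im
  apply Complex.ext
  · simp [wq]
  · simp [wq]

lemma Fh_decomp {g : ℝ → ℂ} (hg : Continuous g) {rho : ℝ} (h0 : 0 ≤ rho) (h1 : rho < 1) (x : ℝ) :
    ∫ t, g t * (2 * (1 - rho * ee (x - t))⁻¹ - 1) ∂mu =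
      Fh (wq g 0) (rho * ee x) - Fh (wq g 1) (rho * ee x) +
        Complex.I * (Fh (wq g 2) (rho * ee x) - Fh (wq g 3) (rho * ee x)) := by
  simp_rw [Fh_polar]
  have hi : ∀ q, Integrable (fun t => (wq g q t : ℂ) * (2 * (1 - rho * ee (x - t))⁻¹ - 1)) mu :=
    fun q => integrable_polar (integrable_mu (wq_cont hg q)) h0 h1 x
  rw [← integral_sub (hi 0) (hi 1), ← integral_sub (hi 2) (hi 3), ← integral_const_mul,
    ← integral_add]
  rotate_left
  · exact (hi 0).sub (hi 1)
  · exact ((hi 2).sub (hi 3)).const_mul _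
  congr 1; ext t
  conv_lhs => rw [wq_decomp g t]
  ring

/-- closeness of dilations -/
lemma exists_R (s : Finset ℤ) (c : ℤ → ℂ) {e : ℝ} (he : 0 < e) :
    ∃ R : ℝ, 0 ≤ R ∧ R < 1 ∧ ∑ a ∈ s, ‖c a‖ * (1 - R ^ a.natAbs) ≤ e := by
  have hc : Continuous (fun R : ℝ => ∑ a ∈ s, ‖c a‖ * (1 - R ^ a.natAbs)) := by fun_prop
  have h1 : (fun R : ℝ => ∑ a ∈ s, ‖c a‖ * (1 - R ^ a.natAbs)) 1 < e := by simpa using he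
  have h2 := hc.continuousAt.eventually_lt continuousAt_const h1
  have h3 : ∀ᶠ R in nhdsWithin (1:ℝ) (Iio 1), (fun R : ℝ => ∑ a ∈ s, ‖c a‖ * (1 - R ^ a.natAbs)) R < e :=
    h2.filter_mono nhdsWithin_le_nhds
  have h4 : ∀ᶠ R in nhdsWithin (1:ℝ) (Iio 1), R < 1 := eventually_mem_nhdsWithin
  have h5 : ∀ᶠ R in nhdsWithin (1:ℝ) (Iio 1), 0 < R :=
    (lt_mem_nhds (show (0:ℝ) < 1 by norm_num)).filter_mono nhdsWithin_le_nhds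
  obtain ⟨R, h, h', h''⟩ := (h3.and (h4.and h5)).exists
  exact ⟨R, h''.le, h', h.le⟩

lemma Ph_close (s : Finset ℤ) (c : ℤ → ℂ) {R rho : ℝ} (hR0 : 0 ≤ R) (hR1 : R < 1) (h0 : 0 ≤ rho)
    (h1 : rho ≤ 1) (x : ℝ) :
    ‖Ph s c rho x - Ph s c (R * rho) x‖ ≤ ∑ a ∈ s, ‖c a‖ * (1 - R ^ a.natAbs) := by
  unfold Ph
  rw [← Finset.sum_sub_distrib]
  refine (norm_sum_le _ _).trans (Finset.sum_le_sum fun a _ => ?_)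
  have hp : R ^ a.natAbs ≤ 1 := pow_le_one₀ hR0 hR1.le
  have hp2 : rho ^ a.natAbs ≤ 1 := pow_le_one₀ h0 h1
  have hp3 : 0 ≤ rho ^ a.natAbs := by positivity
  split_ifs
  · have e : c a * (rho:ℂ) ^ a.natAbs * ee x ^ a - c a * ((R * rho : ℝ):ℂ) ^ a.natAbs * ee x ^ a =
        c a * (((rho ^ a.natAbs * (1 - R ^ a.natAbs) : ℝ) : ℂ) * ee x ^ a) := by
      push_cast; rw [mul_pow]; ring
    rw [e, norm_mul, norm_mul, Complex.norm_real, norm_zpow, norm_ee, one_zpow, mul_one,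
      Real.norm_of_nonneg (mul_nonneg hp3 (by linarith))]
    gcongr
    nlinarith
  · simp only [sub_zero, norm_zero]
    exact mul_nonneg (norm_nonneg _) (by linarith)

lemma weak_Ph (s : Finset ℤ) (c : ℤ → ℂ) {lam : ℝ} (hlam : 0 < lam) (K : ℕ) :
    mu {x | lam < ‖Ph s c 1 x‖ ∨ ∃ k, 1 ≤ k ∧ k ≤ K ∧ lam < ‖Ph s c (rk k ^ 2) x‖} ≤
      ENNReal.ofReal (20000000 * (∫ t, ‖tp s c t‖ ∂mu) / lam) := by
  set A := ∫ t, ‖tp s c t‖ ∂mu with hA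
  have hA0 : 0 ≤ A := integral_nonneg fun t => norm_nonneg _
  have hgc := continuous_tp s c
  rcases lt_or_ge lam A with hAl | hAl
  · have h1 : mu {x | lam < ‖Ph s c 1 x‖ ∨ ∃ k, 1 ≤ k ∧ k ≤ K ∧ lam < ‖Ph s c (rk k ^ 2) x‖} ≤ 1 :=
      prob_le_one
    refine h1.trans ?_
    rw [← ENNReal.ofReal_one]
    apply ENNReal.ofReal_le_ofReal
    rw [le_div_iff₀ hlam]; linarith
  obtain ⟨R, hR0, hR1, hR⟩ := exists_R s c (show 0 < lam / 4 by positivity)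
  set E : Fin 4 → Set ℝ := fun q => {x | lam / 8 ≤ ‖Fh (wq (tp s c) q) (R * ee x)‖ ∨ ∃ k, 1 ≤ k ∧ k ≤ K ∧
    lam / 8 ≤ ‖Fh (wq (tp s c) q) (R * (((rk k) ^ 2 : ℝ) * ee x))‖} with hE
  have hEm : ∀ q, mu (E q) ≤ ENNReal.ofReal (600005 * A / (lam / 8)) := by
    intro q
    refine (kolmogorov (integrable_mu (wq_cont hgc q)) (wq_nonneg _ q) (by positivity) hR0 hR1 K).trans ?_
    apply ENNReal.ofReal_le_ofReal
    gcongr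
    exact integral_mono (integrable_mu (wq_cont hgc q)) (integrable_mu hgc.norm) (wq_le _ q)
  have key : ∀ rho : ℝ, 0 ≤ rho → rho ≤ 1 → ∀ x, lam < ‖Ph s c rho x‖ →
      ∃ q, lam / 8 ≤ ‖Fh (wq (tp s c) q) (R * (rho * ee x))‖ := by
    intro rho h0 h1 x hx
    by_contra! hcon
    have hp1 : R * rho < 1 := by nlinarith
    have hp0 : 0 ≤ R * rho := by positivity
    have h2 := tp_ker hp0 hp1 s c x
    rw [Fh_decomp hgc hp0 hp1 x] at h2
    have h3 := Ph_close s c hR0 hR1 h0 h1 x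
    have h4 : ‖∫ t, tp s c t ∂mu‖ ≤ A := norm_integral_le_integral_norm _
    have e : (((R * rho : ℝ) : ℂ) * ee x) = R * (rho * ee x) := by push_cast; ring
    rw [e] at h2
    have h5 : ‖2 * Ph s c (R * rho) x‖ ≤ 4 * (lam / 8) + A := by
      have : 2 * Ph s c (R * rho) x = Fh (wq (tp s c) 0) (R * (rho * ee x)) - Fh (wq (tp s c) 1) (R * (rho * ee x)) +
        Complex.I * (Fh (wq (tp s c) 2) (R * (rho * ee x)) - Fh (wq (tp s c) 3) (R * (rho * ee x))) -
          ∫ t, tp s c t ∂mu := by rw [h2]; ring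
      rw [this]
      refine (norm_sub_le _ _).trans (add_le_add ?_ h4)
      refine (norm_add_le _ _).trans ?_
      rw [norm_mul, Complex.norm_I, one_mul]
      have := norm_sub_le (Fh (wq (tp s c) 0) (R * (rho * ee x))) (Fh (wq (tp s c) 1) (R * (rho * ee x)))
      have := norm_sub_le (Fh (wq (tp s c) 2) (R * (rho * ee x))) (Fh (wq (tp s c) 3) (R * (rho * ee x)))
      linarith [hcon 0, hcon 1, hcon 2, hcon 3]
    rw [norm_mul, Complex.norm_ofNat] at h5
    have h6 : ‖Ph s c rho x‖ ≤ ‖Ph s c rho x - Ph s c (R * rho) x‖ + ‖Ph s c (R * rho) x‖ := by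
      simpa using norm_add_le (Ph s c rho x - Ph s c (R * rho) x) (Ph s c (R * rho) x)
    linarith
  have hsub : {x | lam < ‖Ph s c 1 x‖ ∨ ∃ k, 1 ≤ k ∧ k ≤ K ∧ lam < ‖Ph s c (rk k ^ 2) x‖} ⊆ ⋃ q, E q := by
    rintro x (hx | ⟨k, hk, hkK, hx⟩)
    · obtain ⟨q, hq⟩ := key 1 zero_le_one le_rfl x hx
      refine mem_iUnion.mpr ⟨q, Or.inl ?_⟩
      simpa using hq
    · obtain ⟨q, hq⟩ := key (rk k ^ 2) (sq_nonneg _)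
        (pow_le_one₀ (rk_nonneg k) (rk_lt k).le) x hx
      exact mem_iUnion.mpr ⟨q, Or.inr ⟨k, hk, hkK, hq⟩⟩
  refine (measure_mono hsub).trans ((measure_iUnion_fintype_le _ _).trans ?_)
  refine (Finset.sum_le_sum fun q _ => hEm q).trans ?_
  rw [Finset.sum_const, Finset.card_univ, Fintype.card_fin, nsmul_eq_mul]
  have : ((4:ℕ):ENNReal) = ENNReal.ofReal 4 := by norm_num
  rw [this, ← ENNReal.ofReal_mul (by norm_num)]
  apply ENNReal.ofReal_le_ofReal
  have e1 : 4 * (600005 * A / (lam / 8)) = 19200160 * (A / lam) := by field_simp; ring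
  rw [e1, mul_div_assoc]
  have : 0 ≤ A / lam := by positivity
  linarith

/-! ### dyadic averages and John-Nirenberg -/

def av (k i : ℕ) (f : ℕ → ℝ) : ℝ := (2 ^ k : ℝ)⁻¹ * ∑ j ∈ Finset.range (2 ^ k), f (i * 2 ^ k + j)

lemma av_zero (i : ℕ) (f : ℕ → ℝ) : av 0 i f = f i := by simp [av]

lemma av_succ (k i : ℕ) (f : ℕ → ℝ) : av (k + 1) i f = (av k (2 * i) f + av k (2 * i + 1) f) / 2 := by
  unfold av
  have e1 : 2 ^ (k + 1) = 2 ^ k + 2 ^ k := by ring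
  have e2 : ∑ j ∈ Finset.range (2 ^ (k + 1)), f (i * 2 ^ (k + 1) + j) =
      ∑ j ∈ Finset.range (2 ^ k), f (2 * i * 2 ^ k + j) +
        ∑ j ∈ Finset.range (2 ^ k), f ((2 * i + 1) * 2 ^ k + j) := by
    rw [e1, Finset.sum_range_add]
    congr 1
    · refine Finset.sum_congr rfl fun j _ => ?_
      congr 1; ring
    · refine Finset.sum_congr rfl fun j _ => ?_
      congr 1; ring
  rw [e2, pow_succ]
  field_simp

lemma bellman {d v1 v2 : ℝ} (h1 : 0 ≤ v1) (h2 : 0 ≤ v2) (h1' : v1 ≤ 1 / 20) (h2' : v2 ≤ 1 / 20)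
    (hd : (v1 + v2) / 2 + d ^ 2 ≤ 1 / 20) :
    (Real.exp d * (1 + 2 * v1 - 4 * v1 ^ 2) + Real.exp (-d) * (1 + 2 * v2 - 4 * v2 ^ 2)) / 2 ≤
      1 + 2 * ((v1 + v2) / 2 + d ^ 2) - 4 * ((v1 + v2) / 2 + d ^ 2) ^ 2 := by
  have hd2 : d ^ 2 ≤ 1 / 20 := by linarith
  have hd1 : |d| ≤ 1 / 4 := abs_le_of_sq_le_sq (by linarith) (by norm_num)
  have key : ∀ u : ℝ, |u| ≤ 1 / 4 → Real.exp u ≤ 1 + u + 3 / 5 * u ^ 2 := by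
    intro u hu
    have hu' := abs_le.mp hu
    have hb := Real.abs_exp_sub_one_sub_id_le (x := u) (hu.trans (by norm_num))
    have hb2 := Real.exp_bound (x := u) (hu.trans (by norm_num)) (n := 3) (by norm_num)
    norm_num [Finset.sum_range_succ, Nat.factorial] at hb2
    have h3 := (abs_le.mp hb2).2
    have h4 : |u| ^ 3 = |u| * u ^ 2 := by rw [pow_succ, sq_abs]; ring
    rw [h4] at h3
    nlinarith [sq_nonneg u]
  have k1 := key d hd1
  have k2 := key (-d) (by rwa [abs_neg])
  have p1 : 0 ≤ 1 + 2 * v1 - 4 * v1 ^ 2 := by nlinarith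
  have p2 : 0 ≤ 1 + 2 * v2 - 4 * v2 ^ 2 := by nlinarith
  have a1 := mul_le_mul_of_nonneg_right k1 p1
  have a2 := mul_le_mul_of_nonneg_right k2 p2
  have hsum : (Real.exp d * (1 + 2 * v1 - 4 * v1 ^ 2) + Real.exp (-d) * (1 + 2 * v2 - 4 * v2 ^ 2)) / 2 ≤
      ((1 + d + 3 / 5 * d ^ 2) * (1 + 2 * v1 - 4 * v1 ^ 2) +
        (1 + -d + 3 / 5 * (-d) ^ 2) * (1 + 2 * v2 - 4 * v2 ^ 2)) / 2 := by linarith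
  refine hsum.trans ?_
  set m := (v1 + v2) / 2 with hm
  set h := (v1 - v2) / 2 with hh
  have e1 : v1 = m + h := by rw [hm, hh]; ring
  have e2 : v2 = m - h := by rw [hm, hh]; ring
  have hm0 : 0 ≤ m := by rw [hm]; linarith
  have hm1 : m ≤ 1 / 20 := by rw [hm]; linarith
  clear_value m h
  subst e1 e2
  -- reduce
  have b1 : d * (h * (2 - 8 * m)) ≤ 4 * h ^ 2 + (1 / 4) * d ^ 2 := by
    have : d * (h * (2 - 8 * m)) ≤ |d * h| * 2 := by
      have h1 : d * h * (2 - 8 * m) ≤ |d * h| * (2 - 8 * m) :=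
        mul_le_mul_of_nonneg_right (le_abs_self _) (by linarith)
      have h2 : |d * h| * (2 - 8 * m) ≤ |d * h| * 2 := mul_le_mul_of_nonneg_left (by linarith) (abs_nonneg _)
      linarith
    have h3 : |d * h| * 2 ≤ 4 * h ^ 2 + (1 / 4) * d ^ 2 := by
      rw [abs_mul]
      nlinarith [sq_nonneg (2 * |h| - 1 / 2 * |d|), sq_abs d, sq_abs h]
    linarith
  have b2 : (3 / 5 * d ^ 2) * (1 + 2 * m - 4 * m ^ 2 - 4 * h ^ 2) ≤ (3 / 5 * d ^ 2) * (11 / 10) := by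
    apply mul_le_mul_of_nonneg_left _ (by positivity)
    nlinarith [sq_nonneg m, sq_nonneg h]
  have b3 : 8 * m * d ^ 2 ≤ 2 / 5 * d ^ 2 := by nlinarith [sq_nonneg d]
  have b4 : 4 * (d ^ 2) ^ 2 ≤ 1 / 5 * d ^ 2 := by nlinarith [sq_nonneg d]
  nlinarith [sq_nonneg d]

lemma av_sq_sub_nonneg (k i : ℕ) (f : ℕ → ℝ) : (av k i f) ^ 2 ≤ av k i (fun n => f n ^ 2) := by
  induction k generalizing i with
  | zero => simp [av_zero]
  | succ k ih =>
    rw [av_succ, av_succ]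
    nlinarith [ih (2 * i), ih (2 * i + 1), sq_nonneg (av k (2 * i) f - av k (2 * i + 1) f)]

lemma john_nirenberg {f : ℕ → ℝ} (hf : ∀ k i, av k i (fun n => f n ^ 2) - (av k i f) ^ 2 ≤ 1 / 20) (k i : ℕ) :
    av k i (fun n => Real.exp (f n)) ≤ Real.exp (av k i f) *
      (1 + 2 * (av k i (fun n => f n ^ 2) - (av k i f) ^ 2) -
        4 * (av k i (fun n => f n ^ 2) - (av k i f) ^ 2) ^ 2) := by
  induction k generalizing i with
  | zero => simp [av_zero]
  | succ k ih =>
    have i1 := ih (2 * i)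
    have i2 := ih (2 * i + 1)
    have n1 := av_sq_sub_nonneg k (2 * i) f
    have n2 := av_sq_sub_nonneg k (2 * i + 1) f
    have u1 := hf k (2 * i)
    have u2 := hf k (2 * i + 1)
    have u := hf (k + 1) i
    rw [av_succ k i (fun n => Real.exp (f n))]
    rw [av_succ k i f, av_succ k i (fun n => f n ^ 2)] at *
    set a := av k (2 * i) f
    set b := av k (2 * i + 1) f
    set p := av k (2 * i) (fun n => f n ^ 2)
    set q := av k (2 * i + 1) (fun n => f n ^ 2)
    have e : (p + q) / 2 - ((a + b) / 2) ^ 2 = ((p - a ^ 2) + (q - b ^ 2)) / 2 + ((a - b) / 2) ^ 2 := by ring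
    rw [e] at u ⊢
    have hb := bellman (d := (a - b) / 2) (v1 := p - a ^ 2) (v2 := q - b ^ 2) (by linarith) (by linarith) u1 u2 u
    have ea : Real.exp a = Real.exp ((a + b) / 2) * Real.exp ((a - b) / 2) := by
      rw [← Real.exp_add]; congr 1; ring
    have eb : Real.exp b = Real.exp ((a + b) / 2) * Real.exp (-((a - b) / 2)) := by
      rw [← Real.exp_add]; congr 1; ring
    have hm := mul_le_mul_of_nonneg_left hb (Real.exp_pos ((a + b) / 2)).le
    rw [ea] at i1
    rw [eb] at i2
    refine le_trans ?_ hm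
    nlinarith

/-- complex block mean -/
def avC (k i : ℕ) (f : ℕ → ℂ) : ℂ := (2 ^ k : ℂ)⁻¹ * ∑ j ∈ Finset.range (2 ^ k), f (i * 2 ^ k + j)

def Good (lam : ℝ) (f : ℕ → ℂ) : Prop := ∀ k, 1 ≤ k →
  (∑ j ∈ Finset.range (2 ^ k), ‖f j‖ ^ 2 ≤ lam ^ 2 * 2 ^ k) ∧
  ∀ i, ∑ j ∈ Finset.range (2 ^ k), ‖f (i * 2 ^ k + j) - avC k i f‖ ^ 2 ≤ lam ^ 2 * 2 ^ k

lemma norm_add_sq_le (a b : ℂ) : ‖a + b‖ ^ 2 ≤ 2 * ‖a‖ ^ 2 + 2 * ‖b‖ ^ 2 := by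
  have := norm_add_le a b
  nlinarith [norm_nonneg (a + b), sq_nonneg (‖a‖ - ‖b‖)]

lemma avC_add (k i : ℕ) (f g : ℕ → ℂ) : avC k i (fun n => f n + g n) = avC k i f + avC k i g := by
  unfold avC; rw [Finset.sum_add_distrib]; ring

lemma avC_smul (k i : ℕ) (z : ℂ) (f : ℕ → ℂ) : avC k i (fun n => z * f n) = z * avC k i f := by
  unfold avC; rw [← Finset.mul_sum]; ring

lemma Good.add {lam : ℝ} {f g : ℕ → ℂ} (hf : Good lam f) (hg : Good lam g) :
    Good (2 * lam) (fun n => f n + g n) := by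
  intro k hk
  obtain ⟨f1, f2⟩ := hf k hk
  obtain ⟨g1, g2⟩ := hg k hk
  constructor
  · have : ∑ j ∈ Finset.range (2 ^ k), ‖f j + g j‖ ^ 2 ≤
        ∑ j ∈ Finset.range (2 ^ k), (2 * ‖f j‖ ^ 2 + 2 * ‖g j‖ ^ 2) :=
      Finset.sum_le_sum fun j _ => norm_add_sq_le _ _
    rw [Finset.sum_add_distrib, ← Finset.mul_sum, ← Finset.mul_sum] at this
    nlinarith
  · intro i
    have f2 := f2 i
    have g2 := g2 i
    rw [avC_add]
    have : ∑ j ∈ Finset.range (2 ^ k), ‖f (i * 2 ^ k + j) + g (i * 2 ^ k + j) - (avC k i f + avC k i g)‖ ^ 2 ≤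
        ∑ j ∈ Finset.range (2 ^ k), (2 * ‖f (i * 2 ^ k + j) - avC k i f‖ ^ 2 +
          2 * ‖g (i * 2 ^ k + j) - avC k i g‖ ^ 2) :=
      Finset.sum_le_sum fun j _ => by rw [add_sub_add_comm]; exact norm_add_sq_le _ _
    rw [Finset.sum_add_distrib, ← Finset.mul_sum, ← Finset.mul_sum] at this
    nlinarith

lemma Good.smul {lam : ℝ} {f : ℕ → ℂ} (hf : Good lam f) (z : ℂ) :
    Good (‖z‖ * lam) (fun n => z * f n) := by
  intro k hk
  obtain ⟨f1, f2⟩ := hf k hk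
  constructor
  · simp_rw [norm_mul, mul_pow]
    rw [← Finset.mul_sum, mul_assoc]
    gcongr
  · intro i
    rw [avC_smul]
    simp_rw [← mul_sub, norm_mul, mul_pow]
    rw [← Finset.mul_sum, mul_assoc]
    gcongr
    exact f2 i

lemma Good.mono {lam lam' : ℝ} {f : ℕ → ℂ} (hf : Good lam f) (h0 : 0 ≤ lam) (h : lam ≤ lam') : Good lam' f := by
  intro k hk
  obtain ⟨f1, f2⟩ := hf k hk
  have : lam ^ 2 * 2 ^ k ≤ lam' ^ 2 * (2:ℝ) ^ k := by gcongr
  exact ⟨f1.trans this, fun i => (f2 i).trans this⟩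

lemma Good.conj {lam : ℝ} {f : ℕ → ℂ} (hf : Good lam f) : Good lam (fun n => (starRingEnd ℂ) (f n)) := by
  intro k hk
  obtain ⟨f1, f2⟩ := hf k hk
  refine ⟨by simpa using f1, fun i => ?_⟩
  have e : avC k i (fun n => (starRingEnd ℂ) (f n)) = (starRingEnd ℂ) (avC k i f) := by
    unfold avC; simp [map_sum]
    exact Or.inl (by rw [Complex.conj_ofNat])
  rw [e]
  simp_rw [← map_sub, Complex.norm_conj]
  exact f2 i

/-- mean minimizes -/
lemma var_le (k i : ℕ) (f : ℕ → ℂ) (c : ℂ) :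
    ∑ j ∈ Finset.range (2 ^ k), ‖f (i * 2 ^ k + j) - avC k i f‖ ^ 2 ≤
      4 * ∑ j ∈ Finset.range (2 ^ k), ‖f (i * 2 ^ k + j) - c‖ ^ 2 := by
  set N : ℕ := 2 ^ k with hN
  have hNp : (0:ℝ) < N := by rw [hN]; positivity
  set X := ∑ j ∈ Finset.range N, ‖f (i * N + j) - c‖ ^ 2 with hX
  have h1 : avC k i f - c = (N:ℂ)⁻¹ * ∑ j ∈ Finset.range N, (f (i * N + j) - c) := by
    rw [Finset.sum_sub_distrib, Finset.sum_const, Finset.card_range, nsmul_eq_mul]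
    have : (N:ℂ) ≠ 0 := by exact_mod_cast hNp.ne'
    have h3 : avC k i f = (N:ℂ)⁻¹ * ∑ j ∈ Finset.range N, f (i * N + j) := by
      unfold avC; rw [hN]; push_cast; rfl
    rw [h3]; field_simp
  have h2 : N * ‖c - avC k i f‖ ^ 2 ≤ X := by
    rw [norm_sub_rev, h1, norm_mul, norm_inv, Complex.norm_natCast, mul_pow]
    have h3 := norm_sum_le (Finset.range N) (fun j => f (i * N + j) - c)
    have h4 : (∑ j ∈ Finset.range N, ‖f (i * N + j) - c‖) ^ 2 ≤ N * X := by
      have := sq_sum_le_card_mul_sum_sq (s := Finset.range N) (f := fun j => ‖f (i * N + j) - c‖)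
      simpa using this
    have h5 : ‖∑ j ∈ Finset.range N, (f (i * N + j) - c)‖ ^ 2 ≤ N * X := le_trans (by gcongr) h4
    calc (N:ℝ) * ((N:ℝ)⁻¹ ^ 2 * ‖∑ j ∈ Finset.range N, (f (i * N + j) - c)‖ ^ 2)
        ≤ (N:ℝ) * ((N:ℝ)⁻¹ ^ 2 * (N * X)) := by gcongr
      _ = X := by field_simp
  have : ∑ j ∈ Finset.range N, ‖f (i * N + j) - avC k i f‖ ^ 2 ≤
      ∑ j ∈ Finset.range N, (2 * ‖f (i * N + j) - c‖ ^ 2 + 2 * ‖c - avC k i f‖ ^ 2) :=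
    Finset.sum_le_sum fun j _ => by
      have := norm_add_sq_le (f (i * N + j) - c) (c - avC k i f)
      simpa using this
  rw [Finset.sum_add_distrib, ← Finset.mul_sum, ← Finset.mul_sum, Finset.sum_const, Finset.card_range,
    nsmul_eq_mul] at this
  linarith

lemma good_exp {f : ℕ → ℝ} (hf : Good (1 / 5) (fun n => (f n : ℂ))) (k : ℕ) (hk : 1 ≤ k) :
    ∑ j ∈ Finset.range (2 ^ k), Real.exp |f j| ≤ 6 * 2 ^ k := by
  have hvar : ∀ k i, av k i (fun n => f n ^ 2) - (av k i f) ^ 2 ≤ 1 / 20 := by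
    intro k i
    rcases Nat.eq_zero_or_pos k with rfl | hk
    · simp [av_zero]
    have h := (hf k hk).2 i
    have e1 : avC k i (fun n => (f n : ℂ)) = ((av k i f : ℝ) : ℂ) := by
      unfold avC av; push_cast; rfl
    rw [e1] at h
    have e2 : ∀ j, ‖(f (i * 2 ^ k + j) : ℂ) - (av k i f : ℝ)‖ ^ 2 =
        f (i * 2 ^ k + j) ^ 2 - 2 * av k i f * f (i * 2 ^ k + j) + (av k i f) ^ 2 := by
      intro j
      rw [← Complex.ofReal_sub, Complex.norm_real, Real.norm_eq_abs, sq_abs]; ring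
    simp_rw [e2] at h
    rw [Finset.sum_add_distrib, Finset.sum_sub_distrib, ← Finset.mul_sum, Finset.sum_const, Finset.card_range,
      nsmul_eq_mul] at h
    have e3 : ∑ j ∈ Finset.range (2 ^ k), f (i * 2 ^ k + j) = 2 ^ k * av k i f := by
      unfold av; field_simp
    have e4 : ∑ j ∈ Finset.range (2 ^ k), f (i * 2 ^ k + j) ^ 2 = 2 ^ k * av k i (fun n => f n ^ 2) := by
      unfold av; field_simp
    rw [e3, e4] at h
    push_cast at h
    have hp : (0:ℝ) < 2 ^ k := by positivity
    have h5 : (2:ℝ) ^ k * (av k i (fun n => f n ^ 2) - (av k i f) ^ 2) ≤ 2 ^ k * (1 / 25) := by nlinarith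
    have := le_of_mul_le_mul_left h5 hp
    linarith
  have hmean : |av k 0 f| ≤ 1 / 5 := by
    have h := (hf k hk).1
    have h1 := av_sq_sub_nonneg k 0 f
    have e4 : ∑ j ∈ Finset.range (2 ^ k), ‖(f j : ℂ)‖ ^ 2 = 2 ^ k * av k 0 (fun n => f n ^ 2) := by
      unfold av; field_simp; simp
    rw [e4] at h
    have hp : (0:ℝ) < 2 ^ k := by positivity
    have h5 : (2:ℝ) ^ k * av k 0 (fun n => f n ^ 2) ≤ 2 ^ k * (1 / 25) := by nlinarith
    have := le_of_mul_le_mul_left h5 hp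
    apply abs_le_of_sq_le_sq _ (by norm_num)
    linarith
  have core : ∀ g : ℕ → ℝ, (∀ k i, av k i (fun n => g n ^ 2) - (av k i g) ^ 2 ≤ 1 / 20) → av k 0 g ≤ 1 / 5 →
      ∑ j ∈ Finset.range (2 ^ k), Real.exp (g j) ≤ 3 * 2 ^ k := by
    intro g hg hm
    have h := john_nirenberg hg k 0
    have hv := hg k 0
    have hv0 := av_sq_sub_nonneg k 0 g
    have h1 : Real.exp (av k 0 g) ≤ 3 / 2 := by
      have h2 : Real.exp (1 / 5) ≤ 3 / 2 := by
        have := Real.exp_bound' (x := 1 / 5) (by norm_num) (by norm_num) (n := 3) (by norm_num)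
        norm_num [Finset.sum_range_succ, Nat.factorial] at this
        linarith
      exact (Real.exp_le_exp.mpr hm).trans h2
    have h3 : av k 0 (fun n => Real.exp (g n)) ≤ 3 := by
      refine h.trans ?_
      have h5 := Real.exp_pos (av k 0 g)
      set v := av k 0 (fun n => g n ^ 2) - av k 0 g ^ 2
      have h4 : 1 + 2 * v - 4 * v ^ 2 ≤ 2 := by nlinarith [sq_nonneg v]
      nlinarith
    unfold av at h3
    rw [inv_mul_le_iff₀ (by positivity)] at h3
    simp only [zero_mul, zero_add] at h3
    linarith
  have c1 := core f hvar (abs_le.mp hmean).2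
  have hneg : ∀ k i, av k i (fun n => -f n) = -av k i f := by
    intro k i; unfold av; rw [Finset.sum_neg_distrib]; ring
  have c2 := core (fun n => -f n) (by intro k i; rw [hneg]; simpa using hvar k i)
    (by rw [hneg]; linarith [(abs_le.mp hmean).1])
  calc ∑ j ∈ Finset.range (2 ^ k), Real.exp |f j|
      ≤ ∑ j ∈ Finset.range (2 ^ k), (Real.exp (f j) + Real.exp (-f j)) := by
        refine Finset.sum_le_sum fun j _ => ?_
        rcases abs_cases (f j) with h | h <;> rw [h.1]
        · linarith [Real.exp_pos (-f j)]
        · linarith [Real.exp_pos (f j)]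
    _ ≤ 6 * 2 ^ k := by rw [Finset.sum_add_distrib]; linarith

/-! ### one-dimensional theorem -/

lemma good_of_bounds (s : Finset ℤ) (c : ℤ → ℂ) {lam : ℝ} (hlam : 0 < lam) (x : ℝ)
    (h1 : ∀ k, 1 ≤ k → BB k (fun u => ‖tp s c u‖) x ≤ 250000 * lam ^ 2)
    (h2 : ‖Ph s c 1 x‖ ≤ lam) (h3 : ∀ k, 1 ≤ k → ‖Ph s c (rk k ^ 2) x‖ ≤ lam) :
    Good (4000 * lam) (fun n : ℕ => Rp s c n x) := by
  intro k hk
  have hp : (0:ℝ) < 2 ^ k := by positivity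
  have hosc : ∀ n0 : ℤ, ∑ j ∈ Finset.range (2 ^ k), ‖Rp s c (n0 + j) x - (Rp s c n0 x + cl s c k n0 x)‖ ^ 2 ≤
      4000000 * lam ^ 2 * 2 ^ k := by
    intro n0
    refine (osc s c n0 hk x).trans ?_
    have := h1 k hk
    nlinarith
  constructor
  · have hc := center_zero s c k x
    have hs : √(BB k (fun u => ‖tp s c u‖) x) ≤ 500 * lam := by
      apply Real.sqrt_le_iff.mpr
      refine ⟨by positivity, ?_⟩
      have := h1 k hk
      nlinarith
    have h4 : ‖Rp s c 0 x + cl s c k 0 x‖ ≤ 502 * lam := by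
      have := h3 k hk
      linarith
    have h5 : ‖Rp s c 0 x + cl s c k 0 x‖ ^ 2 ≤ (502 * lam) ^ 2 := by gcongr
    have h0 := hosc 0
    have : ∑ j ∈ Finset.range (2 ^ k), ‖Rp s c ((j : ℕ) : ℤ) x‖ ^ 2 ≤
        ∑ j ∈ Finset.range (2 ^ k), (2 * ‖Rp s c (0 + j) x - (Rp s c 0 x + cl s c k 0 x)‖ ^ 2 +
          2 * ‖Rp s c 0 x + cl s c k 0 x‖ ^ 2) :=
      Finset.sum_le_sum fun j _ => by
        have := norm_add_sq_le (Rp s c (0 + j) x - (Rp s c 0 x + cl s c k 0 x)) (Rp s c 0 x + cl s c k 0 x)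
        simpa using this
    rw [Finset.sum_add_distrib, ← Finset.mul_sum, ← Finset.mul_sum, Finset.sum_const, Finset.card_range,
      nsmul_eq_mul] at this
    push_cast at this
    nlinarith
  · intro i
    have h0 := hosc ((i * 2 ^ k : ℕ) : ℤ)
    have h4 := var_le k i (fun n : ℕ => Rp s c n x)
      (Rp s c ((i * 2 ^ k : ℕ) : ℤ) x + cl s c k ((i * 2 ^ k : ℕ) : ℤ) x)
    refine h4.trans ?_
    simp only [Nat.cast_add]
    nlinarith

lemma good_Rp (s : Finset ℤ) (c : ℤ → ℂ) {lam : ℝ} (hlam : 0 < lam) :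
    mu {x | ¬ Good lam (fun n : ℕ => Rp s c n x)} ≤
      ENNReal.ofReal (100000000000 * (∫ t, ‖tp s c t‖ ∂mu) / lam) := by
  set A := ∫ t, ‖tp s c t‖ ∂mu with hA
  have hA0 : 0 ≤ A := integral_nonneg fun t => norm_nonneg _
  set l := lam / 4000 with hl
  have hl0 : 0 < l := by positivity
  set E : ℕ → Set ℝ := fun K => {x | ∃ k, 1 ≤ k ∧ k ≤ K ∧ 250000*l^2 < BB k (fun u => ‖tp s c u‖) x} ∪
    {x | l < ‖Ph s c 1 x‖ ∨ ∃ k, 1 ≤ k ∧ k ≤ K ∧ l < ‖Ph s c (rk k ^ 2) x‖} with hE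
  have hsub : {x | ¬ Good lam (fun n : ℕ => Rp s c n x)} ⊆ ⋃ K, E K := by
    intro x hx
    by_contra hcon
    simp only [mem_iUnion, not_exists] at hcon
    apply hx
    have : lam = 4000 * l := by rw [hl]; ring
    rw [this]
    apply good_of_bounds s c hl0 x
    · intro k hk
      by_contra! h
      exact hcon k (Or.inl ⟨k, hk, le_rfl, h⟩)
    · by_contra! h
      exact hcon 0 (Or.inr (Or.inl h))
    · intro k hk
      by_contra! h
      exact hcon k (Or.inr (Or.inr ⟨k, hk, le_rfl, h⟩))
  have hmono : Monotone E := by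
    intro K K' hK x hx
    rcases hx with ⟨k, h1, h2, h3⟩ | h | ⟨k, h1, h2, h3⟩
    · exact Or.inl ⟨k, h1, h2.trans hK, h3⟩
    · exact Or.inr (Or.inl h)
    · exact Or.inr (Or.inr ⟨k, h1, h2.trans hK, h3⟩)
  refine (measure_mono hsub).trans ?_
  rw [hmono.measure_iUnion]
  refine iSup_le fun K => (measure_union_le _ _).trans ?_
  refine (add_le_add (lemmaD (continuous_tp s c).norm (fun _ => norm_nonneg _) hl0 K) (weak_Ph s c hl0 K)).trans ?_
  rw [← ENNReal.ofReal_add (by positivity) (by positivity)]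
  apply ENNReal.ofReal_le_ofReal
  have e1 : 200 * A / l + 20000000 * A / l = 80000800000 * (A / lam) := by rw [hl]; field_simp; ring
  rw [e1, mul_div_assoc]
  have : 0 ≤ A / lam := by positivity
  linarith

/-! ### product measure and the L log L bound -/

def kap2 : ENNReal := ENNReal.ofReal (2 * Real.pi)⁻¹ * ENNReal.ofReal (2 * Real.pi)⁻¹

lemma kap2_ne_zero : kap2 ≠ 0 := by
  unfold kap2
  have : ENNReal.ofReal (2 * Real.pi)⁻¹ ≠ 0 := by
    rw [Ne, ENNReal.ofReal_eq_zero, not_le]; positivity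
  exact mul_ne_zero this this

lemma kap2_ne_top : kap2 ≠ ⊤ := by
  unfold kap2
  exact ENNReal.mul_ne_top ENNReal.ofReal_ne_top ENNReal.ofReal_ne_top

lemma mu_prod : mu.prod mu = kap2 • volume.restrict T2 := by
  unfold mu T2 kap2
  rw [Measure.prod_smul_left, Measure.prod_smul_right, Measure.prod_restrict, smul_smul]
  rfl

lemma integrable_mu2 {E : Type*} [NormedAddCommGroup E] [SecondCountableTopology E] {F : ℝ × ℝ → E}
    (hF : Continuous F) : Integrable F (mu.prod mu) := by
  rw [mu_prod]
  apply Integrable.smul_measure _ kap2_ne_top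
  have h : IntegrableOn F (Icc (-Real.pi) Real.pi ×ˢ Icc (-Real.pi) Real.pi) volume :=
    hF.continuousOn.integrableOn_compact (isCompact_Icc.prod isCompact_Icc)
  exact h.mono_set (prod_mono Ico_subset_Icc_self Ico_subset_Icc_self)

lemma swap_mu {E : Type*} [NormedAddCommGroup E] [NormedSpace ℝ E] [SecondCountableTopology E] {f : ℝ → ℝ → E}
    (hf : Continuous (Function.uncurry f)) :
    ∫ x, ∫ y, f x y ∂mu ∂mu = ∫ y, ∫ x, f x y ∂mu ∂mu :=
  integral_integral_swap (integrable_mu2 hf)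

lemma cker_neg {rho : ℝ} (h0 : 0 ≤ rho) (h1 : rho < 1) (x : ℝ) (a : ℤ) :
    ∫ t, ee t ^ a * (starRingEnd ℂ) (2 * (1 - rho * ee (x - t))⁻¹ - 1) ∂mu =
      (if a < 0 then 2 * (rho ^ a.natAbs * ee x ^ a) else 0) + if a = 0 then 1 else 0 := by
  have h := congrArg (starRingEnd ℂ) (cker_pos h0 h1 x (-a))
  rw [← integral_conj] at h
  have e : ∀ t, (starRingEnd ℂ) (ee t ^ (-a) * (2 * (1 - rho * ee (x - t))⁻¹ - 1)) =
      ee t ^ a * (starRingEnd ℂ) (2 * (1 - rho * ee (x - t))⁻¹ - 1) := by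
    intro t; rw [map_mul, conj_ee_zpow, neg_neg]
  simp_rw [e] at h
  rw [h]
  rcases lt_trichotomy a 0 with h | h | h
  · rw [if_pos (by omega), if_neg (by omega), if_pos h, if_neg h.ne, Int.natAbs_neg]
    rw [map_add, map_mul, map_mul, map_pow, conj_ee_zpow, neg_neg, Complex.conj_ofReal, Complex.conj_ofNat]
    simp
  · subst h; simp
  · rw [if_neg (by omega), if_neg (by omega), if_neg (by omega), if_neg (by omega)]; simp

def gp {ι : Type*} (S : Finset ι) (φ : ι → ℤ) (C : ι → ℂ) (t : ℝ) : ℂ := ∑ p ∈ S, C p * ee t ^ φ p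

lemma continuous_gp {ι : Type*} (S : Finset ι) (φ : ι → ℤ) (C : ι → ℂ) : Continuous (gp S φ C) := by
  unfold gp
  exact continuous_finsetSum _ fun p _ => continuous_const.mul (continuous_ee_zpow _)

lemma Fh_im {w : ℝ → ℝ} (hw : Integrable w mu) {rho : ℝ} (h0 : 0 ≤ rho) (h1 : rho < 1) (x : ℝ) :
    (Fh w (rho * ee x)).im = ∫ t, w t * (2 * (1 - rho * ee (x - t))⁻¹ - 1).im ∂mu := by
  rw [Fh_polar]
  have hi := integrable_polar hw h0 h1 x
  refine Eq.trans (integral_im (𝕜 := ℂ) hi).symm ?_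
  congr 1; ext t
  simp only [RCLike.im_eq_complex_im]
  rw [Complex.im_ofReal_mul]

lemma gp_im {ι : Type*} (S : Finset ι) (φ : ι → ℤ) (C : ι → ℂ) {w : ℝ → ℝ} (hw : ∀ t, gp S φ C t = (w t : ℂ))
    {rho : ℝ} (h0 : 0 ≤ rho) (h1 : rho < 1) (x : ℝ) :
    Complex.I * (Fh w (rho * ee x)).im =
      ∑ p ∈ S, C p * ((φ p).sign * (rho:ℂ) ^ (φ p).natAbs) * ee x ^ φ p := by
  have hc := continuous_kerp h0 h1 x
  have hc' : Continuous (fun t => (starRingEnd ℂ) (2 * (1 - rho * ee (x - t))⁻¹ - 1)) :=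
    Complex.continuous_conj.comp hc
  have hF : Fh w (rho * ee x) = ∑ p ∈ S, C p * ∫ t, ee t ^ φ p * (2 * (1 - rho * ee (x - t))⁻¹ - 1) ∂mu := by
    rw [Fh_polar]
    simp_rw [← hw, gp, Finset.sum_mul, mul_assoc]
    have i1 : ∀ p ∈ S, Integrable (fun t => C p * (ee t ^ φ p * (2 * (1 - rho * ee (x - t))⁻¹ - 1))) mu :=
      fun p _ => integrable_mu (continuous_const.mul ((continuous_ee_zpow _).mul hc))
    rw [integral_finsetSum _ i1]
    simp_rw [integral_const_mul]
  have hG : (starRingEnd ℂ) (Fh w (rho * ee x)) =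
      ∑ p ∈ S, C p * ∫ t, ee t ^ φ p * (starRingEnd ℂ) (2 * (1 - rho * ee (x - t))⁻¹ - 1) ∂mu := by
    rw [Fh_polar, ← integral_conj]
    simp_rw [map_mul, Complex.conj_ofReal, ← hw, gp, Finset.sum_mul, mul_assoc]
    have i1 : ∀ p ∈ S, Integrable
        (fun t => C p * (ee t ^ φ p * (starRingEnd ℂ) (2 * (1 - rho * ee (x - t))⁻¹ - 1))) mu :=
      fun p _ => integrable_mu (continuous_const.mul ((continuous_ee_zpow _).mul hc'))
    rw [integral_finsetSum _ i1]
    simp_rw [integral_const_mul]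
  have h2 := Complex.sub_conj (Fh w (rho * ee x))
  rw [hG, hF, ← Finset.sum_sub_distrib, ← hF] at h2
  have h3 : Complex.I * (Fh w (rho * ee x)).im = (2:ℂ)⁻¹ * ((2 * (Fh w (rho * ee x)).im : ℝ) * Complex.I) := by
    push_cast; ring
  rw [h3, ← h2, Finset.mul_sum]
  refine Finset.sum_congr rfl fun p _ => ?_
  rw [cker_pos h0 h1, cker_neg h0 h1]
  rcases lt_trichotomy (φ p) 0 with h | h | h
  · rw [if_neg (show ¬ 0 < φ p by omega), if_pos h, Int.sign_eq_neg_one_of_neg h]; push_cast; ring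
  · rw [if_neg (show ¬ 0 < φ p by omega), if_neg (show ¬ φ p < 0 by omega), h]; simp
  · rw [if_pos h, if_neg (show ¬ φ p < 0 by omega), Int.sign_eq_one_of_pos h]; push_cast; ring

lemma young {a b : ℝ} (ha : 0 ≤ a) (hb : 0 ≤ b) : a * b ≤ a * logPlus a + Real.exp b := by
  unfold logPlus
  split_ifs with h
  · have h0 : 0 < a := by linarith
    have := Real.add_one_le_exp (b - Real.log a)
    rw [Real.exp_sub, Real.exp_log h0, le_div_iff₀ h0] at this
    nlinarith
  · have := Real.add_one_le_exp b
    nlinarith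

lemma exp_Fh {σ : ℝ → ℝ} (hσ : Continuous σ) (h1 : ∀ t, |σ t| ≤ 1) {R : ℝ} (hR0 : 0 ≤ R) (hR1 : R < 1) :
    ∫ t, Real.exp |(Fh σ (R * ee t)).im| ∂mu ≤ 4 := by
  have hi := integrable_mu hσ
  have hd : DiffContOnCl ℂ (fun z => Fh σ (R * z)) (Metric.ball 0 1) :=
    diffContOnCl_scaled (fun z hz => hasDerivAt_Fh hi hz) hR0 hR1
  have hFc : Continuous (fun t => Fh σ (R * ee t)) := by
    have := hd.continuousOn
    rw [closure_ball _ one_ne_zero] at this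
    exact this.comp_continuous continuous_ee (by intro t; simp)
  have hre : ∀ t, |(Fh σ (R * ee t)).re| ≤ 1 := by
    intro t
    rw [Fh_re hi hR0 hR1]
    have hPc : Continuous (fun u => Pk R (t - u)) := (continuous_Pk hR0 hR1).comp (by fun_prop)
    rw [← Real.norm_eq_abs]
    refine (norm_integral_le_integral_norm _).trans ?_
    refine (integral_mono (integrable_mu (hσ.mul hPc).norm) (integrable_mu hPc) ?_).trans
      (integral_Pk_sub hR0 hR1 t).le
    intro u
    simp only [Pi.mul_apply, Real.norm_eq_abs, abs_mul, abs_of_nonneg (Pk_nonneg hR0 hR1 (t - u))]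
    nlinarith [h1 u, Pk_nonneg hR0 hR1 (t - u), abs_nonneg (σ u)]
  have core : ∀ e : ℝ, (e = 1 ∨ e = -1) → ∫ t, Real.exp (e * (Fh σ (R * ee t)).im) ∂mu ≤ 2 := by
    intro e he
    have hW : DiffContOnCl ℂ (fun z => Complex.exp (-(e * Complex.I) * Fh σ (R * z))) (Metric.ball 0 1) := by
      have h2 : DiffContOnCl ℂ (fun z => (-(e * Complex.I) : ℂ) * Fh σ (R * z)) (Metric.ball 0 1) :=
        ⟨hd.1.const_mul _, continuousOn_const.mul hd.2⟩
      exact ⟨h2.1.cexp, h2.2.cexp⟩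
    have h3 := mean_value hW
    have hWc : Continuous (fun t => Complex.exp (-(e * Complex.I) * Fh σ (R * ee t))) := by fun_prop
    have h4 := integral_re (𝕜 := ℂ) (μ := mu) (f := fun t => Complex.exp (-(e * Complex.I) * Fh σ (R * ee t)))
      (integrable_mu hWc)
    rw [h3] at h4
    have h5 : (Complex.exp (-(e * Complex.I) * Fh σ (R * 0))).re ≤ 1 := by
      rw [mul_zero, Fh_zero]
      rw [Complex.exp_re]
      simp
      exact Real.cos_le_one _
    have h6 : ∫ t, (Complex.exp (-(e * Complex.I) * Fh σ (R * ee t))).re ∂mu ≤ 1 := le_trans (le_of_eq h4) h5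
    have h7 : ∫ t, (1 / 2) * Real.exp (e * (Fh σ (R * ee t)).im) ∂mu ≤
        ∫ t, (Complex.exp (-(e * Complex.I) * Fh σ (R * ee t))).re ∂mu := by
      have hic : Continuous (fun t => (Fh σ (R * ee t)).im) := Complex.continuous_im.comp hFc
      apply integral_mono (integrable_mu (by fun_prop)) (integrable_mu (Complex.continuous_re.comp hWc))
      intro t
      show 1 / 2 * Real.exp _ ≤ (Complex.exp _).re
      rw [Complex.exp_re]
      have e1 : (-(e * Complex.I) * Fh σ (R * ee t)).re = e * (Fh σ (R * ee t)).im := by simp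
      have e2 : (-(e * Complex.I) * Fh σ (R * ee t)).im = -(e * (Fh σ (R * ee t)).re) := by simp
      rw [e1, e2, Real.cos_neg]
      have h8 := Real.one_sub_sq_div_two_le_cos (x := e * (Fh σ (R * ee t)).re)
      have h9 : (e * (Fh σ (R * ee t)).re) ^ 2 ≤ 1 := by
        have : e ^ 2 = 1 := by rcases he with rfl | rfl <;> norm_num
        rw [mul_pow, this, one_mul, ← sq_abs]
        have := hre t
        nlinarith [abs_nonneg (Fh σ (R * ee t)).re]
      have h10 := Real.exp_pos (e * (Fh σ (R * ee t)).im)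
      nlinarith
    rw [integral_const_mul] at h7
    linarith
  have c1 := core 1 (Or.inl rfl)
  have c2 := core (-1) (Or.inr rfl)
  have hic : Continuous (fun t => (Fh σ (R * ee t)).im) := Complex.continuous_im.comp hFc
  have i1 : Integrable (fun t => Real.exp (1 * (Fh σ (R * ee t)).im)) mu := integrable_mu (by fun_prop)
  have i2 : Integrable (fun t => Real.exp (-1 * (Fh σ (R * ee t)).im)) mu := integrable_mu (by fun_prop)
  have : ∫ t, Real.exp |(Fh σ (R * ee t)).im| ∂mu ≤
      ∫ t, (Real.exp (1 * (Fh σ (R * ee t)).im) + Real.exp (-1 * (Fh σ (R * ee t)).im)) ∂mu := by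
    apply integral_mono (integrable_mu (by fun_prop)) (i1.add i2)
    intro t
    show Real.exp |(Fh σ (R * ee t)).im| ≤
      Real.exp (1 * (Fh σ (R * ee t)).im) + Real.exp (-1 * (Fh σ (R * ee t)).im)
    rcases abs_cases (Fh σ (R * ee t)).im with h | h <;> rw [h.1]
    · rw [one_mul]; linarith [Real.exp_pos (-1 * (Fh σ (R * ee t)).im)]
    · rw [neg_one_mul]; linarith [Real.exp_pos (1 * (Fh σ (R * ee t)).im)]
  rw [integral_add i1 i2] at this
  linarith

lemma logPlus_nonneg (u : ℝ) : 0 ≤ logPlus u := by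
  unfold logPlus; split_ifs with h
  · exact Real.log_nonneg h.le
  · exact le_rfl

lemma logPlus_eq (u : ℝ) : logPlus u = Real.log (max u 1) := by
  unfold logPlus; split_ifs with h
  · rw [max_eq_left h.le]
  · rw [max_eq_right (not_lt.mp h), Real.log_one]

@[fun_prop] lemma continuous_logPlus : Continuous logPlus := by
  have : logPlus = fun u => Real.log (max u 1) := funext logPlus_eq
  rw [this]
  exact Continuous.log (by fun_prop) fun u => by positivity

lemma ker_im_neg (rho u : ℝ) : (2 * (1 - rho * ee (-u))⁻¹ - 1).im = -(2 * (1 - rho * ee u)⁻¹ - 1).im := by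
  have : (2 * (1 - rho * ee (-u))⁻¹ - 1) = (starRingEnd ℂ) (2 * (1 - rho * ee u)⁻¹ - 1) := by
    simp only [map_sub, map_mul, map_inv₀, map_one, Complex.conj_ofReal, ee_conj, ee_neg, Complex.conj_ofNat]
  rw [this, Complex.conj_im]

lemma LlogL_R {w : ℝ → ℝ} (hw : Continuous w) {K : ℝ} (hK : 0 < K) {R : ℝ} (hR0 : 0 ≤ R) (hR1 : R < 1) :
    K * ∫ x, |(Fh w (R * ee x)).im| ∂mu ≤ 4 + ∫ t, K * |w t| * logPlus (K * |w t|) ∂mu := by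
  set k : ℝ → ℝ := fun u => (2 * (1 - R * ee u)⁻¹ - 1).im with hk
  have hkc : Continuous k :=
    Complex.continuous_im.comp ((continuous_const.mul (continuous_cauchy hR0 hR1)).sub continuous_const)
  set H : ℝ → ℝ := fun x => (Fh w (R * ee x)).im with hH
  have hHe : ∀ x, H x = ∫ t, w t * k (x - t) ∂mu := fun x => Fh_im (integrable_mu hw) hR0 hR1 x
  have hHc : Continuous H := by
    have : H = fun x => ∫ t, w t * k (x - t) ∂mu := funext hHe
    rw [this]
    exact continuous_integral_mu (by simp only [Function.uncurry_def]; fun_prop)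
  have hmain : ∀ e : ℝ, 0 < e → K * ∫ x, |H x| ∂mu ≤
      (4 + ∫ t, K * |w t| * logPlus (K * |w t|) ∂mu) + K * e := by
    intro e he
    set σ : ℝ → ℝ := fun x => H x / (|H x| + e) with hσ
    have hden : ∀ x, |H x| + e ≠ 0 := fun x => by positivity
    have hσc : Continuous σ := Continuous.div hHc (by fun_prop) hden
    have hσ1 : ∀ x, |σ x| ≤ 1 := by
      intro x
      simp only [hσ]
      rw [abs_div, abs_of_pos (show 0 < |H x| + e by positivity)]
      apply div_le_one_of_le₀ (by linarith) (by positivity)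
    have h1 : ∫ x, (|H x| - e) ∂mu ≤ ∫ x, σ x * H x ∂mu := by
      apply integral_mono (integrable_mu (by fun_prop)) (integrable_mu (by fun_prop))
      intro x
      simp only [hσ]
      rw [div_mul_eq_mul_div, le_div_iff₀ (by positivity)]
      nlinarith [abs_mul_abs_self (H x)]
    have hSe : ∀ t, (Fh σ (R * ee t)).im = -∫ x, σ x * k (x - t) ∂mu := by
      intro t
      rw [Fh_im (integrable_mu hσc) hR0 hR1, ← integral_neg]
      congr 1; ext x
      have := ker_im_neg R (x - t)
      rw [neg_sub] at this
      rw [this]; simp only [hk]; ring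
    have h2 : ∫ x, σ x * H x ∂mu = ∫ t, w t * (-(Fh σ (R * ee t)).im) ∂mu := by
      have e1 : ∀ x, σ x * H x = ∫ t, σ x * (w t * k (x - t)) ∂mu := by
        intro x; rw [hHe, integral_const_mul]
      have e2 : ∀ t, w t * (-(Fh σ (R * ee t)).im) = ∫ x, σ x * (w t * k (x - t)) ∂mu := by
        intro t; rw [hSe, neg_neg, ← integral_const_mul]
        congr 1; ext x; ring
      simp_rw [e1, e2]
      exact swap_mu (by simp only [Function.uncurry_def]; fun_prop)
    have hSc : Continuous (fun t => (Fh σ (R * ee t)).im) := by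
      simp_rw [hSe]
      exact (continuous_integral_mu (by simp only [Function.uncurry_def]; fun_prop)).neg
    have i1 : Integrable (fun t => K * |w t| * logPlus (K * |w t|)) mu := integrable_mu (by fun_prop)
    have i2 : Integrable (fun t => Real.exp |(Fh σ (R * ee t)).im|) mu := integrable_mu (by fun_prop)
    have h3 : ∫ t, K * (w t * (-(Fh σ (R * ee t)).im)) ∂mu ≤
        ∫ t, (K * |w t| * logPlus (K * |w t|) + Real.exp |(Fh σ (R * ee t)).im|) ∂mu := by
      apply integral_mono (integrable_mu (by fun_prop)) (i1.add i2)
      intro t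
      simp only []
      have := young (a := K * |w t|) (b := |(Fh σ (R * ee t)).im|) (by positivity) (abs_nonneg _)
      refine le_trans ?_ this
      rw [mul_assoc, ← abs_mul]
      gcongr
      rw [mul_neg]
      exact neg_le_abs _
    rw [integral_const_mul, integral_add i1 i2, ← h2] at h3
    have h4 := exp_Fh hσc hσ1 hR0 hR1
    have h5 : ∫ x, (|H x| - e) ∂mu = (∫ x, |H x| ∂mu) - e := by
      rw [integral_sub (integrable_mu (by fun_prop)) (integrable_const _)]
      simp
    nlinarith
  refine le_of_forall_pos_le_add fun e he => ?_
  have := hmain (e / K) (by positivity)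
  rwa [mul_div_cancel₀ _ hK.ne'] at this

lemma LlogL_gp {ι : Type*} (S : Finset ι) (φ : ι → ℤ) (C : ι → ℂ) {w : ℝ → ℝ} (hw : ∀ t, gp S φ C t = (w t : ℂ))
    {K : ℝ} (hK : 0 < K) :
    K * ∫ x, ‖gp S φ (fun p => C p * (φ p).sign) x‖ ∂mu ≤
      4 + ∫ t, K * |w t| * logPlus (K * |w t|) ∂mu := by
  have hwc : Continuous w := by
    have : w = fun t => (gp S φ C t).re := by ext t; rw [hw]; simp
    rw [this]
    exact Complex.continuous_re.comp (continuous_gp S φ C)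
  refine le_of_forall_pos_le_add fun e he => ?_
  -- choose R
  have hc : Continuous (fun R : ℝ => ∑ p ∈ S, ‖C p‖ * (1 - R ^ (φ p).natAbs)) := by fun_prop
  have h1 : (fun R : ℝ => ∑ p ∈ S, ‖C p‖ * (1 - R ^ (φ p).natAbs)) 1 < e / K := by
    simp; positivity
  have h2 := hc.continuousAt.eventually_lt continuousAt_const h1
  have h3 : ∀ᶠ R in nhdsWithin (1:ℝ) (Iio 1), (fun R : ℝ => ∑ p ∈ S, ‖C p‖ * (1 - R ^ (φ p).natAbs)) R < e / K :=
    h2.filter_mono nhdsWithin_le_nhds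
  have h4 : ∀ᶠ R in nhdsWithin (1:ℝ) (Iio 1), R < 1 := eventually_mem_nhdsWithin
  have h5 : ∀ᶠ R in nhdsWithin (1:ℝ) (Iio 1), 0 < R :=
    (lt_mem_nhds (show (0:ℝ) < 1 by norm_num)).filter_mono nhdsWithin_le_nhds
  obtain ⟨R, hR, hR1, hR0⟩ := (h3.and (h4.and h5)).exists
  have hpt : ∀ x, ‖gp S φ (fun p => C p * (φ p).sign) x‖ ≤ |(Fh w (R * ee x)).im| + e / K := by
    intro x
    have h6 := gp_im S φ C hw hR0.le hR1 x
    have h7 : ‖gp S φ (fun p => C p * (φ p).sign) x - Complex.I * (Fh w (R * ee x)).im‖ ≤ e / K := by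
      rw [h6]
      unfold gp
      rw [← Finset.sum_sub_distrib]
      refine ((norm_sum_le _ _).trans (Finset.sum_le_sum fun p _ => ?_)).trans hR.le
      have hp : R ^ (φ p).natAbs ≤ 1 := pow_le_one₀ hR0.le hR1.le
      have e1 : C p * ((φ p).sign : ℂ) * ee x ^ φ p - C p * ((φ p).sign * (R:ℂ) ^ (φ p).natAbs) * ee x ^ φ p =
          C p * (((φ p).sign : ℂ) * (((1 - R ^ (φ p).natAbs : ℝ)) : ℂ) * ee x ^ φ p) := by
        push_cast; ring
      rw [e1, norm_mul, norm_mul, norm_mul, norm_zpow, norm_ee, one_zpow, mul_one, Complex.norm_real,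
        Real.norm_of_nonneg (by linarith : 0 ≤ 1 - R ^ (φ p).natAbs)]
      gcongr
      have : ‖((φ p).sign : ℂ)‖ ≤ 1 := by
        rcases lt_trichotomy (φ p) 0 with h | h | h
        · rw [Int.sign_eq_neg_one_of_neg h]; simp
        · rw [h]; simp
        · rw [Int.sign_eq_one_of_pos h]; simp
      nlinarith
    have h8 : ‖Complex.I * ((Fh w (R * ee x)).im : ℂ)‖ = |(Fh w (R * ee x)).im| := by simp
    have h9 := norm_add_le (gp S φ (fun p => C p * (φ p).sign) x - Complex.I * (Fh w (R * ee x)).im)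
      (Complex.I * (Fh w (R * ee x)).im)
    rw [sub_add_cancel, h8] at h9
    linarith
  have h6 := LlogL_R hwc hK hR0.le hR1
  have hHc : Continuous (fun x => (Fh w (R * ee x)).im) := by
    have hd : DiffContOnCl ℂ (fun z => Fh w (R * z)) (Metric.ball 0 1) :=
      diffContOnCl_scaled (fun z hz => hasDerivAt_Fh (integrable_mu hwc) hz) hR0.le hR1
    have := hd.continuousOn
    rw [closure_ball _ one_ne_zero] at this
    exact Complex.continuous_im.comp (this.comp_continuous continuous_ee (by intro t; simp))
  have i1 : Integrable (fun x => |(Fh w (R * ee x)).im|) mu := integrable_mu hHc.abs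
  have h7 : ∫ x, ‖gp S φ (fun p => C p * (φ p).sign) x‖ ∂mu ≤ ∫ x, (|(Fh w (R * ee x)).im| + e / K) ∂mu :=
    integral_mono (integrable_mu (continuous_gp _ _ _).norm) (i1.add (integrable_const _)) hpt
  rw [integral_add i1 (integrable_const _)] at h7
  simp only [integral_const, probReal_univ, one_smul] at h7
  have h8 : K * ∫ x, ‖gp S φ (fun p => C p * (φ p).sign) x‖ ∂mu ≤
      K * ((∫ x, |(Fh w (R * ee x)).im| ∂mu) + e / K) := by gcongr
  rw [mul_add, mul_div_cancel₀ _ hK.ne'] at h8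
  linarith

/-! ### two-dimensional trigonometric polynomials -/

lemma continuous_avC {X : Type*} [TopologicalSpace X] {F : X → ℕ → ℂ} (hF : ∀ n, Continuous fun x => F x n) (k i : ℕ) :
    Continuous (fun x => avC k i (F x)) := by
  unfold avC
  fun_prop

lemma measurable_avC {X : Type*} [MeasurableSpace X] {F : X → ℕ → ℂ} (hF : ∀ n, Measurable fun x => F x n) (k i : ℕ) :
    Measurable (fun x => avC k i (F x)) := by
  unfold avC
  fun_prop

lemma measurableSet_good {X : Type*} [MeasurableSpace X] {F : X → ℕ → ℂ} (hF : ∀ n, Measurable fun x => F x n)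
    (lam : ℝ) : MeasurableSet {x | Good lam (F x)} := by
  unfold Good
  have ha := fun k i => measurable_avC hF k i
  simp only [ofPred_forall, ofPred_and]
  refine MeasurableSet.iInter fun k => MeasurableSet.iInter fun _ => MeasurableSet.inter ?_
    (MeasurableSet.iInter fun i => ?_)
  · exact measurableSet_le (by fun_prop) measurable_const
  · have := ha k i
    exact measurableSet_le (by fun_prop) measurable_const

lemma Good.half {lam : ℝ} {f : ℕ → ℂ} (hf : Good (2 * lam) f) : Good lam (fun n => (1 / 2 : ℂ) * f n) := by
  have := hf.smul (1 / 2)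
  have e : ‖(1 / 2 : ℂ)‖ * (2 * lam) = lam := by
    rw [show (1 / 2 : ℂ) = ((1 / 2 : ℝ) : ℂ) by push_cast; rfl, Complex.norm_real]
    norm_num
    ring
  rwa [e] at this

lemma Good.neg {lam : ℝ} {f : ℕ → ℂ} (hf : Good lam f) : Good lam (fun n => -f n) := by
  have := hf.smul (-1)
  simpa using this

lemma Good.re {lam : ℝ} {f : ℕ → ℂ} (hf : Good lam f) : Good lam (fun n => ((f n).re : ℂ)) := by
  have := (hf.add hf.conj).half
  have e : (fun n => (1 / 2 : ℂ) * (f n + (starRingEnd ℂ) (f n))) = fun n => ((f n).re : ℂ) := by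
    ext n; rw [Complex.add_conj]; push_cast; ring
  rwa [e] at this

def qs (n : ℕ) (a : ℤ) : ℂ := (if (n:ℤ) < a then 1 else 0) - (if a < -(n:ℤ) then 1 else 0)

lemma qs_identity (n : ℕ) (a b : ℤ) :
    (if (-(n:ℤ) ≤ a ∧ a ≤ n) ∧ (-(n:ℤ) ≤ b ∧ b ≤ n) then (1:ℂ) else 0) - 1 =
      -(1 / 2) * ((((a + b).sign : ℂ) * qs n a + ((a + b).sign : ℂ) * qs n b) +
        (((a - b).sign : ℂ) * qs n a + -(((a - b).sign : ℂ) * qs n b))) := by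
  unfold qs
  rcases lt_trichotomy (a + b) 0 with h | h | h <;> rcases lt_trichotomy (a - b) 0 with h' | h' | h' <;>
  simp only [h, h', Int.sign_eq_neg_one_of_neg, Int.sign_eq_one_of_pos, Int.sign_zero] <;>
  split_ifs <;> first | omega | norm_num

def bx (N : ℕ) : Finset ℤ := Finset.Icc (-(N:ℤ)) N

lemma sum_bx_neg (N : ℕ) (F : ℤ → ℂ) : ∑ a ∈ bx N, F (-a) = ∑ a ∈ bx N, F a := by
  apply Finset.sum_nbij' (fun a => -a) (fun a => -a)
  · intro a ha; simp only [bx, Finset.mem_Icc] at *; omega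
  · intro a ha; simp only [bx, Finset.mem_Icc] at *; omega
  · intro a _; simp
  · intro a _; simp
  · intro a _; simp

lemma good_Qp (N : ℕ) (c : ℤ → ℂ) {lam : ℝ} (hlam : 0 < lam) :
    mu {x | ¬ Good (2 * lam) (fun n : ℕ => ∑ a ∈ bx N, c a * qs n a * ee x ^ a)} ≤
      ENNReal.ofReal (200000000000 * (∫ t, ‖tp (bx N) c t‖ ∂mu) / lam) := by
  set c' : ℤ → ℂ := fun a => (starRingEnd ℂ) (c (-a)) with hc'
  have htp : ∀ t, ‖tp (bx N) c' t‖ = ‖tp (bx N) c t‖ := by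
    intro t
    rw [← Complex.norm_conj (tp (bx N) c t)]
    congr 1
    unfold tp
    rw [map_sum, ← sum_bx_neg]
    refine Finset.sum_congr rfl fun a _ => ?_
    simp only [hc', neg_neg, map_mul, conj_ee_zpow]
  have h1 := good_Rp (bx N) c hlam
  have h2 := good_Rp (bx N) c' hlam
  simp_rw [htp] at h2
  have hsub : {x | ¬ Good (2 * lam) (fun n : ℕ => ∑ a ∈ bx N, c a * qs n a * ee x ^ a)} ⊆
      {x | ¬ Good lam (fun n : ℕ => Rp (bx N) c n x)} ∪ {x | ¬ Good lam (fun n : ℕ => Rp (bx N) c' n x)} := by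
    intro x hx
    by_contra hcon
    simp only [mem_union, not_or, Set.mem_ofPred_eq, not_not] at hcon
    apply hx
    have h3 := hcon.1.add hcon.2.conj.neg
    have e : (fun n : ℕ => Rp (bx N) c n x + -(starRingEnd ℂ) (Rp (bx N) c' n x)) =
        fun n : ℕ => ∑ a ∈ bx N, c a * qs n a * ee x ^ a := by
      ext n
      unfold Rp
      rw [map_sum, ← sum_bx_neg N (fun a => (starRingEnd ℂ) _), ← Finset.sum_neg_distrib, ← Finset.sum_add_distrib]
      refine Finset.sum_congr rfl fun a _ => ?_
      unfold qs
      have hiff : (n:ℤ) < -a ↔ a < -(n:ℤ) := by omega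
      simp only [hiff]
      have e2 : (starRingEnd ℂ) (c' (-a) * ee x ^ (-a)) = c a * ee x ^ a := by
        simp only [hc', map_mul, conj_ee_zpow, neg_neg, Complex.conj_conj]
      rw [apply_ite (starRingEnd ℂ), e2, map_zero]
      split_ifs <;> ring
    rwa [e] at h3
  refine (measure_mono hsub).trans ((measure_union_le _ _).trans ((add_le_add h1 h2).trans ?_))
  have hA0 : 0 ≤ ∫ t, ‖tp (bx N) c t‖ ∂mu := integral_nonneg fun t => norm_nonneg _
  rw [← ENNReal.ofReal_add (by positivity) (by positivity)]
  apply ENNReal.ofReal_le_ofReal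
  apply le_of_eq; ring

/-- two-dimensional trigonometric polynomial -/
def tq (N : ℕ) (C : ℤ × ℤ → ℂ) (p : ℝ × ℝ) : ℂ :=
  ∑ q ∈ bx N ×ˢ bx N, C q * (ee p.1 ^ q.1 * ee p.2 ^ q.2)

@[fun_prop] lemma continuous_tq (N : ℕ) (C : ℤ × ℤ → ℂ) : Continuous (tq N C) := by
  unfold tq
  exact continuous_finsetSum _ fun q _ => continuous_const.mul
    (((continuous_ee_zpow _).comp continuous_fst).mul ((continuous_ee_zpow _).comp continuous_snd))

lemma tq_eq_tp1 (N : ℕ) (C : ℤ × ℤ → ℂ) (x y : ℝ) :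
    tq N C (x, y) = tp (bx N) (fun a => ∑ b ∈ bx N, C (a, b) * ee y ^ b) x := by
  unfold tq tp
  rw [Finset.sum_product]
  refine Finset.sum_congr rfl fun a _ => ?_
  rw [Finset.sum_mul]
  refine Finset.sum_congr rfl fun b _ => ?_
  ring

lemma tq_eq_tp2 (N : ℕ) (C : ℤ × ℤ → ℂ) (x y : ℝ) :
    tq N C (x, y) = tp (bx N) (fun b => ∑ a ∈ bx N, C (a, b) * ee x ^ a) y := by
  unfold tq tp
  rw [Finset.sum_product_right]
  refine Finset.sum_congr rfl fun a _ => ?_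
  rw [Finset.sum_mul]
  refine Finset.sum_congr rfl fun b _ => ?_
  ring

lemma prod_le_of_slice {S : Set (ℝ × ℝ)} (hS : MeasurableSet S) {G : ℝ → ℝ} (hG : Continuous G) (hG0 : ∀ y, 0 ≤ G y)
    (h : ∀ y, mu {x | (x, y) ∈ S} ≤ ENNReal.ofReal (G y)) :
    (mu.prod mu) S ≤ ENNReal.ofReal (∫ y, G y ∂mu) := by
  rw [Measure.prod_apply_symm hS, ofReal_integral_eq_lintegral_ofReal (integrable_mu hG) (ae_of_all _ hG0)]
  exact lintegral_mono h

lemma prod_le_of_slice2 {S : Set (ℝ × ℝ)} (hS : MeasurableSet S) {G : ℝ → ℝ} (hG : Continuous G) (hG0 : ∀ y, 0 ≤ G y)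
    (h : ∀ x, mu {y | (x, y) ∈ S} ≤ ENNReal.ofReal (G x)) :
    (mu.prod mu) S ≤ ENNReal.ofReal (∫ y, G y ∂mu) := by
  rw [Measure.prod_apply hS, ofReal_integral_eq_lintegral_ofReal (integrable_mu hG) (ae_of_all _ hG0)]
  exact lintegral_mono h

lemma good_x (N : ℕ) (C : ℤ × ℤ → ℂ) {lam : ℝ} (hlam : 0 < lam) :
    (mu.prod mu) {p | ¬ Good (2 * lam) (fun n : ℕ => tq N (fun q => C q * qs n q.1) p)} ≤
      ENNReal.ofReal (200000000000 * (∫ y, ∫ x, ‖tq N C (x, y)‖ ∂mu ∂mu) / lam) := by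
  have hc : Continuous (fun y => ∫ x, ‖tq N C (x, y)‖ ∂mu) :=
    continuous_integral_mu (by simp only [Function.uncurry_def]; fun_prop)
  have h := prod_le_of_slice (S := {p | ¬ Good (2 * lam) (fun n : ℕ => tq N (fun q => C q * qs n q.1) p)})
    (G := fun y => 200000000000 / lam * (∫ x, ‖tq N C (x, y)‖ ∂mu))
    (measurableSet_good (fun n => (continuous_tq _ _).measurable) _).compl (continuous_const.mul hc)
    (fun y => mul_nonneg (by positivity) (integral_nonneg fun _ => norm_nonneg _)) (by
      intro y
      have h1 := good_Qp N (fun a => ∑ b ∈ bx N, C (a, b) * ee y ^ b) hlam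
      simp_rw [← tq_eq_tp1] at h1
      rw [mul_div_right_comm] at h1
      refine le_trans (le_of_eq ?_) h1
      congr 1
      ext x
      simp only [Set.mem_ofPred_eq]
      have e : (fun n : ℕ => tq N (fun q => C q * qs n q.1) (x, y)) =
          fun n : ℕ => ∑ a ∈ bx N, (∑ b ∈ bx N, C (a, b) * ee y ^ b) * qs n a * ee x ^ a := by
        ext n
        rw [tq_eq_tp1]
        unfold tp
        refine Finset.sum_congr rfl fun a _ => ?_
        rw [Finset.sum_mul, Finset.sum_mul, Finset.sum_mul]
        refine Finset.sum_congr rfl fun b _ => ?_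
        ring
      rw [e])
  rw [integral_const_mul] at h
  rwa [mul_div_right_comm]

lemma good_y (N : ℕ) (C : ℤ × ℤ → ℂ) {lam : ℝ} (hlam : 0 < lam) :
    (mu.prod mu) {p | ¬ Good (2 * lam) (fun n : ℕ => tq N (fun q => C q * qs n q.2) p)} ≤
      ENNReal.ofReal (200000000000 * (∫ y, ∫ x, ‖tq N C (x, y)‖ ∂mu ∂mu) / lam) := by
  have hc : Continuous (fun x => ∫ y, ‖tq N C (x, y)‖ ∂mu) :=
    continuous_integral_mu (by simp only [Function.uncurry_def]; fun_prop)
  have h := prod_le_of_slice2 (S := {p | ¬ Good (2 * lam) (fun n : ℕ => tq N (fun q => C q * qs n q.2) p)})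
    (G := fun x => 200000000000 / lam * (∫ y, ‖tq N C (x, y)‖ ∂mu))
    (measurableSet_good (fun n => (continuous_tq _ _).measurable) _).compl (continuous_const.mul hc)
    (fun y => mul_nonneg (by positivity) (integral_nonneg fun _ => norm_nonneg _)) (by
      intro x
      have h1 := good_Qp N (fun b => ∑ a ∈ bx N, C (a, b) * ee x ^ a) hlam
      simp_rw [← tq_eq_tp2] at h1
      rw [mul_div_right_comm] at h1
      refine le_trans (le_of_eq ?_) h1
      congr 1
      ext y
      simp only [Set.mem_ofPred_eq]
      have e : (fun n : ℕ => tq N (fun q => C q * qs n q.2) (x, y)) =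
          fun n : ℕ => ∑ b ∈ bx N, (∑ a ∈ bx N, C (a, b) * ee x ^ a) * qs n b * ee y ^ b := by
        ext n
        rw [tq_eq_tp2]
        unfold tp
        refine Finset.sum_congr rfl fun a _ => ?_
        rw [Finset.sum_mul, Finset.sum_mul, Finset.sum_mul]
        refine Finset.sum_congr rfl fun b _ => ?_
        ring
      rw [e])
  rw [integral_const_mul, swap_mu (f := fun x y => ‖tq N C (x, y)‖)
    (by simp only [Function.uncurry_def]; fun_prop)] at h
  rwa [mul_div_right_comm]

lemma tq_periodic1 (N : ℕ) (C : ℤ × ℤ → ℂ) (x y : ℝ) : tq N C (x + 2 * Real.pi, y) = tq N C (x, y) := by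
  unfold tq; simp only [ee_periodic x]

lemma tq_periodic2 (N : ℕ) (C : ℤ × ℤ → ℂ) (x y : ℝ) : tq N C (x, y + 2 * Real.pi) = tq N C (x, y) := by
  unfold tq; simp only [ee_periodic y]

lemma shear {F : ℝ × ℝ → ℝ} (hF : Continuous F) (h1 : ∀ x y, F (x + 2 * Real.pi, y) = F (x, y)) :
    ∫ x, ∫ y, F (x + y, y) ∂mu ∂mu = ∫ y, ∫ x, F (x, y) ∂mu ∂mu := by
  rw [swap_mu (f := fun x y => F (x + y, y)) (by simp only [Function.uncurry_def]; fun_prop)]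
  congr 1; ext y
  have := integral_mu_add (f := fun x => F (x, y)) (fun x => h1 x y) y
  rw [← this]
  congr 1; ext x; rw [add_comm]

lemma shear_neg {F : ℝ × ℝ → ℝ} (hF : Continuous F) (h1 : ∀ x y, F (x + 2 * Real.pi, y) = F (x, y)) :
    ∫ x, ∫ y, F (x + y, -y) ∂mu ∂mu = ∫ y, ∫ x, F (x, y) ∂mu ∂mu := by
  have := shear (F := fun p => F (p.1, -p.2)) (by fun_prop) (fun x y => h1 x (-y))
  rw [this]
  exact integral_mu_neg (fun y => ∫ x, F (x, y) ∂mu)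

lemma LlogL_tq_add (N : ℕ) (C : ℤ × ℤ → ℂ) {h : ℝ × ℝ → ℝ} (hh : ∀ p, tq N C p = (h p : ℂ)) {K : ℝ} (hK : 0 < K) :
    K * ∫ y, ∫ x, ‖tq N (fun q => C q * ((q.1 + q.2).sign : ℂ)) (x, y)‖ ∂mu ∂mu ≤
      4 + ∫ y, ∫ x, K * |h (x, y)| * logPlus (K * |h (x, y)|) ∂mu ∂mu := by
  have hhc : Continuous h := by
    have : h = fun t => (tq N C t).re := by ext t; rw [hh]; simp
    rw [this]
    exact Complex.continuous_re.comp (continuous_tq N C)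
  have hhp : ∀ x y, h (x + 2 * Real.pi, y) = h (x, y) := by
    intro x y
    have := tq_periodic1 N C x y
    rw [hh, hh] at this
    exact_mod_cast this
  rw [← shear (F := fun p => ‖tq N (fun q => C q * ((q.1 + q.2).sign : ℂ)) p‖) (by fun_prop)
    (fun x y => by rw [tq_periodic1])]
  rw [← shear (F := fun p => K * |h p| * logPlus (K * |h p|)) (by fun_prop)
    (fun x y => by rw [hhp])]
  have hpt : ∀ x, K * ∫ y, ‖tq N (fun q => C q * ((q.1 + q.2).sign : ℂ)) (x + y, y)‖ ∂mu ≤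
      4 + ∫ y, K * |h (x + y, y)| * logPlus (K * |h (x + y, y)|) ∂mu := by
    intro x
    have h1 := LlogL_gp (bx N ×ˢ bx N) (fun q => q.1 + q.2) (fun q => C q * ee x ^ q.1)
      (w := fun y => h (x + y, y)) (by
        intro y
        rw [← hh]
        unfold gp tq
        refine Finset.sum_congr rfl fun q _ => ?_
        rw [ee_add, mul_zpow, zpow_add₀ (ee_ne _)]
        ring) hK
    refine le_trans (le_of_eq ?_) h1
    congr 2
    ext y
    congr 1
    unfold gp tq
    refine Finset.sum_congr rfl fun q _ => ?_
    rw [ee_add, mul_zpow, zpow_add₀ (ee_ne _)]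
    push_cast
    ring
  rw [← integral_const_mul]
  have c1 : Continuous (fun x => ∫ y, ‖tq N (fun q => C q * ((q.1 + q.2).sign : ℂ)) (x + y, y)‖ ∂mu) :=
    continuous_integral_mu (by simp only [Function.uncurry_def]; fun_prop)
  have c2 : Continuous (fun x => ∫ y, K * |h (x + y, y)| * logPlus (K * |h (x + y, y)|) ∂mu) :=
    continuous_integral_mu (by simp only [Function.uncurry_def]; fun_prop)
  have := integral_mono (μ := mu) (integrable_mu (continuous_const.mul c1)) (integrable_mu (continuous_const.add c2)) hpt
  refine this.trans (le_of_eq ?_)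
  refine (integral_add (integrable_const _) (integrable_mu c2)).trans ?_
  simp

lemma LlogL_tq_sub (N : ℕ) (C : ℤ × ℤ → ℂ) {h : ℝ × ℝ → ℝ} (hh : ∀ p, tq N C p = (h p : ℂ)) {K : ℝ} (hK : 0 < K) :
    K * ∫ y, ∫ x, ‖tq N (fun q => C q * ((q.1 - q.2).sign : ℂ)) (x, y)‖ ∂mu ∂mu ≤
      4 + ∫ y, ∫ x, K * |h (x, y)| * logPlus (K * |h (x, y)|) ∂mu ∂mu := by
  have hhc : Continuous h := by
    have : h = fun t => (tq N C t).re := by ext t; rw [hh]; simp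
    rw [this]
    exact Complex.continuous_re.comp (continuous_tq N C)
  have hhp : ∀ x y, h (x + 2 * Real.pi, y) = h (x, y) := by
    intro x y
    have := tq_periodic1 N C x y
    rw [hh, hh] at this
    exact_mod_cast this
  rw [← shear_neg (F := fun p => ‖tq N (fun q => C q * ((q.1 - q.2).sign : ℂ)) p‖) (by fun_prop)
    (fun x y => by rw [tq_periodic1])]
  rw [← shear_neg (F := fun p => K * |h p| * logPlus (K * |h p|)) (by fun_prop)
    (fun x y => by rw [hhp])]
  have hpt : ∀ x, K * ∫ y, ‖tq N (fun q => C q * ((q.1 - q.2).sign : ℂ)) (x + y, -y)‖ ∂mu ≤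
      4 + ∫ y, K * |h (x + y, -y)| * logPlus (K * |h (x + y, -y)|) ∂mu := by
    intro x
    have h1 := LlogL_gp (bx N ×ˢ bx N) (fun q => q.1 - q.2) (fun q => C q * ee x ^ q.1)
      (w := fun y => h (x + y, -y)) (by
        intro y
        rw [← hh]
        unfold gp tq
        refine Finset.sum_congr rfl fun q _ => ?_
        simp only
        rw [ee_add, ee_neg, mul_zpow, sub_eq_add_neg, zpow_add₀ (ee_ne _), inv_zpow, zpow_neg]
        ring) hK
    refine le_trans (le_of_eq ?_) h1
    congr 2
    ext y
    congr 1
    unfold gp tq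
    refine Finset.sum_congr rfl fun q _ => ?_
    simp only
    rw [ee_add, ee_neg, mul_zpow, zpow_sub₀ (ee_ne _), inv_zpow]
    push_cast
    ring
  rw [← integral_const_mul]
  have c1 : Continuous (fun x => ∫ y, ‖tq N (fun q => C q * ((q.1 - q.2).sign : ℂ)) (x + y, -y)‖ ∂mu) :=
    continuous_integral_mu (by simp only [Function.uncurry_def]; fun_prop)
  have c2 : Continuous (fun x => ∫ y, K * |h (x + y, -y)| * logPlus (K * |h (x + y, -y)|) ∂mu) :=
    continuous_integral_mu (by simp only [Function.uncurry_def]; fun_prop)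
  have := integral_mono (μ := mu) (integrable_mu (continuous_const.mul c1)) (integrable_mu (continuous_const.add c2)) hpt
  refine this.trans (le_of_eq ?_)
  refine (integral_add (integrable_const _) (integrable_mu c2)).trans ?_
  simp

/-- square partial sums of a trigonometric polynomial -/
def tqS (N : ℕ) (C : ℤ × ℤ → ℂ) (n : ℕ) (p : ℝ × ℝ) : ℂ :=
  tq N (fun q => C q * (if (-(n:ℤ) ≤ q.1 ∧ q.1 ≤ n) ∧ (-(n:ℤ) ≤ q.2 ∧ q.2 ≤ n) then (1:ℂ) else 0)) p

theorem weak_tq (N : ℕ) (C : ℤ × ℤ → ℂ) {h : ℝ × ℝ → ℝ} (hh : ∀ p, tq N C p = (h p : ℂ)) {K lam : ℝ}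
    (hK : 0 < K) (hlam : 0 < lam) :
    (mu.prod mu) {p | ¬ Good lam (fun n : ℕ => tqS N C n p - tq N C p)} ≤
      ENNReal.ofReal (3200000000000 * (4 + ∫ p, K * |h p| * logPlus (K * |h p|) ∂(mu.prod mu)) / (K * lam)) := by
  have hhc : Continuous h := by
    have : h = fun t => (tq N C t).re := by ext t; rw [hh]; simp
    rw [this]
    exact Complex.continuous_re.comp (continuous_tq N C)
  set l := lam / 4 with hl
  have hl0 : 0 < l := by positivity
  set Ca : ℤ × ℤ → ℂ := fun q => C q * ((q.1 + q.2).sign : ℂ) with hCa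
  set Cs : ℤ × ℤ → ℂ := fun q => C q * ((q.1 - q.2).sign : ℂ) with hCs
  have a1 := good_x N Ca hl0
  have a2 := good_y N Ca hl0
  have a3 := good_x N Cs hl0
  have a4 := good_y N Cs hl0
  have ba := LlogL_tq_add N C hh hK
  have bs := LlogL_tq_sub N C hh hK
  rw [← swap_mu (f := fun x y => K * |h (x, y)| * logPlus (K * |h (x, y)|))
    (by simp only [Function.uncurry_def]; fun_prop),
    ← integral_prod (fun p => K * |h p| * logPlus (K * |h p|)) (integrable_mu2 (by fun_prop))] at ba bs
  set J := ∫ p, K * |h p| * logPlus (K * |h p|) ∂(mu.prod mu) with hJ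
  set A := ∫ y, ∫ x, ‖tq N Ca (x, y)‖ ∂mu ∂mu with hA
  set S := ∫ y, ∫ x, ‖tq N Cs (x, y)‖ ∂mu ∂mu with hS
  have hA0 : 0 ≤ A := integral_nonneg fun y => integral_nonneg fun x => norm_nonneg _
  have hS0 : 0 ≤ S := integral_nonneg fun y => integral_nonneg fun x => norm_nonneg _
  have hsub : {p | ¬ Good lam (fun n : ℕ => tqS N C n p - tq N C p)} ⊆
      ({p | ¬ Good (2 * l) (fun n : ℕ => tq N (fun q => Ca q * qs n q.1) p)} ∪
        {p | ¬ Good (2 * l) (fun n : ℕ => tq N (fun q => Ca q * qs n q.2) p)}) ∪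
      ({p | ¬ Good (2 * l) (fun n : ℕ => tq N (fun q => Cs q * qs n q.1) p)} ∪
        {p | ¬ Good (2 * l) (fun n : ℕ => tq N (fun q => Cs q * qs n q.2) p)}) := by
    intro p hp
    by_contra hcon
    simp only [mem_union, not_or, Set.mem_ofPred_eq, not_not] at hcon
    apply hp
    obtain ⟨⟨g1, g2⟩, g3, g4⟩ := hcon
    have g := ((g1.add g2).add (g3.add g4.neg)).half.neg
    have e : 2 * (2 * l) = lam := by rw [hl]; ring
    rw [e] at g
    convert g using 2 with n
    unfold tqS tq
    rw [← Finset.sum_sub_distrib, ← Finset.sum_add_distrib, ← Finset.sum_neg_distrib, ← Finset.sum_add_distrib,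
      ← Finset.sum_add_distrib, Finset.mul_sum, ← Finset.sum_neg_distrib]
    refine Finset.sum_congr rfl fun q _ => ?_
    have := qs_identity n q.1 q.2
    simp only [hCa, hCs]
    linear_combination (C q * (ee p.1 ^ q.1 * ee p.2 ^ q.2)) * this
  refine (measure_mono hsub).trans ((measure_union_le _ _).trans ((add_le_add
    ((measure_union_le _ _).trans (add_le_add a1 a2)) ((measure_union_le _ _).trans (add_le_add a3 a4))).trans ?_))
  rw [← ENNReal.ofReal_add (by positivity) (by positivity), ← ENNReal.ofReal_add (by positivity) (by positivity),
    ← ENNReal.ofReal_add (by positivity) (by positivity)]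
  apply ENNReal.ofReal_le_ofReal
  rw [le_div_iff₀ (by positivity)]
  have e : (200000000000 * A / l + 200000000000 * A / l + (200000000000 * S / l + 200000000000 * S / l)) * (K * lam)
      = 1600000000000 * (K * A + K * S) := by rw [hl]; field_simp; ring
  rw [e]
  nlinarith

/-! ### L² approximation by trigonometric polynomials -/

def ps1 (x : ℝ) : UnitAddCircle := ((x * (2 * Real.pi)⁻¹ : ℝ) : UnitAddCircle)

lemma mp_scale : MeasurePreserving (fun x : ℝ => x * (2 * Real.pi)⁻¹) mu
    (volume.restrict (Ioc (-(1 / 2) : ℝ) (-(1 / 2) + 1))) := by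
  have hm : Measurable (fun x : ℝ => x * (2 * Real.pi)⁻¹) := by fun_prop
  refine ⟨hm, ?_⟩
  have h2 : (0:ℝ) < (2 * Real.pi)⁻¹ := by positivity
  have hpre : (fun x : ℝ => x * (2 * Real.pi)⁻¹) ⁻¹' (Ico (-(1 / 2) : ℝ) (-(1 / 2) + 1)) = T1 := by
    ext x
    simp only [mem_preimage, mem_Ico, T1, ← div_eq_mul_inv]
    rw [le_div_iff₀ (by positivity), div_lt_iff₀ (by positivity)]
    constructor <;> rintro ⟨a, b⟩ <;> constructor <;> linarith
  rw [mu, Measure.map_smul, ← hpre, ← Measure.restrict_map hm measurableSet_Ico, ← Measure.restrict_smul]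
  have := Real.smul_map_volume_mul_right h2.ne'
  rw [abs_of_pos h2] at this
  rw [this]
  exact restrict_Ico_eq_restrict_Ioc

lemma mp_ps1 : MeasurePreserving ps1 mu AddCircle.haarAddCircle := by
  have h : (volume : Measure UnitAddCircle) = AddCircle.haarAddCircle := by
    rw [AddCircle.volume_eq_smul_haarAddCircle]; simp
  rw [← h]
  exact (UnitAddCircle.measurePreserving_mk (-(1 / 2))).comp mp_scale

section torus
attribute [local instance] instMeasureSpaceUnitAddCircle
local instance : Measure.IsAddHaarMeasure (volume : Measure UnitAddCircle) :=
  inferInstanceAs (Measure.IsAddHaarMeasure AddCircle.haarAddCircle)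
local instance : IsProbabilityMeasure (volume : Measure UnitAddCircle) :=
  inferInstanceAs (IsProbabilityMeasure AddCircle.haarAddCircle)

def ps2 (p : ℝ × ℝ) : UnitAddTorus (Fin 2) := ![ps1 p.1, ps1 p.2]

lemma mp_ps2 : MeasurePreserving ps2 (mu.prod mu) volume := by
  have h1 : MeasurePreserving (Prod.map ps1 ps1) (mu.prod mu) ((volume : Measure UnitAddCircle).prod (volume : Measure UnitAddCircle)) :=
    mp_ps1.prod mp_ps1
  have h2 := (volume_preserving_finTwoArrow UnitAddCircle).symm
  exact h2.comp h1

def ph1 (t : UnitAddCircle) : ℝ := (AddCircle.measurableEquivIco 1 (-(1 / 2)) t : ℝ) * (2 * Real.pi)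

lemma measurable_ph1 : Measurable ph1 := by
  unfold ph1
  exact (measurable_subtype_coe.comp (AddCircle.measurableEquivIco 1 (-(1 / 2))).measurable).mul_const _

lemma ph1_ps1 {x : ℝ} (hx : x ∈ T1) : ph1 (ps1 x) = x := by
  have : x * (2 * Real.pi)⁻¹ ∈ Ico (-(1 / 2) : ℝ) (-(1 / 2) + 1) := by
    simp only [mem_Ico, T1, ← div_eq_mul_inv] at *
    rw [le_div_iff₀ (by positivity), div_lt_iff₀ (by positivity)]
    constructor <;> linarith
  unfold ph1 ps1
  have h2 : (AddCircle.measurableEquivIco 1 (-(1 / 2)) ((x * (2 * Real.pi)⁻¹ : ℝ) : UnitAddCircle) : ℝ) =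
      x * (2 * Real.pi)⁻¹ := congrArg Subtype.val (AddCircle.equivIco_coe_eq this)
  rw [h2]
  field_simp

lemma fourier_ps1 (n : ℤ) (x : ℝ) : fourier n (ps1 x) = ee x ^ n := by
  unfold ps1 ee
  rw [fourier_coe_apply, ← Complex.exp_int_mul]
  congr 1
  push_cast
  have : (Real.pi : ℂ) ≠ 0 := by exact_mod_cast Real.pi_ne_zero
  field_simp

lemma mFourier_ps2 (q : ℤ × ℤ) (p : ℝ × ℝ) :
    UnitAddTorus.mFourier ![q.1, q.2] (ps2 p) = ee p.1 ^ q.1 * ee p.2 ^ q.2 := by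
  rw [← fourier_ps1, ← fourier_ps1]
  exact Fin.prod_univ_two (fun i : Fin 2 => (fourier ((![q.1, q.2] : Fin 2 → ℤ) i) (ps2 p i) : ℂ))

lemma ae_mem_T2 : ∀ᵐ p ∂(mu.prod mu), p ∈ T2 := by
  rw [mu_prod]
  apply Measure.ae_smul_measure
  exact ae_restrict_mem (measurableSet_Ico.prod measurableSet_Ico)

lemma approx_L2 {f : ℝ × ℝ → ℝ} (hf : Measurable f) {M : ℝ} (hM : ∀ p, |f p| ≤ M) {e : ℝ} (he : 0 < e) :
    ∃ N C, ∫ p, ‖(f p : ℂ) - tq N C p‖ ^ 2 ∂(mu.prod mu) ≤ e := by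
  set G : UnitAddTorus (Fin 2) → ℂ := fun t => (f (ph1 (t 0), ph1 (t 1)) : ℂ) with hG
  have hGm : Measurable G := by
    have h0 : Measurable fun t : UnitAddTorus (Fin 2) => ph1 (t 0) := measurable_ph1.comp (measurable_pi_apply 0)
    have h1 : Measurable fun t : UnitAddTorus (Fin 2) => ph1 (t 1) := measurable_ph1.comp (measurable_pi_apply 1)
    exact Complex.measurable_ofReal.comp (hf.comp (h0.prodMk h1))
  have hGp : MemLp G 2 volume := by
    apply MemLp.of_bound hGm.aestronglyMeasurable M
    exact ae_of_all _ fun t => by simp only [hG, Complex.norm_real]; exact hM _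
  set g := hGp.toLp G with hg
  have hs := UnitAddTorus.hasSum_mFourier_series_L2 g
  have hs2 := (Metric.tendsto_nhds.1 hs) (Real.sqrt e) (Real.sqrt_pos.2 he)
  rw [SummationFilter.unconditional_filter, eventually_atTop] at hs2
  obtain ⟨s0, hs0⟩ := hs2
  -- a box containing s0
  obtain ⟨N, hN⟩ : ∃ N : ℕ, ∀ v ∈ s0, ∀ i, v i ∈ bx N := by
    refine ⟨∑ v ∈ s0, ∑ i, (v i).natAbs, fun v hv i => ?_⟩
    have h1 : (v i).natAbs ≤ ∑ i, (v i).natAbs := Finset.single_le_sum (f := fun i => (v i).natAbs) (by simp) (Finset.mem_univ i)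
    have h2 : ∑ i, (v i).natAbs ≤ ∑ v ∈ s0, ∑ i, (v i).natAbs :=
      Finset.single_le_sum (f := fun v : Fin 2 → ℤ => ∑ i, (v i).natAbs) (by simp) hv
    simp only [bx, Finset.mem_Icc]
    omega
  set em : ℤ × ℤ ↪ (Fin 2 → ℤ) := (finTwoArrowEquiv ℤ).symm.toEmbedding with hem
  have hsub : s0 ≤ (bx N ×ˢ bx N).map em := by
    intro v hv
    rw [Finset.mem_map]
    refine ⟨(v 0, v 1), ?_, ?_⟩
    · simp [hN v hv]
    · ext i; fin_cases i <;> rfl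
  have h3 := hs0 _ hsub
  rw [Finset.sum_map] at h3
  set C : ℤ × ℤ → ℂ := fun q => UnitAddTorus.mFourierCoeff g (em q) with hC
  refine ⟨N, C, ?_⟩
  set H : C(UnitAddTorus (Fin 2), ℂ) := ∑ q ∈ bx N ×ˢ bx N, C q • UnitAddTorus.mFourier (em q) with hH
  have h4 : ∑ q ∈ bx N ×ˢ bx N, C q • UnitAddTorus.mFourierLp 2 (em q) = ContinuousMap.toLp 2 volume ℂ H := by
    rw [hH, map_sum]
    refine Finset.sum_congr rfl fun q _ => ?_
    rw [map_smul]
  rw [h4, dist_comm, dist_eq_norm] at h3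
  have h5 : ‖g - ContinuousMap.toLp 2 volume ℂ H‖ ^ 2 ≤ e := by
    rw [← Real.sq_sqrt he.le]
    gcongr
  have h6 : (g - ContinuousMap.toLp 2 volume ℂ H : Lp ℂ 2 volume) =ᵐ[volume] fun t => G t - H t := by
    filter_upwards [Lp.coeFn_sub g (ContinuousMap.toLp 2 volume ℂ H), hGp.coeFn_toLp,
      ContinuousMap.coeFn_toLp (p := 2) (𝕜 := ℂ) volume H] with t h1 h2 h3
    rw [h1, Pi.sub_apply, h3, hg, h2]
  have h7 : ‖g - ContinuousMap.toLp 2 volume ℂ H‖ ^ 2 = ∫ t, ‖G t - H t‖ ^ 2 := by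
    have h8 := inner_self_eq_norm_sq (𝕜 := ℂ) (g - ContinuousMap.toLp 2 volume ℂ H)
    rw [L2.inner_def] at h8
    rw [← h8]
    have h9 : ∫ a, inner ℂ ((g - ContinuousMap.toLp 2 volume ℂ H : Lp ℂ 2 volume) a)
        ((g - ContinuousMap.toLp 2 volume ℂ H : Lp ℂ 2 volume) a) = ∫ t, ((‖G t - H t‖ ^ 2 : ℝ) : ℂ) := by
      apply integral_congr_ae
      filter_upwards [h6] with t ht
      rw [ht, inner_self_eq_norm_sq_to_K]
      norm_cast
    rw [h9, integral_complex_ofReal]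
    exact Complex.ofReal_re _
  rw [h7, ← mp_ps2.map_eq, integral_map mp_ps2.measurable.aemeasurable (by
      exact ((hGm.sub H.continuous.measurable).norm.pow_const 2).aestronglyMeasurable)] at h5
  refine le_trans (le_of_eq ?_) h5
  apply integral_congr_ae
  filter_upwards [ae_mem_T2] with p hp
  have e1 : G (ps2 p) = f p := by
    simp only [hG, ps2, Matrix.cons_val_zero, Matrix.cons_val_one]
    rw [ph1_ps1 hp.1, ph1_ps1 hp.2]
  have e2 : H (ps2 p) = tq N C p := by
    rw [hH, ContinuousMap.sum_apply]
    unfold tq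
    refine Finset.sum_congr rfl fun q _ => ?_
    rw [ContinuousMap.smul_apply, smul_eq_mul, ← mFourier_ps2]
    rfl
  rw [e1, e2]

end torus

lemma tq_re (N : ℕ) (C : ℤ × ℤ → ℂ) (p : ℝ × ℝ) :
    tq N (fun q => (1 / 2) * (C q + (starRingEnd ℂ) (C (-q.1, -q.2)))) p = ((tq N C p).re : ℂ) := by
  have h1 : (starRingEnd ℂ) (tq N C p) = tq N (fun q => (starRingEnd ℂ) (C (-q.1, -q.2))) p := by
    unfold tq
    rw [map_sum, Finset.sum_product, Finset.sum_product, ← sum_bx_neg]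
    refine Finset.sum_congr rfl fun a _ => ?_
    rw [← sum_bx_neg]
    refine Finset.sum_congr rfl fun b _ => ?_
    simp only [map_mul, conj_ee_zpow, neg_neg]
  have h2 := Complex.add_conj (tq N C p)
  have h3 : ((tq N C p).re : ℂ) = 1 / 2 * (tq N C p + (starRingEnd ℂ) (tq N C p)) := by
    rw [h2]; push_cast; ring
  rw [h3, h1]
  unfold tq
  rw [← Finset.sum_add_distrib, Finset.mul_sum]
  refine Finset.sum_congr rfl fun q _ => ?_
  ring

/-! ### approximation in L log L -/

def phi (u : ℝ) : ℝ := |u| * logPlus |u|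

lemma logPlus_mono {u v : ℝ} (h : u ≤ v) : logPlus u ≤ logPlus v := by
  rw [logPlus_eq, logPlus_eq]
  exact Real.log_le_log (by positivity) (max_le_max h le_rfl)

lemma phi_nonneg (u : ℝ) : 0 ≤ phi u := mul_nonneg (abs_nonneg _) (logPlus_nonneg _)

@[fun_prop] lemma continuous_phi : Continuous phi := by unfold phi; fun_prop

lemma phi_mono {u v : ℝ} (h : |u| ≤ |v|) : phi u ≤ phi v :=
  mul_le_mul h (logPlus_mono h) (logPlus_nonneg _) (abs_nonneg _)

lemma logPlus_le {u : ℝ} (hu : 0 ≤ u) : logPlus u ≤ u := by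
  unfold logPlus; split_ifs with h
  · have := Real.log_le_sub_one_of_pos (show 0 < u by linarith); linarith
  · exact hu

lemma phi_le_sq (u : ℝ) : phi u ≤ u ^ 2 := by
  unfold phi
  rw [← sq_abs, sq]
  exact mul_le_mul_of_nonneg_left (logPlus_le (abs_nonneg _)) (abs_nonneg _)

lemma phi_add (a b : ℝ) : phi (a + b) ≤ phi (2 * a) + phi (2 * b) := by
  have h := abs_add_le a b
  rcases le_total |a| |b| with h1 | h1
  · have : phi (a + b) ≤ phi (2 * b) := phi_mono (by rw [abs_mul, abs_two]; linarith)
    linarith [phi_nonneg (2 * a)]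
  · have : phi (a + b) ≤ phi (2 * a) := phi_mono (by rw [abs_mul, abs_two]; linarith)
    linarith [phi_nonneg (2 * b)]

lemma logPlus_mul {a b : ℝ} (ha : 0 ≤ a) (hb : 0 ≤ b) : logPlus (a * b) ≤ logPlus a + logPlus b := by
  rw [logPlus_eq, logPlus_eq, logPlus_eq, ← Real.log_mul (by positivity) (by positivity)]
  apply Real.log_le_log (by positivity)
  apply max_le
  · exact mul_le_mul (le_max_left _ _) (le_max_left _ _) hb (by positivity)
  · exact one_le_mul_of_one_le_of_one_le (le_max_right _ _) (le_max_right _ _)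

lemma phi_scale (K u : ℝ) : phi (K * u) ≤ |K| * logPlus |K| * |u| + |K| * phi u := by
  unfold phi
  rw [abs_mul]
  have := logPlus_mul (abs_nonneg K) (abs_nonneg u)
  have h2 : 0 ≤ |K| * |u| := by positivity
  nlinarith

lemma integrable_phi_scale {f : ℝ × ℝ → ℝ} (hm : Measurable f) (h1 : Integrable f (mu.prod mu))
    (h2 : Integrable (fun p => phi (f p)) (mu.prod mu)) (K : ℝ) :
    Integrable (fun p => phi (K * f p)) (mu.prod mu) := by
  refine Integrable.mono' ((h1.abs.const_mul (|K| * logPlus |K|)).add (h2.const_mul |K|)) ?_ ?_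
  · exact (continuous_phi.measurable.comp (hm.const_mul K)).aestronglyMeasurable
  · refine ae_of_all _ fun p => ?_
    rw [Real.norm_of_nonneg (phi_nonneg _)]
    exact phi_scale _ _

def trunc (f : ℝ × ℝ → ℝ) (n : ℕ) (p : ℝ × ℝ) : ℝ := if |f p| ≤ n then f p else 0

lemma abs_sub_trunc (f : ℝ × ℝ → ℝ) (n : ℕ) (p : ℝ × ℝ) : |f p - trunc f n p| ≤ |f p| := by
  unfold trunc; split_ifs <;> simp

lemma measurable_trunc {f : ℝ × ℝ → ℝ} (hm : Measurable f) (n : ℕ) : Measurable (trunc f n) := by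
  unfold trunc
  exact Measurable.ite (measurableSet_le hm.abs measurable_const) hm measurable_const

lemma trunc_eventually (f : ℝ × ℝ → ℝ) (p : ℝ × ℝ) : ∀ᶠ n : ℕ in atTop, f p - trunc f n p = 0 := by
  obtain ⟨n0, hn0⟩ := exists_nat_ge |f p|
  filter_upwards [eventually_ge_atTop n0] with n hn
  have : |f p| ≤ n := hn0.trans (by exact_mod_cast hn)
  simp [trunc, this]

theorem approx_LlogL {f : ℝ × ℝ → ℝ} (hm : Measurable f) (h1 : Integrable f (mu.prod mu))
    (h2 : Integrable (fun p => phi (f p)) (mu.prod mu)) {K e : ℝ} (hK : 0 < K) (he : 0 < e) :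
    ∃ N C, ∃ h : ℝ × ℝ → ℝ, (∀ p, tq N C p = (h p : ℂ)) ∧ ∫ p, |f p - h p| ∂(mu.prod mu) ≤ e ∧
      Integrable (fun p => phi (K * (f p - h p))) (mu.prod mu) ∧
      ∫ p, phi (K * (f p - h p)) ∂(mu.prod mu) ≤ e := by
  have i2 := integrable_phi_scale hm h1 h2 (2 * K)
  have t1 : Tendsto (fun n => ∫ p, |f p - trunc f n p| ∂(mu.prod mu)) atTop (nhds (∫ p, (0:ℝ) ∂(mu.prod mu))) := by
    apply tendsto_integral_of_dominated_convergence (fun p => |f p|)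
    · exact fun n => (hm.sub (measurable_trunc hm n)).abs.aestronglyMeasurable
    · exact h1.abs
    · intro n; refine ae_of_all _ fun p => ?_
      rw [Real.norm_eq_abs, abs_abs]; exact abs_sub_trunc f n p
    · refine ae_of_all _ fun p => ?_
      apply tendsto_const_nhds.congr'
      filter_upwards [trunc_eventually f p] with n hn
      rw [hn, abs_zero]
  have t2 : Tendsto (fun n => ∫ p, phi ((2 * K) * (f p - trunc f n p)) ∂(mu.prod mu)) atTop
      (nhds (∫ p, (0:ℝ) ∂(mu.prod mu))) := by
    apply tendsto_integral_of_dominated_convergence (fun p => phi ((2 * K) * f p))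
    · exact fun n => (continuous_phi.measurable.comp ((hm.sub (measurable_trunc hm n)).const_mul _)).aestronglyMeasurable
    · exact i2
    · intro n; refine ae_of_all _ fun p => ?_
      rw [Real.norm_of_nonneg (phi_nonneg _)]
      apply phi_mono
      rw [abs_mul (2*K) (f p - _), abs_mul (2*K) (f p)]
      exact mul_le_mul_of_nonneg_left (abs_sub_trunc f n p) (abs_nonneg _)
    · refine ae_of_all _ fun p => ?_
      apply tendsto_const_nhds.congr'
      filter_upwards [trunc_eventually f p] with n hn
      rw [hn, mul_zero]; simp [phi]
  rw [integral_zero] at t1 t2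
  have ev1 := t1.eventually (gt_mem_nhds (show (0:ℝ) < e / 4 by positivity))
  have ev2 := t2.eventually (gt_mem_nhds (show (0:ℝ) < e / 2 by positivity))
  obtain ⟨n, hn1, hn2⟩ := (ev1.and ev2).exists
  set g := trunc f n with hg
  have hgm : Measurable g := measurable_trunc hm n
  have hgb : ∀ p, |g p| ≤ n := by
    intro p; simp only [hg, trunc]; split_ifs with h
    · exact h
    · simp
  set d := min (e ^ 2 / 4) (e / (8 * K ^ 2)) with hd
  have hd0 : 0 < d := by rw [hd]; positivity
  obtain ⟨N, C, hNC⟩ := approx_L2 hgm hgb hd0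
  refine ⟨N, _, fun p => (tq N C p).re, tq_re N C, ?_⟩
  have hhc : Continuous (fun p => (tq N C p).re) := Complex.continuous_re.comp (continuous_tq N C)
  obtain ⟨B, hB⟩ : ∃ B : ℝ, ∀ p, |(tq N C p).re| ≤ B := by
    refine ⟨∑ q ∈ bx N ×ˢ bx N, ‖C q‖, fun p => (Complex.abs_re_le_norm _).trans ?_⟩
    unfold tq
    refine (norm_sum_le _ _).trans (Finset.sum_le_sum fun q _ => ?_)
    simp
  set u : ℝ × ℝ → ℝ := fun p => g p - (tq N C p).re with hu
  have hum : Measurable u := hgm.sub hhc.measurable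
  have hub : ∀ p, |u p| ≤ n + B := fun p => (abs_sub _ _).trans (add_le_add (hgb p) (hB p))
  have iu : Integrable u (mu.prod mu) :=
    Integrable.of_bound hum.aestronglyMeasurable (n + B) (ae_of_all _ hub)
  have iu2 : Integrable (fun p => u p ^ 2) (mu.prod mu) := by
    apply Integrable.of_bound (hum.pow_const 2).aestronglyMeasurable ((n + B) ^ 2) (ae_of_all _ fun p => ?_)
    rw [norm_pow]
    exact pow_le_pow_left₀ (norm_nonneg _) (hub p) 2
  have hu2 : ∫ p, u p ^ 2 ∂(mu.prod mu) ≤ d := by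
    refine le_trans ?_ hNC
    apply integral_mono iu2
    · refine Integrable.of_bound (C := (n + ∑ q ∈ bx N ×ˢ bx N, ‖C q‖) ^ 2) ?_ ?_
      · exact (((Complex.measurable_ofReal.comp hgm).sub
          (continuous_tq N C).measurable).norm.pow_const 2).aestronglyMeasurable
      · refine ae_of_all _ fun p => ?_
        rw [norm_pow, norm_norm]
        apply pow_le_pow_left₀ (norm_nonneg _)
        refine (norm_sub_le _ _).trans (add_le_add ?_ ?_)
        · rw [Complex.norm_real]; exact hgb p
        · unfold tq
          refine (norm_sum_le _ _).trans (Finset.sum_le_sum fun q _ => ?_)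
          simp
    · intro p
      show u p ^ 2 ≤ ‖(g p : ℂ) - tq N C p‖ ^ 2
      rw [← sq_abs]
      apply pow_le_pow_left₀ (abs_nonneg _)
      have : u p = ((g p : ℂ) - tq N C p).re := by simp [hu]
      rw [this]
      exact Complex.abs_re_le_norm _
  have ig : Integrable (fun p => |f p - g p|) (mu.prod mu) :=
    Integrable.mono' h1.abs (hm.sub hgm).abs.aestronglyMeasurable (ae_of_all _ fun p => by
      rw [Real.norm_eq_abs, abs_abs]; exact abs_sub_trunc f n p)
  have igp : Integrable (fun p => phi ((2 * K) * (f p - g p))) (mu.prod mu) :=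
    Integrable.mono' i2 (continuous_phi.measurable.comp ((hm.sub hgm).const_mul _)).aestronglyMeasurable
      (ae_of_all _ fun p => by
        rw [Real.norm_of_nonneg (phi_nonneg _)]
        apply phi_mono
        rw [abs_mul (2*K) (f p - _), abs_mul (2*K) (f p)]
        exact mul_le_mul_of_nonneg_left (abs_sub_trunc f n p) (abs_nonneg _))
  have ic : Integrable (fun _ : ℝ × ℝ => e / 4) (mu.prod mu) := integrable_const _
  have iu3 : Integrable (fun p => u p ^ 2 / e) (mu.prod mu) := iu2.div_const _
  have iu4 : Integrable (fun p => 4 * K ^ 2 * u p ^ 2) (mu.prod mu) := iu2.const_mul _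
  have ibd : Integrable (fun p => phi ((2 * K) * (f p - g p)) + 4 * K ^ 2 * u p ^ 2) (mu.prod mu) := igp.add iu4
  have ptw : ∀ p, phi (K * (f p - (tq N C p).re)) ≤ phi ((2 * K) * (f p - g p)) + 4 * K ^ 2 * u p ^ 2 := by
    intro p
    have e1 : K * (f p - (tq N C p).re) = K * (f p - g p) + K * u p := by simp only [hu]; ring
    have e2 := phi_add (K * (f p - g p)) (K * u p)
    have e3 := phi_le_sq (2 * (K * u p))
    rw [e1, mul_assoc 2 K]
    nlinarith
  have iK : Integrable (fun p => phi (K * (f p - (tq N C p).re))) (mu.prod mu) :=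
    Integrable.mono' ibd
      (continuous_phi.measurable.comp ((hm.sub hhc.measurable).const_mul _)).aestronglyMeasurable
      (ae_of_all _ fun p => by rw [Real.norm_of_nonneg (phi_nonneg _)]; exact ptw p)
  refine ⟨?_, iK, ?_⟩
  · have i5 : Integrable (fun p => e / 4 + u p ^ 2 / e) (mu.prod mu) := ic.add iu3
    have i6 : Integrable (fun p => |f p - g p| + (e / 4 + u p ^ 2 / e)) (mu.prod mu) := ig.add i5
    have : ∫ p, |f p - (tq N C p).re| ∂(mu.prod mu) ≤ ∫ p, (|f p - g p| + (e / 4 + u p ^ 2 / e)) ∂(mu.prod mu) := by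
      apply integral_mono ((h1.sub (integrable_mu2 hhc)).abs) i6
      intro p
      show |f p - (tq N C p).re| ≤ |f p - g p| + (e / 4 + u p ^ 2 / e)
      have e1 : f p - (tq N C p).re = (f p - g p) + u p := by simp only [hu]; ring
      have e2 : |u p| ≤ e / 4 + u p ^ 2 / e := by
        have : e / 4 + u p ^ 2 / e - |u p| = (e / 2 - |u p|) ^ 2 / e := by
          rw [← sq_abs (u p)]; field_simp; ring
        have h0 : 0 ≤ (e / 2 - |u p|) ^ 2 / e := by positivity
        linarith
      rw [e1]
      linarith [abs_add_le (f p - g p) (u p)]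
    rw [integral_add ig i5, integral_add ic iu3, integral_div e (fun p => u p ^ 2)] at this
    simp only [integral_const, probReal_univ, one_smul] at this
    have h7 : (∫ p, u p ^ 2 ∂(mu.prod mu)) / e ≤ e / 4 := by
      rw [div_le_iff₀ he]
      have := min_le_left (e ^ 2 / 4) (e / (8 * K ^ 2))
      nlinarith
    show ∫ p, |f p - (tq N C p).re| ∂(mu.prod mu) ≤ e
    linarith
  · have := integral_mono iK ibd ptw
    rw [integral_add igp iu4, integral_const_mul] at this
    have h7 : 4 * K ^ 2 * (∫ p, u p ^ 2 ∂(mu.prod mu)) ≤ e / 2 := by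
      have h8 := hu2.trans (min_le_right (e ^ 2 / 4) (e / (8 * K ^ 2)))
      rw [le_div_iff₀ (by positivity)] at h8
      linarith
    show ∫ p, phi (K * (f p - (tq N C p).re)) ∂(mu.prod mu) ≤ e
    linarith

/-! Fourier coefficients and extension of the weak-type estimate -/

lemma isClosed_good (lam : ℝ) : IsClosed {f : ℕ → ℂ | Good lam f} := by
  have ha := fun k i => continuous_avC (F := fun f : ℕ → ℂ => f) (fun n => continuous_apply n) k i
  have e : {f : ℕ → ℂ | Good lam f} = ⋂ k : ℕ, ⋂ _ : 1 ≤ k,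
      ({f : ℕ → ℂ | ∑ j ∈ Finset.range (2 ^ k), ‖f j‖ ^ 2 ≤ lam ^ 2 * 2 ^ k} ∩
        ⋂ i : ℕ, {f : ℕ → ℂ | ∑ j ∈ Finset.range (2 ^ k), ‖f (i * 2 ^ k + j) - avC k i f‖ ^ 2 ≤ lam ^ 2 * 2 ^ k}) := by
    ext f
    simp [Good]
  rw [e]
  refine isClosed_iInter fun k => isClosed_iInter fun _ => IsClosed.inter ?_ (isClosed_iInter fun i => ?_)
  · exact isClosed_le (by fun_prop) continuous_const
  · refine isClosed_le ?_ continuous_const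
    have := ha k i
    fun_prop

lemma good_of_limit {lam : ℝ} {F : ℕ → ℕ → ℂ} {f : ℕ → ℂ} (h : ∀ n, Tendsto (fun j => F j n) atTop (nhds (f n)))
    (hf : ∃ᶠ j in atTop, Good lam (F j)) : Good lam f :=
  (isClosed_good lam).mem_of_frequently_of_tendsto hf (tendsto_pi_nhds.mpr h)

def cf (F : ℝ × ℝ → ℂ) (q : ℤ × ℤ) : ℂ := ∫ p, F p * (ee p.1 ^ (-q.1) * ee p.2 ^ (-q.2)) ∂(mu.prod mu)

lemma norm_ee_ee (p : ℝ × ℝ) (a b : ℤ) : ‖ee p.1 ^ a * ee p.2 ^ b‖ = 1 := by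
  simp

lemma continuous_ee_ee (a b : ℤ) : Continuous (fun p : ℝ × ℝ => ee p.1 ^ a * ee p.2 ^ b) :=
  ((continuous_ee_zpow a).comp continuous_fst).mul ((continuous_ee_zpow b).comp continuous_snd)

lemma integrable_cf {F : ℝ × ℝ → ℂ} (hF : Integrable F (mu.prod mu)) (a b : ℤ) :
    Integrable (fun p => F p * (ee p.1 ^ a * ee p.2 ^ b)) (mu.prod mu) := by
  refine hF.mono (hF.aestronglyMeasurable.mul (continuous_ee_ee a b).aestronglyMeasurable) (ae_of_all _ fun p => ?_)
  rw [norm_mul, norm_ee_ee, mul_one]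

lemma cf_sub {F G : ℝ × ℝ → ℂ} (hF : Integrable F (mu.prod mu)) (hG : Integrable G (mu.prod mu)) (q : ℤ × ℤ) :
    cf (fun p => F p - G p) q = cf F q - cf G q := by
  unfold cf
  rw [← integral_sub (integrable_cf hF _ _) (integrable_cf hG _ _)]
  congr 1; ext p; ring

lemma norm_cf_le (F : ℝ × ℝ → ℂ) (q : ℤ × ℤ) : ‖cf F q‖ ≤ ∫ p, ‖F p‖ ∂(mu.prod mu) := by
  unfold cf
  refine (norm_integral_le_integral_norm _).trans (le_of_eq ?_)
  congr 1; ext p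
  rw [norm_mul, norm_ee_ee, mul_one]

lemma tq_sub (N : ℕ) (C D : ℤ × ℤ → ℂ) (p : ℝ × ℝ) : tq N (fun q => C q - D q) p = tq N C p - tq N D p := by
  unfold tq
  rw [← Finset.sum_sub_distrib]
  exact Finset.sum_congr rfl fun q _ => by ring

lemma norm_tq_cf_le (n : ℕ) (F : ℝ × ℝ → ℂ) (p : ℝ × ℝ) :
    ‖tq n (cf F) p‖ ≤ ((bx n ×ˢ bx n).card : ℝ) * ∫ p, ‖F p‖ ∂(mu.prod mu) := by
  unfold tq
  refine (norm_sum_le _ _).trans ?_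
  rw [← nsmul_eq_mul]
  refine Finset.sum_le_card_nsmul _ _ _ fun q _ => ?_
  rw [norm_mul, norm_ee_ee, mul_one]
  exact norm_cf_le F q

lemma cf_tq (N : ℕ) (C : ℤ × ℤ → ℂ) (q : ℤ × ℤ) :
    cf (tq N C) q = if q ∈ bx N ×ˢ bx N then C q else 0 := by
  unfold cf tq
  simp only [Finset.sum_mul]
  rw [integral_finsetSum]
  · have : ∀ r ∈ bx N ×ˢ bx N, ∫ p, C r * (ee p.1 ^ r.1 * ee p.2 ^ r.2) * (ee p.1 ^ (-q.1) * ee p.2 ^ (-q.2)) ∂(mu.prod mu)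
        = if q = r then C r else 0 := by
      intro r _
      have e : (fun p : ℝ × ℝ => C r * (ee p.1 ^ r.1 * ee p.2 ^ r.2) * (ee p.1 ^ (-q.1) * ee p.2 ^ (-q.2))) =
          fun p => C r * ((ee p.1 ^ (-q.1) * ee p.1 ^ r.1) * (ee p.2 ^ (-q.2) * ee p.2 ^ r.2)) := by
        ext p; ring
      rw [e, integral_const_mul,
        integral_prod_mul (fun x => ee x ^ (-q.1) * ee x ^ r.1) (fun x => ee x ^ (-q.2) * ee x ^ r.2),
        ee_zpow_orth, ee_zpow_orth]
      by_cases h1 : q.1 = r.1 <;> by_cases h2 : q.2 = r.2 <;> simp [h1, h2, Prod.ext_iff]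
    rw [Finset.sum_congr rfl this, Finset.sum_ite_eq]
  · intro r _
    exact integrable_mu2 ((continuous_const.mul (continuous_ee_ee _ _)).mul (continuous_ee_ee _ _))

lemma tq_cf_tq (N : ℕ) (C : ℤ × ℤ → ℂ) (n : ℕ) (p : ℝ × ℝ) : tq n (cf (tq N C)) p = tqS N C n p := by
  unfold tqS
  simp only [tq.eq_1 n, tq.eq_1 N (fun q => C q * _), cf_tq]
  have e1 : ∀ q, (if q ∈ bx N ×ˢ bx N then C q else 0) * (ee p.1 ^ q.1 * ee p.2 ^ q.2) =
      if q ∈ bx N ×ˢ bx N then C q * (ee p.1 ^ q.1 * ee p.2 ^ q.2) else 0 := by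
    intro q; split_ifs <;> simp
  have e2 : ∀ q : ℤ × ℤ, (C q * (if (-(n:ℤ) ≤ q.1 ∧ q.1 ≤ n) ∧ (-(n:ℤ) ≤ q.2 ∧ q.2 ≤ n) then (1:ℂ) else 0)) *
      (ee p.1 ^ q.1 * ee p.2 ^ q.2) =
      if q ∈ bx n ×ˢ bx n then C q * (ee p.1 ^ q.1 * ee p.2 ^ q.2) else 0 := by
    intro q
    simp only [bx, Finset.mem_product, Finset.mem_Icc]
    split_ifs <;> simp
  simp only [e1, e2]
  rw [Finset.sum_ite_mem, Finset.sum_ite_mem, Finset.inter_comm]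

lemma bx_mono {N M : ℕ} (h : N ≤ M) : bx N ⊆ bx M := by
  intro a; simp only [bx, Finset.mem_Icc]; omega

lemma tq_ext {N M : ℕ} (h : N ≤ M) (C : ℤ × ℤ → ℂ) (p : ℝ × ℝ) :
    tq M (fun q => if q ∈ bx N ×ˢ bx N then C q else 0) p = tq N C p := by
  unfold tq
  simp only [ite_mul, zero_mul]
  rw [Finset.sum_ite_mem, Finset.inter_eq_right.mpr (Finset.product_subset_product (bx_mono h) (bx_mono h))]

lemma tqS_eventually {N n : ℕ} (h : N ≤ n) (C : ℤ × ℤ → ℂ) (p : ℝ × ℝ) : tqS N C n p = tq N C p := by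
  rw [← tq_cf_tq, ← tq_ext h C p]
  congr 1; ext q; exact cf_tq N C q

lemma fourierCoef2_eq (f : ℝ × ℝ → ℝ) (a b : ℤ) : fourierCoef2 f a b = cf (fun p => (f p : ℂ)) (a, b) := by
  unfold fourierCoef2 cf
  rw [mu_prod, integral_smul_measure]
  have e : ∀ p : ℝ × ℝ, Complex.exp (-Complex.I * ((a : ℂ) * (p.1 : ℂ) + (b : ℂ) * (p.2 : ℂ))) =
      ee p.1 ^ (-a) * ee p.2 ^ (-b) := by
    intro p
    unfold ee
    rw [← Complex.exp_int_mul, ← Complex.exp_int_mul, ← Complex.exp_add]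
    congr 1; push_cast; ring
  have k : kap2.toReal = 1 / (4 * Real.pi ^ 2) := by
    unfold kap2
    rw [ENNReal.toReal_mul, ENNReal.toReal_ofReal (by positivity)]
    field_simp; norm_num
  simp only [e, k]
  rw [Complex.real_smul]
  push_cast; rfl

lemma Snn_eq (f : ℝ × ℝ → ℝ) (n : ℕ) (x y : ℝ) : Snn f n x y = (tq n (cf (fun p => (f p : ℂ))) (x, y)).re := by
  unfold Snn tq
  rw [Finset.sum_product]
  congr 1
  refine Finset.sum_congr rfl fun a _ => Finset.sum_congr rfl fun b _ => ?_
  rw [fourierCoef2_eq]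
  congr 1
  unfold ee
  rw [← Complex.exp_int_mul, ← Complex.exp_int_mul, ← Complex.exp_add]
  congr 1; push_cast; ring

lemma measurable_tq_cf (F : ℝ × ℝ → ℂ) (n : ℕ) : Measurable (tq n (cf F)) := (continuous_tq _ _).measurable

theorem weak_f {g : ℝ × ℝ → ℝ} (hi : Integrable g (mu.prod mu)) {K lam : ℝ} (hK : 0 < K)
    (hlam : 0 < lam) (N : ℕ → ℕ) (C : ℕ → ℤ × ℤ → ℂ) (h : ℕ → ℝ × ℝ → ℝ)
    (hh : ∀ j p, tq (N j) (C j) p = (h j p : ℂ))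
    (hconv : Tendsto (fun j => ∫ p, |h j p - g p| ∂(mu.prod mu)) atTop (nhds 0))
    (hb : ∀ j, ∫ p, phi (K * h j p) ∂(mu.prod mu) ≤ 1) :
    (mu.prod mu) {p | ¬ Good lam (fun n : ℕ => (((tq n (cf (fun p => (g p : ℂ))) p).re - g p : ℝ) : ℂ))} ≤
      ENNReal.ofReal (3200000000000 * 5 / (K * lam)) := by
  have hhe : ∀ j, h j = fun p => (tq (N j) (C j) p).re := fun j => by ext p; rw [hh]; simp
  have hhc : ∀ j, Continuous (h j) := fun j => by
    rw [hhe j]; exact Complex.continuous_re.comp (continuous_tq _ _)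
  have hhi : ∀ j, Integrable (h j) (mu.prod mu) := fun j => integrable_mu2 (hhc j)
  have hmeas : TendstoInMeasure (mu.prod mu) h atTop g := by
    apply tendstoInMeasure_of_tendsto_eLpNorm (p := 1) one_ne_zero (fun j => (hhi j).aestronglyMeasurable)
      hi.aestronglyMeasurable
    have e : ∀ j, eLpNorm (h j - g) 1 (mu.prod mu) = ENNReal.ofReal (∫ p, |h j p - g p| ∂(mu.prod mu)) := by
      intro j
      rw [eLpNorm_one_eq_lintegral_enorm, ← ofReal_integral_norm_eq_lintegral_enorm ((hhi j).sub hi)]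
      rfl
    simp only [e]
    have := ENNReal.tendsto_ofReal hconv
    rwa [ENNReal.ofReal_zero] at this
  obtain ⟨ns, hns, hae⟩ := hmeas.exists_seq_tendsto_ae
  set B : ℕ → Set (ℝ × ℝ) := fun j => {p | ¬ Good lam (fun n : ℕ => tqS (N j) (C j) n p - tq (N j) (C j) p)} with hB
  have hBm : ∀ j, (mu.prod mu) (B j) ≤ ENNReal.ofReal (3200000000000 * 5 / (K * lam)) := by
    intro j
    refine (weak_tq (N j) (C j) (hh j) hK hlam).trans (ENNReal.ofReal_le_ofReal ?_)
    have e : ∫ p, K * |h j p| * logPlus (K * |h j p|) ∂(mu.prod mu) ≤ 1 := by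
      refine le_trans (le_of_eq ?_) (hb j)
      congr 1; ext p
      unfold phi
      rw [abs_mul, abs_of_pos hK]
    gcongr
    linarith
  set D : ℕ → Set (ℝ × ℝ) := fun J => ⋂ j ≥ J, B (ns j) with hD
  have hDmono : Monotone D := by
    intro a b hab p hp
    simp only [hD, mem_iInter] at hp ⊢
    exact fun j hj => hp j (le_trans hab hj)
  have hDm : (mu.prod mu) (⋃ J, D J) ≤ ENNReal.ofReal (3200000000000 * 5 / (K * lam)) := by
    rw [hDmono.measure_iUnion]
    refine iSup_le fun J => (measure_mono ?_).trans (hBm (ns J))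
    intro p hp
    simp only [hD, mem_iInter] at hp
    exact hp J le_rfl
  refine le_trans (measure_mono_ae ?_) hDm
  filter_upwards [hae] with p hp hbad
  by_contra hcon
  apply hbad
  have hfreq : ∃ᶠ j in atTop, Good lam
      (fun n : ℕ => (((tqS (N (ns j)) (C (ns j)) n p - tq (N (ns j)) (C (ns j)) p).re : ℝ) : ℂ)) := by
    rw [frequently_atTop]
    intro J
    have : p ∉ D J := fun hx => hcon (mem_iUnion.mpr ⟨J, hx⟩)
    simp only [hD, hB, mem_iInter, not_forall] at this
    obtain ⟨j, hj, hg⟩ := this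
    refine ⟨j, hj, Good.re ?_⟩
    by_contra h'
    exact hg h'
  refine good_of_limit ?_ hfreq
  intro n
  refine (Complex.continuous_ofReal.tendsto _).comp ?_
  have t1 : Tendsto (fun j => tq n (cf (tq (N (ns j)) (C (ns j)))) p) atTop
      (nhds (tq n (cf (fun p => (g p : ℂ))) p)) := by
    rw [tendsto_iff_norm_sub_tendsto_zero]
    have t0 := (hconv.comp hns.tendsto_atTop).const_mul ((bx n ×ˢ bx n).card : ℝ)
    rw [mul_zero] at t0
    refine squeeze_zero (fun _ => norm_nonneg _) (fun j => ?_) t0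
    have e1 : cf (fun p' => tq (N (ns j)) (C (ns j)) p' - (g p' : ℂ)) =
        fun q => cf (tq (N (ns j)) (C (ns j))) q - cf (fun p => (g p : ℂ)) q := by
      ext q; exact cf_sub (integrable_mu2 (continuous_tq _ _)) hi.ofReal q
    rw [← tq_sub, ← e1]
    refine (norm_tq_cf_le n _ p).trans (le_of_eq ?_)
    simp only [Function.comp]
    congr 2; ext p'
    rw [hh, ← Complex.ofReal_sub, Complex.norm_real, Real.norm_eq_abs]
  have t2 : Tendsto (fun j => tqS (N (ns j)) (C (ns j)) n p) atTop (nhds (tq n (cf (fun p => (g p : ℂ))) p)) := by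
    refine t1.congr fun j => tq_cf_tq _ _ _ _
  have t3 : Tendsto (fun j => (tqS (N (ns j)) (C (ns j)) n p).re - h (ns j) p) atTop
      (nhds ((tq n (cf (fun p => (g p : ℂ))) p).re - g p)) :=
    ((Complex.continuous_re.tendsto _).comp t2).sub hp
  refine t3.congr fun j => ?_
  rw [Complex.sub_re, hh, Complex.ofReal_re]

/-! Almost everywhere statement and the deterministic conclusion -/

lemma phi_neg (u : ℝ) : phi (-u) = phi u := by simp [phi]

lemma weak_K {f : ℝ × ℝ → ℝ} (hm : Measurable f) (h1 : Integrable f (mu.prod mu))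
    (h2 : Integrable (fun p => phi (f p)) (mu.prod mu)) {K lam : ℝ} (hK : 0 < K) (hlam : 0 < lam) :
    (mu.prod mu) {p | ¬ ∃ η : ℕ → ℝ, Good lam (fun n => (η n : ℂ)) ∧
      ∀ᶠ n : ℕ in atTop, η n = Snn f n p.1 p.2 - f p} ≤ ENNReal.ofReal (3200000000000 * 5 / (K * lam)) := by
  obtain ⟨N0, C0, h0, hh0, hi0, hp0, hb0⟩ := approx_LlogL hm h1 h2 (K := 2 * K) (e := 1 / 2) (by positivity) (by norm_num)
  have hA := fun j : ℕ => approx_LlogL hm h1 h2 (K := 2 * K) (e := min (1 / 2) (1 / ((j:ℝ) + 1))) (by positivity)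
    (by positivity)
  choose N C h hh hi hp hb using hA
  have ch0 : Continuous h0 := by
    have : h0 = fun p => (tq N0 C0 p).re := by ext p; rw [hh0]; simp
    rw [this]; exact Complex.continuous_re.comp (continuous_tq _ _)
  have ch : ∀ j, Continuous (h j) := fun j => by
    have : h j = fun p => (tq (N j) (C j) p).re := by ext p; rw [hh]; simp
    rw [this]; exact Complex.continuous_re.comp (continuous_tq _ _)
  have i0 : Integrable h0 (mu.prod mu) := integrable_mu2 ch0
  have ig : Integrable (fun p => f p - h0 p) (mu.prod mu) := h1.sub i0
  have key := weak_f (g := fun p => f p - h0 p) ig hK hlam (fun j => max (N j) N0)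
    (fun j q => (if q ∈ bx (N j) ×ˢ bx (N j) then C j q else 0) - (if q ∈ bx N0 ×ˢ bx N0 then C0 q else 0))
    (fun j p => h j p - h0 p) ?_ ?_ ?_
  · refine le_trans (measure_mono ?_) key
    intro p hpp hgood
    apply hpp
    refine ⟨_, hgood, ?_⟩
    filter_upwards [eventually_ge_atTop N0] with n hn
    rw [Snn_eq]
    have e1 : cf (fun p => ((f p - h0 p : ℝ) : ℂ)) = fun q => cf (fun p => (f p : ℂ)) q - cf (tq N0 C0) q := by
      ext q
      rw [← cf_sub (F := fun p => (f p : ℂ)) (G := tq N0 C0) h1.ofReal (integrable_mu2 (continuous_tq _ _))]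
      congr 1; ext p; rw [hh0]; push_cast; rfl
    rw [e1, tq_sub, tq_cf_tq, tqS_eventually hn, hh0, Complex.sub_re, Complex.ofReal_re]
    ring
  · intro j p
    rw [tq_sub, tq_ext (le_max_left _ _), tq_ext (le_max_right _ _), hh, hh0]
    push_cast; rfl
  · refine squeeze_zero (fun j => integral_nonneg fun p => abs_nonneg _) (fun j => ?_)
      tendsto_one_div_add_atTop_nhds_zero_nat
    refine le_trans (le_of_eq ?_) ((hi j).trans (min_le_right _ _))
    congr 1; ext p
    rw [abs_sub_comm]; congr 1; ring
  · intro j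
    have i3 : Integrable (fun p => phi (2 * K * (f p - h j p)) + phi (2 * K * (f p - h0 p))) (mu.prod mu) :=
      (hp j).add hp0
    have ptw : ∀ p, phi (K * (h j p - h0 p)) ≤ phi (2 * K * (f p - h j p)) + phi (2 * K * (f p - h0 p)) := by
      intro p
      have := phi_add (-(K * (f p - h j p))) (K * (f p - h0 p))
      rw [mul_neg, phi_neg, ← mul_assoc, ← mul_assoc] at this
      refine le_trans (le_of_eq ?_) this
      congr 1; ring
    have i4 : Integrable (fun p => phi (K * (h j p - h0 p))) (mu.prod mu) :=
      integrable_mu2 (continuous_phi.comp (continuous_const.mul ((ch j).sub ch0)))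
    have := integral_mono i4 i3 ptw
    rw [integral_add (hp j) hp0] at this
    have h5 := (hb j).trans (min_le_left _ _)
    show ∫ p, phi (K * (h j p - h0 p)) ∂(mu.prod mu) ≤ 1
    linarith

lemma main_ae {f : ℝ × ℝ → ℝ} (hm : Measurable f) (h1 : Integrable f (mu.prod mu))
    (h2 : Integrable (fun p => phi (f p)) (mu.prod mu)) :
    ∀ᵐ p ∂(mu.prod mu), ∀ l : ℕ, ∃ η : ℕ → ℝ, Good (1 / ((l:ℝ) + 1)) (fun n => (η n : ℂ)) ∧
      ∀ᶠ n : ℕ in atTop, η n = Snn f n p.1 p.2 - f p := by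
  rw [ae_all_iff]
  intro l
  rw [ae_iff]
  refine le_antisymm ?_ zero_le
  have t : Tendsto (fun i : ℕ => ENNReal.ofReal (3200000000000 * 5 / (((i:ℝ) + 1) * (1 / ((l:ℝ) + 1))))) atTop (nhds 0) := by
    rw [← ENNReal.ofReal_zero]
    apply ENNReal.tendsto_ofReal
    have := (tendsto_one_div_add_atTop_nhds_zero_nat (𝕜 := ℝ)).const_mul (3200000000000 * 5 * ((l:ℝ) + 1))
    rw [mul_zero] at this
    refine this.congr fun i => ?_
    field_simp
  exact ge_of_tendsto' t fun i => weak_K hm h1 h2 (by positivity) (by positivity)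

lemma psi_bound {ψ : ℝ → ℝ} (hnonneg : ∀ u, 0 ≤ u → 0 ≤ ψ u) (hmono : MonotoneOn ψ (Ici 0)) (hzero : ψ 0 = 0)
    (hlim0 : Tendsto ψ (nhdsWithin 0 (Ioi 0)) (nhds 0))
    (hgrowth : ∃ C : ℝ, ∀ᶠ u in atTop, Real.log (ψ u) ≤ C * u) {ε : ℝ} (hε : 0 < ε) :
    ∃ A D δ : ℝ, 0 < δ ∧ 0 < D ∧ ∀ t, A ≤ t → ∀ u, 0 ≤ u →
      ψ u ≤ ε / 2 + D * Real.exp (-((t - A) * δ)) * Real.exp (t * u) := by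
  obtain ⟨C, hC⟩ := hgrowth
  obtain ⟨U0, hU0⟩ := eventually_atTop.mp hC
  have he := hlim0.eventually (gt_mem_nhds (show (0:ℝ) < ε / 2 by positivity))
  obtain ⟨d, hd0, hd⟩ := mem_nhdsGT_iff_exists_Ioo_subset.mp he
  have hd0' : (0:ℝ) < d := hd0
  set U := max U0 0
  set A := max C 0
  set D := max 1 (ψ U)
  have hD1 : 1 ≤ D := le_max_left _ _
  have hA0 : 0 ≤ A := le_max_right _ _
  refine ⟨A, D, d / 2, by positivity, by linarith, fun t ht u hu => ?_⟩
  have hpos : 0 ≤ D * Real.exp (-((t - A) * (d / 2))) * Real.exp (t * u) := by positivity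
  by_cases hud : u ≤ d / 2
  · rcases hu.eq_or_lt with h | h
    · have h3 : ψ u = 0 := by rw [← h, hzero]
      linarith
    · have : u ∈ Ioo 0 d := ⟨h, by linarith⟩
      have h3 : ψ u < ε / 2 := hd this
      linarith
  · push Not at hud
    have h4 : ψ u ≤ D * Real.exp (A * u) := by
      rcases le_total U u with h | h
      · have h5 := hU0 u ((le_max_left _ _).trans h)
        have h6 : ψ u ≤ Real.exp (A * u) := by
          rcases (hnonneg u hu).eq_or_lt with h7 | h7
          · rw [← h7]; positivity
          · rw [← Real.log_le_iff_le_exp h7]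
            exact h5.trans (mul_le_mul_of_nonneg_right (le_max_left _ _) hu)
        have := Real.exp_pos (A * u)
        nlinarith
      · have h5 : ψ u ≤ ψ U := hmono hu (hu.trans h) h
        have h6 : ψ U ≤ D := le_max_right _ _
        have h7 : 1 ≤ Real.exp (A * u) := Real.one_le_exp (by positivity)
        nlinarith
    have h5 : D * Real.exp (A * u) ≤ D * Real.exp (-((t - A) * (d / 2))) * Real.exp (t * u) := by
      rw [mul_assoc, ← Real.exp_add]
      apply mul_le_mul_of_nonneg_left _ (by linarith)
      apply Real.exp_le_exp.mpr
      nlinarith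
    linarith

lemma avg_exp {l : ℕ} {η : ℕ → ℝ} (hg : Good (1 / ((l:ℝ) + 1)) (fun n => (η n : ℂ))) (m : ℕ) :
    ∑ n ∈ Finset.range (m + 1), Real.exp ((((l:ℝ) + 1) / 5) * |η n|) ≤ 12 * ((m:ℝ) + 1) := by
  set t : ℝ := ((l:ℝ) + 1) / 5 with ht
  have ht0 : 0 < t := by positivity
  have g1 := hg.smul (t : ℂ)
  have e1 : ‖(t : ℂ)‖ * (1 / ((l:ℝ) + 1)) = 1 / 5 := by
    rw [Complex.norm_real, Real.norm_of_nonneg ht0.le, ht]; field_simp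
  rw [e1] at g1
  have g2 : Good (1 / 5) (fun n => ((t * η n : ℝ) : ℂ)) := by
    simpa using g1
  have g3 := good_exp g2 (k := Nat.log 2 (m + 1) + 1) (by omega)
  have a1 : m + 1 < 2 ^ (Nat.log 2 (m + 1) + 1) := Nat.lt_pow_succ_log_self (by norm_num) _
  have a2 : 2 ^ (Nat.log 2 (m + 1)) ≤ m + 1 := Nat.pow_log_le_self 2 (by omega)
  have a3 : (2:ℝ) ^ (Nat.log 2 (m + 1)) ≤ (m:ℝ) + 1 := by exact_mod_cast a2
  have s1 : ∑ n ∈ Finset.range (m + 1), Real.exp (t * |η n|) ≤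
      ∑ n ∈ Finset.range (2 ^ (Nat.log 2 (m + 1) + 1)), Real.exp |t * η n| := by
    have : ∀ n, Real.exp |t * η n| = Real.exp (t * |η n|) := fun n => by rw [abs_mul, abs_of_pos ht0]
    simp only [this]
    apply Finset.sum_le_sum_of_subset_of_nonneg
    · exact Finset.range_subset_range.mpr a1.le
    · intro i _ _; positivity
  have a4 : (2:ℝ) ^ (Nat.log 2 (m + 1) + 1) = 2 ^ (Nat.log 2 (m + 1)) * 2 := pow_succ _ _
  rw [a4] at g3
  linarith

lemma deterministic {ψ : ℝ → ℝ} (hnonneg : ∀ u, 0 ≤ u → 0 ≤ ψ u) (hmono : MonotoneOn ψ (Ici 0)) (hzero : ψ 0 = 0)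
    (hlim0 : Tendsto ψ (nhdsWithin 0 (Ioi 0)) (nhds 0))
    (hgrowth : ∃ C : ℝ, ∀ᶠ u in atTop, Real.log (ψ u) ≤ C * u) {ξ : ℕ → ℝ}
    (h : ∀ l : ℕ, ∃ η : ℕ → ℝ, Good (1 / ((l:ℝ) + 1)) (fun n => (η n : ℂ)) ∧ ∀ᶠ n : ℕ in atTop, η n = ξ n) :
    Tendsto (fun m : ℕ => (1 / ((m:ℝ) + 1)) * ∑ n ∈ Finset.range (m + 1), ψ |ξ n|) atTop (nhds 0) := by
  rw [Metric.tendsto_atTop]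
  intro ε hε
  obtain ⟨A, D, δ, hδ, hD, hψ⟩ := psi_bound hnonneg hmono hzero hlim0 hgrowth hε
  obtain ⟨l, hl⟩ := exists_nat_ge (5 * (|A| + 48 * D / (ε * δ)))
  obtain ⟨η, hη, hev⟩ := h l
  obtain ⟨M, hM⟩ := eventually_atTop.mp hev
  set t : ℝ := ((l:ℝ) + 1) / 5 with ht
  have htA : A + 48 * D / (ε * δ) ≤ t := by
    rw [ht]; linarith [le_abs_self A]
  have hp0 : 0 < 48 * D / (ε * δ) := by positivity
  have hy : 48 * D / ε ≤ (t - A) * δ := by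
    have : 48 * D / ε = 48 * D / (ε * δ) * δ := by field_simp
    rw [this]
    apply mul_le_mul_of_nonneg_right _ hδ.le
    linarith
  set E := D * Real.exp (-((t - A) * δ)) with hE
  have hE0 : 0 < E := by positivity
  have hE12 : 12 * E ≤ ε / 4 := by
    have h1 := Real.add_one_le_exp ((t - A) * δ)
    have h2 : 48 * D ≤ ε * Real.exp ((t - A) * δ) := by
      rw [div_le_iff₀ hε] at hy
      nlinarith
    rw [hE, Real.exp_neg]
    have h3 := Real.exp_pos ((t - A) * δ)
    rw [← div_eq_mul_inv, mul_div_assoc', div_le_iff₀ h3]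
    linarith
  set d : ℕ → ℝ := fun n => |ψ (|ξ n|) - ψ (|η n|)| with hd
  set R := ∑ n ∈ Finset.range M, d n with hR
  have hdR : ∀ m, ∑ n ∈ Finset.range m, d n ≤ R := by
    intro m
    have e : ∑ n ∈ Finset.range m, d n ≤ ∑ n ∈ Finset.range (max m M), d n :=
      Finset.sum_le_sum_of_subset_of_nonneg (Finset.range_subset_range.mpr (le_max_left _ _)) fun _ _ _ => abs_nonneg _
    refine e.trans (le_of_eq (Finset.sum_subset (Finset.range_subset_range.mpr (le_max_right _ _)) ?_).symm)
    intro n _ hn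
    rw [Finset.mem_range, not_lt] at hn
    simp [hd, hM n hn]
  obtain ⟨m0, hm0⟩ := exists_nat_gt (4 * R / ε)
  refine ⟨m0, fun m hm => ?_⟩
  have hmm : (m0:ℝ) ≤ m := by exact_mod_cast hm
  have hm1 : (0:ℝ) < (m:ℝ) + 1 := by positivity
  have hs0 : 0 ≤ ∑ n ∈ Finset.range (m + 1), ψ |ξ n| := Finset.sum_nonneg fun n _ => hnonneg _ (abs_nonneg _)
  have hs : ∑ n ∈ Finset.range (m + 1), ψ |ξ n| ≤ ((m:ℝ) + 1) * (ε / 2) + E * (12 * ((m:ℝ) + 1)) + R := by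
    have h1 : ∑ n ∈ Finset.range (m + 1), ψ |ξ n| ≤
        ∑ n ∈ Finset.range (m + 1), (ε / 2 + E * Real.exp (t * |η n|) + d n) := by
      apply Finset.sum_le_sum
      intro n _
      have h2 := hψ t (by linarith) |η n| (abs_nonneg _)
      have h3 := le_abs_self (ψ |ξ n| - ψ |η n|)
      simp only [hd]
      linarith
    rw [Finset.sum_add_distrib, Finset.sum_add_distrib, ← Finset.mul_sum, Finset.sum_const, Finset.card_range,
      nsmul_eq_mul] at h1
    push_cast at h1
    have h4 := mul_le_mul_of_nonneg_left (avg_exp hη m) hE0.le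
    have h5 := hdR (m + 1)
    linarith
  have hRm : R < ((m:ℝ) + 1) * (ε / 4) := by
    rw [div_lt_iff₀ hε] at hm0
    nlinarith
  rw [Real.dist_eq, sub_zero, abs_of_nonneg (by positivity), one_div, inv_mul_lt_iff₀ hm1]
  nlinarith

lemma ae_T2 {P : ℝ × ℝ → Prop} (h : ∀ᵐ p ∂(mu.prod mu), P p) : ∀ᵐ p ∂(volume.restrict T2), P p := by
  rw [mu_prod] at h
  rw [ae_iff, Measure.smul_apply, smul_eq_mul, mul_eq_zero] at h
  exact h.resolve_left kap2_ne_zero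

lemma integrable_T2 {F : ℝ × ℝ → ℝ} (h : IntegrableOn F T2) : Integrable F (mu.prod mu) := by
  rw [mu_prod]
  exact Integrable.smul_measure h kap2_ne_top

/-- Theorem 3: if `ψ : [0,∞) → [0,∞)` is increasing, `ψ(0) = 0`,
`lim_{u→0⁺} ψ(u) = 0` and `limsup_{u→∞} log ψ(u) / u < ∞`, then for every
`f ∈ L log L(𝕋²)`, for a.e. `(x,y) ∈ 𝕋²`,
`lim_{m→∞} (1/(m+1)) Σ_{n=0}^m ψ(|S_{nn}(x,y,f) - f(x,y)|) = 0`. -/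
theorem ae_psi_summability (ψ : ℝ → ℝ)
    (hnonneg : ∀ u : ℝ, 0 ≤ u → 0 ≤ ψ u)
    (hmono : MonotoneOn ψ (Set.Ici 0))
    (hzero : ψ 0 = 0)
    (hlim0 : Filter.Tendsto ψ (nhdsWithin 0 (Set.Ioi 0)) (nhds 0))
    (hgrowth : ∃ C : ℝ, ∀ᶠ u in Filter.atTop, Real.log (ψ u) ≤ C * u)
    (f : ℝ × ℝ → ℝ)
    (hmeas : Measurable f) (hper : Biperiodic f)
    (hint : IntegrableOn f T2)
    (hlog : IntegrableOn (fun p => |f p| * logPlus |f p|) T2) :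
    ∀ᵐ p ∂(volume.restrict T2),
      Filter.Tendsto
        (fun m : ℕ =>
          (1 / ((m : ℝ) + 1)) * ∑ n ∈ Finset.range (m + 1),
            ψ (|Snn f n p.1 p.2 - f p|))
        Filter.atTop (nhds 0) := by
  refine ae_T2 ?_
  filter_upwards [main_ae hmeas (integrable_T2 hint) (integrable_T2 hlog)] with p hp
  exact deterministic hnonneg hmono hzero hlim0 hgrowth hp
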